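/- The four-color Ramsey number satisfies R(C_4, C_4, K_3, K_4) ≤ 75; that is, every coloring of the edges of the complete graph on 75 vertices with colors 1, 2, 3, 4 contains a cycle of length 4 in color 1 or in color 2, a triangle in color 3, or a complete subgraph on 4 vertices in color 4. -/

import Mathlib

open SimpleGraph

/-- A graph bundled with its vertex type. -/
structure VGraph : Type 1 where
  V : Type
  G : SimpleGraph V

/-- The cycle `C₄` as a bundled graph. -/
def C4 : VGraph := ⟨Fin 4, SimpleGraph.cycleGraph 4⟩

/-- The path `P₃` (on 3 vertices) as a bundled graph. -/
def P3 : VGraph := ⟨Fin 3, SimpleGraph.pathGraph 3⟩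

/-- The complete graph `K_k` as a bundled graph. -/
def Kc (k : ℕ) : VGraph := ⟨Fin k, ⊤⟩

/-- The star `K_{1,k}`: vertex `0` is the center, joined to the `k` leaves. -/
def starGraph (k : ℕ) : SimpleGraph (Fin (k + 1)) :=
  SimpleGraph.fromRel (fun u _ => u = 0)

/-- The book `B_k = K₂ + kK₁`: vertices `0, 1` form the spine, joined
to everything; the `k` pages are pairwise nonadjacent. -/
def bookGraph (k : ℕ) : SimpleGraph (Fin (k + 2)) :=
  SimpleGraph.fromRel (fun u _ => u.val < 2)

/-- Deletion of a vertex (with all incident edges) from a bundled graph. -/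
def VGraph.delete (X : VGraph) (w : X.V) : VGraph :=
  ⟨{v : X.V // v ≠ w}, X.G.induce {v | v ≠ w}⟩

/-- Disjoint union with a single isolated vertex, `G ∪ K₁`. -/
def VGraph.addK1 (X : VGraph) : VGraph :=
  ⟨Option X.V, SimpleGraph.fromRel (fun u v => ∃ a b, u = some a ∧ v = some b ∧ X.G.Adj a b)⟩

/-- `ramseyProp l N` : every coloring of the edges of the complete graph on `N`
vertices with `l.length` colors admits, for some color `i`, a subgraph isomorphic
to the `i`-th graph of `l` all of whose edges have color `i`. -/
def ramseyProp (l : List VGraph) (N : ℕ) : Prop :=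
  ∀ c : Sym2 (Fin N) → Fin l.length,
    ∃ (i : Fin l.length) (f : (l.get i).V ↪ Fin N),
      ∀ u v, (l.get i).G.Adj u v → c s(f u, f v) = i

/-- The Ramsey number of a list of graphs: the least positive `N`
satisfying `ramseyProp l N`. -/
noncomputable def ramseyNumber (l : List VGraph) : ℕ :=
  sInf {N | 0 < N ∧ ramseyProp l N}

namespace R75
set_option maxRecDepth 100000

/-! ## Kernel-friendly search -/

noncomputable def frc (n : Nat) (k : Nat → Bool) : Bool :=
  @Nat.rec (fun _ => Bool) (k 0) (fun m _ => k m) (Nat.add n 1)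
noncomputable def ifb (b t e : Bool) : Bool := @Bool.rec (fun _ => Bool) e t b
noncomputable def ifn (b : Bool) (t e : Nat) : Nat := @Bool.rec (fun _ => Nat) e t b

def adj (A i : Nat) : Nat := Nat.land (Nat.shiftRight A (Nat.mul 8 i)) 255
def tb (n i : Nat) : Bool := Nat.beq (Nat.land (Nat.shiftRight n i) 1) 1

noncomputable def twoL (A a : Nat) (l : List Nat) : Nat :=
  @List.rec Nat (fun _ => Nat) 0
    (fun x _ ih => ifn (tb a x) (Nat.lor (adj A x) ih) ih) l
noncomputable def two (A i : Nat) : Nat := twoL A (adj A i) [0, 1, 2, 3, 4, 5, 6, 7]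
def addE (A i j : Nat) : Nat :=
  Nat.lor A (Nat.lor (Nat.shiftLeft 1 (Nat.add (Nat.mul 8 i) j)) (Nat.shiftLeft 1 (Nat.add (Nat.mul 8 j) i)))
def addC (C c i j : Nat) : Nat :=
  Nat.lor C (Nat.lor (Nat.shiftLeft c (Nat.add (Nat.mul 16 i) (Nat.mul 2 j)))
    (Nat.shiftLeft c (Nat.add (Nat.mul 16 j) (Nat.mul 2 i))))
noncomputable def okE (A i j : Nat) : Bool := Nat.beq (Nat.land (two A i) (adj A j)) 0
noncomputable def okT (A i j : Nat) : Bool := Nat.beq (Nat.land (adj A i) (adj A j)) 0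

noncomputable def wt (A3 AO AS mo ms : Nat) (l : List Nat) : Nat :=
  @List.rec Nat (fun _ => Nat) 0 (fun w _ acc =>
    Nat.add (Nat.add
      (ifn (Nat.beq (Nat.land (Nat.lor (adj AO w) (adj A3 w)) mo) mo) 3 0)
      (ifn (Nat.beq (Nat.land (Nat.lor (Nat.lor (adj AS w) (adj A3 w)) (Nat.shiftLeft 1 w)) ms) ms) 1 0))
      acc) l

def sg (s i : Nat) : Nat := Nat.land (Nat.shiftRight s (Nat.mul 4 i)) 15
def colAt (C i j : Nat) : Nat := Nat.land (Nat.shiftRight C (Nat.add (Nat.mul 16 i) (Nat.mul 2 j))) 3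

inductive EL | nil | cons (i j : Nat) (t : EL)

noncomputable def lexok (C s : Nat) (l : EL) : Bool :=
  @EL.rec (fun _ => Bool) true (fun i j _ ih =>
    (fun a b : Nat => ifb (Nat.beq a 0) true (ifb (Nat.beq b 0) true
      (ifb (Nat.beq a b) ih (Nat.ble a b)))) (colAt C i j) (colAt C (sg s i) (sg s j))) l

noncomputable def lexall (C : Nat) (l : EL) (ss : List Nat) : Bool :=
  @List.rec Nat (fun _ => Bool) true (fun s _ ih => ifb (lexok C s l) ih false) ss

inductive Step | e (i j : Nat) | chk (ss : List Nat)

structure Cfg where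
  l1 : List Nat
  l2 : List Nat
  m1 : Nat
  m2 : Nat
  bnd : Nat
  el : EL

noncomputable def chkW (c : Cfg) (ss : List Nat) (A1 A2 A3 C : Nat) : Bool :=
  @Cfg.rec (fun _ => Bool) (fun l1 l2 m1 m2 bnd el =>
    ifb (Nat.ble (Nat.add (wt A3 A1 A2 m2 m1 l1) (wt A3 A2 A1 m1 m2 l2)) bnd) (lexall C el ss) false) c

noncomputable def dfs (leaf : Nat → Nat → Nat → Nat → Bool) (c : Cfg) (l : List Step) :
    Nat → Nat → Nat → Nat → Bool :=
  @List.rec Step (fun _ => Nat → Nat → Nat → Nat → Bool)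
    leaf
    (fun s _ ih => @Step.rec (fun _ => Nat → Nat → Nat → Nat → Bool)
      (fun i j A1 A2 A3 C =>
        ifb (ifb (okE A1 i j) (frc (addE A1 i j) fun A => frc (addC C 1 i j) fun C => ih A A2 A3 C) false) true
        (ifb (ifb (okE A2 i j) (frc (addE A2 i j) fun A => frc (addC C 2 i j) fun C => ih A1 A A3 C) false) true
        (ifb (okT A3 i j) (frc (addE A3 i j) fun A => frc (addC C 3 i j) fun C => ih A1 A2 A C) false)))
      (fun ss A1 A2 A3 C => ifb (chkW c ss A1 A2 A3 C) (ih A1 A2 A3 C) false) s) l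

inductive IL | nil | cons (i a1 a2 a3 b1 b2 : Nat) (t : IL)

noncomputable def mkIL (A1 A2 A3 : Nat) (l : List Nat) : IL → (IL → Bool) → Bool :=
  @List.rec Nat (fun _ => IL → (IL → Bool) → Bool) (fun acc k => k acc)
   (fun i _ ih acc k => frc (adj A1 i) fun a1 => frc (adj A2 i) fun a2 => frc (adj A3 i) fun a3 =>
      frc (two A1 i) fun b1 => frc (two A2 i) fun b2 => ih (IL.cons i a1 a2 a3 b1 b2 acc) k) l
noncomputable def rowsN (I : IL) : Nat → Nat → Nat → Nat → Nat → Nat → (Nat → Nat → Bool) → Bool :=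
  @IL.rec (fun _ => Nat → Nat → Nat → Nat → Nat → Nat → (Nat → Nat → Bool) → Bool)
   (fun _ _ _ Z acc N k => frc (Nat.add (Nat.mul N Z) acc) fun acc => frc (Nat.mul N 374144419156711147060143317175368453031918731001856) (k acc))
   (fun i a1 a2 a3 b1 b2 _ ih S1 S2 S3 Z acc N k =>
     (fun k1 : Nat → Nat → Bool => ifb (Nat.beq (Nat.land S1 b1) 0)
       (frc (Nat.lor S1 (Nat.shiftLeft 1 i)) fun S1' =>
         ih S1' S2 S3 (Nat.lor Z (Nat.lor (Nat.shiftLeft S1 (Nat.add (Nat.mul 8 i) 32)) (Nat.lor (Nat.shiftLeft 1 i) (Nat.shiftLeft a1 16)))) acc N k1) (k1 acc N))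
     fun acc N =>
     (fun k1 : Nat → Nat → Bool => ifb (Nat.beq (Nat.land S2 b2) 0)
       (frc (Nat.lor S2 (Nat.shiftLeft 1 i)) fun S2' =>
         ih S1 S2' S3 (Nat.lor Z (Nat.lor (Nat.shiftLeft S2 (Nat.add (Nat.mul 8 i) 96)) (Nat.lor (Nat.shiftLeft 1 (Nat.add i 8)) (Nat.shiftLeft a2 24)))) acc N k1) (k1 acc N))
     fun acc N =>
     (ifb (Nat.beq (Nat.land S3 a3) 0)
       (frc (Nat.lor S3 (Nat.shiftLeft 1 i)) fun S3' => ih S1 S2 S3' Z acc N k) (k acc N))) I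
inductive CL | nil | cons (Z pos : Nat) (t : CL)
inductive FL | nil | cons (F1 F2 : Nat) (o : Bool) (t : FL)
noncomputable def tcomb (fl : FL) : CL → Nat :=
  @FL.rec (fun _ => CL → Nat) (fun _ => 1461501637330902918203684832716283019655932542976) (fun F1 F2 _ _ ih cl => @CL.rec (fun _ => Nat) 1461501637330902918203684832716283019655932542976
    (fun Z _ t _ => Nat.lor (Nat.lor (Nat.land Z F1) (Nat.land (Nat.shiftRight Z 16) F2)) (ih t)) cl) fl
noncomputable def bnd (fl : FL) : CL → Nat → Nat :=
  @FL.rec (fun _ => CL → Nat → Nat) (fun _ D => D) (fun _ _ o _ ih cl D => @CL.rec (fun _ => Nat) D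
    (fun _ pos t _ => ih t (ifn o (Nat.mod D (Nat.mul 2 pos)) D)) cl) fl
noncomputable def bits (fuel : Nat) (k : Nat → Bool) : Nat → Bool :=
  @Nat.rec (fun _ => Nat → Bool) (fun _ => true)
    (fun _ ih D => ifb (Nat.beq D 0) false (frc (Nat.div (Nat.add (Nat.xor D (Nat.sub D 1)) 1) 2) fun pos =>
       ifb (k pos) true (frc (Nat.xor D pos) ih))) fuel
noncomputable def goN (ZZ ONES LOW HIGH ALL : Nat) (P : List FL) : CL → Bool :=
  @List.rec FL (fun _ => CL → Bool) (fun _ => true)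
   (fun fl _ ih cl =>
     frc (bnd fl cl (Nat.xor ALL (Nat.mod (Nat.land (Nat.add (Nat.land ZZ (Nat.mul (tcomb fl cl) ONES)) LOW) HIGH) 187072209578355573530071658587684226515959365500927)))
     (bits 200 (fun pos => frc (Nat.mod (Nat.div ZZ (Nat.pow pos 168)) 374144419156711147060143317175368453031918731001856)
       fun Z => ih (CL.cons Z pos cl)))) P
noncomputable def anyP (ZZ ONES LOW HIGH ALL : Nat) (Ps : List (List FL)) : Bool :=
  @List.rec (List FL) (fun _ => Bool) false (fun P _ ih => ifb (goN ZZ ONES LOW HIGH ALL P CL.nil) true ih) Ps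
noncomputable def leafN (l : List Nat) (pats : List (List FL)) (A1 A2 A3 _C : Nat) : Bool :=
  frc A1 fun A1 => frc A2 fun A2 => frc A3 fun A3 => mkIL A1 A2 A3 l .nil fun I => rowsN I 0 0 0 0
    (Nat.add 1461501637330902918203684832716283019655932542976 (Nat.mod (Nat.add A1 (Nat.mul 3 A2)) 1461501637330902918203684832716283019655932542976)) 374144419156711147060143317175368453031918731001856 fun ZZ NN =>
  ifb (Nat.ble NN (Nat.pow 2 27000)) (frc (Nat.div (Nat.sub NN 1) (Nat.sub (Nat.pow 2 168) 1)) fun ONES =>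
  frc (Nat.mul ONES (Nat.sub (Nat.pow 2 167) 1)) fun LOW =>
  frc (Nat.mul ONES (Nat.pow 2 167)) fun HIGH =>
   frc (Nat.mod HIGH 187072209578355573530071658587684226515959365500927) fun ALL =>
   anyP ZZ ONES LOW HIGH ALL pats) true

inductive QL | nil | cons (a1 a2 a3 c : Nat) (t : QL)
noncomputable def notMem (l : QL) (A1 A2 A3 C : Nat) : Bool :=
  @QL.rec (fun _ => Bool) true (fun a1 a2 a3 c _ ih =>
    ifb (Nat.beq C c) (ifb (Nat.beq A1 a1) (ifb (Nat.beq A2 a2) (ifb (Nat.beq A3 a3) false ih) ih) ih) ih) l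
def P5 : List (List FL) := [ [.nil,
  .cons 1461501637330902918203684832716283019651637575935 255 true (.nil),
  .cons 1461501637330902918203684832716283019651637641215 255 false (.cons 1461501637330902918203684832716283019651637641215 255 false (.nil)),
  .cons 1461501637330902918203684832716283019651637641215 65280 false (.cons 1461501637330902918203684832716283019651637575935 65280 false (.cons 1461501637330902918203684832716283019651637640960 255 false (.nil))),
  .cons 1461501637330902918203684832716283019651637640960 65280 false (.cons 1461501637330902918203684832716283019651637641215 65280 false (.cons 1461501637330902918203684832716283019651637640960 255 false (.cons 1461501637330902918203684832716283019651637575935 65280 false (.nil))))],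
 [.nil,
  .cons 1461501637330902918203684832716283019651637640960 255 true (.nil),
  .cons 1461501637330902918203684832716283019651637575935 65280 true (.cons 1461501637330902918203684832716283019651637640960 255 true (.nil)),
  .cons 1461501637330902918203684832716283019651637575935 65280 false (.cons 1461501637330902918203684832716283019651637640960 255 false (.cons 1461501637330902918203684832716283019651637575935 65280 true (.nil))),
  .cons 1461501637330902918203684832716283019651637640960 255 false (.cons 1461501637330902918203684832716283019651637640960 255 false (.cons 1461501637330902918203684832716283019651637575935 65280 false (.cons 1461501637330902918203684832716283019651637575935 65280 true (.nil))))] ]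
def P4 : List (List FL) := [ [.nil,
  .cons 1461501637330902918203684832716283019651637640960 255 false (.nil),
  .cons 1461501637330902918203684832716283019651637641215 65280 true (.cons 1461501637330902918203684832716283019651637640960 255 false (.nil)),
  .cons 1461501637330902918203684832716283019651637640960 65280 false (.cons 1461501637330902918203684832716283019651637640960 65280 false (.cons 1461501637330902918203684832716283019651637575680 65280 false (.nil)))],
 [.nil,
  .cons 1461501637330902918203684832716283019651637575680 255 false (.nil),
  .cons 1461501637330902918203684832716283019651637641215 65280 true (.cons 1461501637330902918203684832716283019651637575680 255 false (.nil)),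
  .cons 1461501637330902918203684832716283019651637641215 65280 true (.cons 1461501637330902918203684832716283019651637641215 65280 false (.cons 1461501637330902918203684832716283019651637575680 255 false (.nil)))],
 [.nil,
  .cons 1461501637330902918203684832716283019651637575680 255 true (.nil),
  .cons 1461501637330902918203684832716283019651637575935 65280 false (.cons 1461501637330902918203684832716283019651637640960 255 false (.nil)),
  .cons 1461501637330902918203684832716283019651637575680 65280 false (.cons 1461501637330902918203684832716283019651637640960 255 false (.cons 1461501637330902918203684832716283019651637575935 65280 false (.nil)))],
 [.nil,
  .cons 1461501637330902918203684832716283019651637575935 65280 false (.nil),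
  .cons 1461501637330902918203684832716283019651637641215 255 true (.cons 1461501637330902918203684832716283019651637575935 65280 false (.nil)),
  .cons 1461501637330902918203684832716283019651637575935 255 false (.cons 1461501637330902918203684832716283019651637575935 255 false (.cons 1461501637330902918203684832716283019651637575680 255 false (.nil)))],
 [.nil,
  .cons 1461501637330902918203684832716283019651637575680 65280 false (.nil),
  .cons 1461501637330902918203684832716283019651637641215 255 true (.cons 1461501637330902918203684832716283019651637575680 65280 false (.nil)),
  .cons 1461501637330902918203684832716283019651637641215 255 true (.cons 1461501637330902918203684832716283019651637641215 255 false (.cons 1461501637330902918203684832716283019651637575680 65280 false (.nil)))] ]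
end R75

namespace R75
set_option maxRecDepth 100000
def cfg06 : Cfg := ⟨[], [1, 2, 3, 4, 5, 6], 0, 126, 4,
  (.cons 1 2 (.cons 1 3 (.cons 1 4 (.cons 1 5 (.cons 1 6 (.cons 2 3 (.cons 2 4 (.cons 2 5 (.cons 2 6 (.cons 3 4 (.cons 3 5 (.cons 3 6 (.cons 4 5 (.cons 4 6 (.cons 5 6 .nil)))))))))))))))⟩
def steps06 : List Step := [.chk [], .e 1 2, .e 1 3, .e 1 4, .e 1 5, .e 1 6, .e 2 3, .e 2 4, .e 2 5, .e 2 6, .e 3 4, .e 3 5, .e 3 6, .e 4 5, .e 4 6, .e 5 6, .chk []]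
theorem run06 : dfs (fun _ _ _ _ => true) cfg06 steps06 0 282578800148862 0 158458742917061955551399914152 = false := by decide +kernel

def cfg15 : Cfg := ⟨[1], [2, 3, 4, 5, 6], 2, 124, 4,
  (.cons 1 2 (.cons 1 3 (.cons 1 4 (.cons 1 5 (.cons 1 6 (.cons 2 3 (.cons 2 4 (.cons 2 5 (.cons 2 6 (.cons 3 4 (.cons 3 5 (.cons 3 6 (.cons 4 5 (.cons 4 6 (.cons 5 6 .nil)))))))))))))))⟩
def steps15 : List Step := [.e 1 2, .e 1 3, .e 1 4, .e 1 5, .e 1 6, .chk [1985225488, 1985098768, 1982084368, 1918121488, 1985167888, 1983140368, 1934909968, 1984246288, 1951805968, 1969500688], .chk [1985225488, 1985098768, 1982084368, 1918121488, 1985167888, 1983140368, 1934909968, 1984246288, 1951805968, 1969500688], .e 2 3, .e 2 4, .e 2 5, .e 2 6, .e 3 4, .e 3 5, .e 3 6, .e 4 5, .e 4 6, .e 5 6, .chk [1985225488, 1985098768, 1982084368, 1918121488, 1985167888, 1983140368, 1934909968, 1984246288, 1951805968, 1969500688]]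
theorem run15 : dfs (fun _ _ _ _ => true) cfg15 steps15 258 282578800148604 0 158458742917061955551399848612 = false := by decide +kernel

def cfg07 : Cfg := ⟨[], [1, 2, 3, 4, 5, 6, 7], 0, 254, 2,
  (.cons 1 2 (.cons 1 3 (.cons 1 4 (.cons 1 5 (.cons 1 6 (.cons 1 7 (.cons 2 3 (.cons 2 4 (.cons 2 5 (.cons 2 6 (.cons 2 7 (.cons 3 4 (.cons 3 5 (.cons 3 6 (.cons 3 7 (.cons 4 5 (.cons 4 6 (.cons 4 7 (.cons 5 6 (.cons 5 7 (.cons 6 7 .nil)))))))))))))))))))))⟩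
def steps07 : List Step := [.chk [], .e 1 2, .e 1 3, .e 1 4, .e 1 5, .e 1 6, .e 1 7, .e 2 3, .e 2 4, .e 2 5, .e 2 6, .e 2 7, .e 3 4, .e 3 5, .e 3 6, .e 3 7, .e 4 5, .e 4 6, .e 4 7, .e 5 6, .e 5 7, .e 6 7, .chk []]
theorem run07 : dfs (fun _ _ _ _ => true) cfg07 steps07 0 72340172838076926 0 10384752175812572319016544058387112 = false := by decide +kernel

def cfg16 : Cfg := ⟨[1], [2, 3, 4, 5, 6, 7], 2, 252, 2,
  (.cons 1 2 (.cons 1 3 (.cons 1 4 (.cons 1 5 (.cons 1 6 (.cons 1 7 (.cons 2 3 (.cons 2 4 (.cons 2 5 (.cons 2 6 (.cons 2 7 (.cons 3 4 (.cons 3 5 (.cons 3 6 (.cons 3 7 (.cons 4 5 (.cons 4 6 (.cons 4 7 (.cons 5 6 (.cons 5 7 (.cons 6 7 .nil)))))))))))))))))))))⟩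
def steps16 : List Step := [.e 1 2, .e 1 3, .e 1 4, .e 1 5, .e 1 6, .e 1 7, .chk [1985225488, 1985098768, 1982084368, 1918121488, 643053328, 1985167888, 1983140368, 1934909968, 911503888, 1984246288, 1951805968, 1180119568, 1969500688, 1450455568, 1733571088], .chk [1985225488, 1985098768, 1982084368, 1918121488, 643053328, 1985167888, 1983140368, 1934909968, 911503888, 1984246288, 1951805968, 1180119568, 1969500688, 1450455568, 1733571088], .e 2 3, .e 2 4, .e 2 5, .e 2 6, .e 2 7, .e 3 4, .e 3 5, .e 3 6, .e 3 7, .e 4 5, .e 4 6, .e 4 7, .e 5 6, .e 5 7, .e 6 7, .chk [1985225488, 1985098768, 1982084368, 1918121488, 643053328, 1985167888, 1983140368, 1934909968, 911503888, 1984246288, 1951805968, 1180119568, 1969500688, 1450455568, 1733571088]]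
theorem run16 : dfs (fun _ _ _ _ => true) cfg16 steps16 258 72340172838076668 0 10384752175812572319016544058321572 = false := by decide +kernel

def cfg05 : Cfg := ⟨[], [1, 2, 3, 4, 5], 0, 62, 0,
  (.cons 1 2 (.cons 1 3 (.cons 1 4 (.cons 1 5 (.cons 2 3 (.cons 2 4 (.cons 2 5 (.cons 3 4 (.cons 3 5 (.cons 4 5 .nil))))))))))⟩
def steps05 : List Step := [.chk [], .e 1 2, .e 1 3, .e 1 4, .e 1 5, .e 2 3, .e 2 4, .e 2 5, .e 3 4, .e 3 5, .e 4 5, .chk []]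
theorem run05 : dfs (fun _ _ _ _ => true) cfg05 steps05 0 1103823438142 0 2417888533280364312005288 = false := by decide +kernel

def cfg14 : Cfg := ⟨[1], [2, 3, 4, 5], 2, 60, 0,
  (.cons 1 2 (.cons 1 3 (.cons 1 4 (.cons 1 5 (.cons 2 3 (.cons 2 4 (.cons 2 5 (.cons 3 4 (.cons 3 5 (.cons 4 5 .nil))))))))))⟩
def steps14 : List Step := [.e 1 2, .e 1 3, .e 1 4, .e 1 5, .chk [1985225488, 1985098768, 1982084368, 1985167888, 1983140368, 1984246288], .chk [1985225488, 1985098768, 1982084368, 1985167888, 1983140368, 1984246288], .e 2 3, .e 2 4, .e 2 5, .e 3 4, .e 3 5, .e 4 5, .chk [1985225488, 1985098768, 1982084368, 1985167888, 1983140368, 1984246288]]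
theorem run14 : dfs (fun _ _ _ _ => true) cfg14 steps14 258 1103823437884 0 2417888533280364311939748 = false := by decide +kernel

def cfg23 : Cfg := ⟨[1, 2], [3, 4, 5], 6, 56, 0,
  (.cons 1 3 (.cons 1 4 (.cons 1 5 (.cons 2 3 (.cons 2 4 (.cons 2 5 (.cons 1 2 (.cons 3 4 (.cons 3 5 (.cons 4 5 .nil))))))))))⟩
def steps23 : List Step := [.e 1 3, .e 1 4, .e 1 5, .chk [1985229088, 1985167888, 1983140368, 1984246288], .e 2 3, .e 2 4, .e 2 5, .chk [1985229088, 1985167888, 1983140368, 1984246288], .e 1 2, .chk [1985229088, 1985167888, 1983140368, 1984246288], .e 3 4, .e 3 5, .e 4 5, .chk [1985229088, 1985167888, 1983140368, 1984246288]]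
theorem run23 : dfs (fun _ _ _ _ => true) cfg23 steps23 65798 1103823372344 0 2417888533280360016972436 = false := by decide +kernel

def cfg25 : Cfg := ⟨[1, 2], [3, 4, 5, 6, 7], 6, 248, 2,
  (.cons 1 3 (.cons 1 4 (.cons 1 5 (.cons 1 6 (.cons 1 7 (.cons 2 3 (.cons 2 4 (.cons 2 5 (.cons 2 6 (.cons 2 7 (.cons 1 2 (.cons 3 4 (.cons 3 5 (.cons 3 6 (.cons 3 7 (.cons 4 5 (.cons 4 6 (.cons 4 7 (.cons 5 6 (.cons 5 7 (.cons 6 7 .nil)))))))))))))))))))))⟩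
def steps25 : List Step := [.e 1 3, .e 1 4, .e 1 5, .e 1 6, .e 1 7, .chk [1985229088, 1985167888, 1983140368, 1934909968, 911503888, 1984246288, 1951805968, 1180119568, 1969500688, 1450455568, 1733571088], .e 2 3, .e 2 4, .e 2 5, .e 2 6, .e 2 7, .chk [1985229088, 1985167888, 1983140368, 1934909968, 911503888, 1984246288, 1951805968, 1180119568, 1969500688, 1450455568, 1733571088], .e 1 2, .chk [1985229088, 1985167888, 1983140368, 1934909968, 911503888, 1984246288, 1951805968, 1180119568, 1969500688, 1450455568, 1733571088], .e 3 4, .e 3 5, .e 3 6, .e 3 7, .e 4 5, .e 4 6, .e 4 7, .e 5 6, .e 5 7, .e 6 7, .chk [1985229088, 1985167888, 1983140368, 1934909968, 911503888, 1984246288, 1951805968, 1180119568, 1969500688, 1450455568, 1733571088]]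
theorem run25 : dfs (fun _ _ _ _ => true) cfg25 steps25 65798 72340172838011128 0 10384752175812572319016539763354260 = false := by decide +kernel

end R75

namespace R75
set_option maxRecDepth 100000

def cfg33 : Cfg := ⟨[1, 2, 3], [4, 5, 6], 14, 112, 4,
  (.cons 1 4 (.cons 1 5 (.cons 1 6 (.cons 2 4 (.cons 2 5 (.cons 2 6 (.cons 3 4 (.cons 3 5 (.cons 3 6 (.cons 1 2 (.cons 1 3 (.cons 2 3 (.cons 4 5 (.cons 4 6 (.cons 5 6 .nil)))))))))))))))⟩
def pre33 : List Step := [.e 1 4, .e 1 5, .e 1 6, .chk [1985229088, 1985221168, 1985225488, 1984246288, 1951805968, 1969500688], .e 2 4, .e 2 5, .e 2 6, .chk [1985229088, 1985221168, 1985225488, 1984246288, 1951805968, 1969500688], .e 3 4, .e 3 5, .e 3 6, .chk [1985229088, 1985221168, 1985225488, 1984246288, 1951805968, 1969500688], .chk [1969500688, 1984246288, 1952789008, 1967534608, 1951805968, 1985225488, 1969496848, 1984242448, 1952785168, 1967530768, 1951802128, 1985229088, 1969500448, 1984246048, 1952788768, 1967534368, 1951805728, 1985221408, 1969492768, 1984238368,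 1952781088, 1967526688, 1951798048, 1985225008, 1969496368, 1984241968, 1952784688, 1967530288, 1951801648, 1985221168, 1969492528, 1984238128, 1952780848, 1967526448, 1951797808]]
def post33 : List Step := [.e 1 2, .e 1 3, .e 2 3, .chk [1985229088, 1985221168, 1985225488, 1984246288, 1951805968, 1969500688], .e 4 5, .e 4 6, .e 5 6, .chk [1985229088, 1985221168, 1985225488, 1984246288, 1951805968, 1969500688], .chk [1969500688, 1984246288, 1952789008, 1967534608, 1951805968, 1985225488, 1969496848, 1984242448, 1952785168, 1967530768, 1951802128, 1985229088, 1969500448, 1984246048, 1952788768, 1967534368, 1951805728, 1985221408, 1969492768, 1984238368, 1952781088, 1967526688, 1951798048, 1985225008, 1969496368, 1984241968, 1952784688, 1967530288, 1951801648, 1985221168, 1969492528, 1984238128, 1952780848, 1967526448, 1951797808]]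
def ql33 : QL := (.cons 565157583483150 282630592397424 3390895476965376 19490425377327279683504271600212
  (.cons 565157583483150 291392594116720 3382133475246080 19490348007255199795172387924564
  (.cons 1128107541082382 845580545835120 2264995565928448 17272036826927878195700937337428
  (.cons 1128107541082382 854342547554416 2256233564209152 17271959456855798307369053661780
  (.cons 1128107541082382 3097346805088368 13229306675200 12201434427194471346520966900308
  (.cons 1128107541082382 845545917661296 2265030194102272 17272036828108541874012386568788
  (.cons 2207630045454 845580545835120 3390895476965376 19807338027384337033878715837012
  (.cons 2207630045454 854342547554416 3382133475246080 19807260657312257145546832161364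
  (.cons 2254008517472526 845545917661296 1139129217712128 9666133226736859657207325731412
  (.cons 2207630045454 3097346805088368 1139129217712128 14736735627650930184698745399892
  (.cons 1128107541082382 3097329624170608 13246487592960 12201434427489619252799831353940
  (.cons 2207630045454 4223229535207536 13246487592960 13469085027717848671888720603732
  (.cons 1128107541082382 282630592397424 2827945519366144 17588949476984935546075381574228
  (.cons 1128107541082382 291392594116720 2819183517646848 17588872106912855657743497898580
  (.cons 1128107541082382 2534396851650672 576179260112896 12518347077251528696895411137108
  (.cons 2256207542817038 284829615661168 1697646494367744 9983012025690304110857403050580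
  (.cons 4406655389966 284829615661168 3949447381794816 20124216827518445165840242387540
  (.cons 2256207542817038 284794987487344 1697681122541568 9983012026870967789168852281940
  (.cons 4406655389966 2536595874914416 1697681122541568 15053614427785038316660271950420
  (.cons 1125908517818638 284829615661168 2827945519366144 17588954312688214004592147507796
  (.cons 1134705147711758 2536595874914416 567382630219776 12518197170449320022125511256660
  (.cons 1134705147711758 284794987487344 2819183517646848 17588799571363390549616930925140
  (.cons 1125908517818638 293591617380464 2819183517646848 17588876942616134116260263832148
  (.cons 1125908517818638 2536595874914416 576179260112896 12518351912954807155412177070676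
  (.cons 2251809494208782 293591617380464 1693282541256704 9982973341244451899455202994772
  (.cons 2256207542817038 293574436462704 1688901673566208 9982934655913372128804383828564
  (.cons 1125908517818638 297972485070960 2814802649956352 17588857600098168184074286475860
  .nil)))))))))))))))))))))))))))
theorem pre_run33 : dfs (notMem ql33) cfg33 pre33 16843022 282578783305840 0 158458742917061674072128170580 = false := by decide +kernel
theorem run33_0 : dfs (leafN [6, 5, 4, 3, 2, 1] P5) cfg33 post33 565157583483150 282630592397424 3390895476965376 19490425377327279683504271600212 = false := by decide +kernel
theorem run33_1 : dfs (leafN [6, 5, 4, 3, 2, 1] P5) cfg33 post33 565157583483150 291392594116720 3382133475246080 19490348007255199795172387924564 = false := by decide +kernel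
theorem run33_2 : dfs (leafN [6, 5, 4, 3, 2, 1] P5) cfg33 post33 1128107541082382 845580545835120 2264995565928448 17272036826927878195700937337428 = false := by decide +kernel
theorem run33_3 : dfs (leafN [6, 5, 4, 3, 2, 1] P5) cfg33 post33 1128107541082382 854342547554416 2256233564209152 17271959456855798307369053661780 = false := by decide +kernel
theorem run33_4 : dfs (leafN [6, 5, 4, 3, 2, 1] P5) cfg33 post33 1128107541082382 3097346805088368 13229306675200 12201434427194471346520966900308 = false := by decide +kernel
theorem run33_5 : dfs (leafN [6, 5, 4, 3, 2, 1] P5) cfg33 post33 1128107541082382 845545917661296 2265030194102272 17272036828108541874012386568788 = false := by decide +kernel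
theorem run33_6 : dfs (leafN [6, 5, 4, 3, 2, 1] P5) cfg33 post33 2207630045454 845580545835120 3390895476965376 19807338027384337033878715837012 = false := by decide +kernel
theorem run33_7 : dfs (leafN [6, 5, 4, 3, 2, 1] P5) cfg33 post33 2207630045454 854342547554416 3382133475246080 19807260657312257145546832161364 = false := by decide +kernel
theorem run33_8 : dfs (leafN [6, 5, 4, 3, 2, 1] P5) cfg33 post33 2254008517472526 845545917661296 1139129217712128 9666133226736859657207325731412 = false := by decide +kernel
theorem run33_9 : dfs (leafN [6, 5, 4, 3, 2, 1] P5) cfg33 post33 2207630045454 3097346805088368 1139129217712128 14736735627650930184698745399892 = false := by decide +kernel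
theorem run33_10 : dfs (leafN [6, 5, 4, 3, 2, 1] P5) cfg33 post33 1128107541082382 3097329624170608 13246487592960 12201434427489619252799831353940 = false := by decide +kernel
theorem run33_11 : dfs (leafN [6, 5, 4, 3, 2, 1] P5) cfg33 post33 2207630045454 4223229535207536 13246487592960 13469085027717848671888720603732 = false := by decide +kernel
theorem run33_12 : dfs (leafN [6, 5, 4, 3, 2, 1] P5) cfg33 post33 1128107541082382 282630592397424 2827945519366144 17588949476984935546075381574228 = false := by decide +kernel
theorem run33_13 : dfs (leafN [6, 5, 4, 3, 2, 1] P5) cfg33 post33 1128107541082382 291392594116720 2819183517646848 17588872106912855657743497898580 = false := by decide +kernel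
theorem run33_14 : dfs (leafN [6, 5, 4, 3, 2, 1] P5) cfg33 post33 1128107541082382 2534396851650672 576179260112896 12518347077251528696895411137108 = false := by decide +kernel
theorem run33_15 : dfs (leafN [6, 5, 4, 3, 2, 1] P5) cfg33 post33 2256207542817038 284829615661168 1697646494367744 9983012025690304110857403050580 = false := by decide +kernel
theorem run33_16 : dfs (leafN [6, 5, 4, 3, 2, 1] P5) cfg33 post33 4406655389966 284829615661168 3949447381794816 20124216827518445165840242387540 = false := by decide +kernel
theorem run33_17 : dfs (leafN [6, 5, 4, 3, 2, 1] P5) cfg33 post33 2256207542817038 284794987487344 1697681122541568 9983012026870967789168852281940 = false := by decide +kernel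
theorem run33_18 : dfs (leafN [6, 5, 4, 3, 2, 1] P5) cfg33 post33 4406655389966 2536595874914416 1697681122541568 15053614427785038316660271950420 = false := by decide +kernel
theorem run33_19 : dfs (leafN [6, 5, 4, 3, 2, 1] P5) cfg33 post33 1125908517818638 284829615661168 2827945519366144 17588954312688214004592147507796 = false := by decide +kernel
theorem run33_20 : dfs (leafN [6, 5, 4, 3, 2, 1] P5) cfg33 post33 1134705147711758 2536595874914416 567382630219776 12518197170449320022125511256660 = false := by decide +kernel
theorem run33_21 : dfs (leafN [6, 5, 4, 3, 2, 1] P5) cfg33 post33 1134705147711758 284794987487344 2819183517646848 17588799571363390549616930925140 = false := by decide +kernel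
theorem run33_22 : dfs (leafN [6, 5, 4, 3, 2, 1] P5) cfg33 post33 1125908517818638 293591617380464 2819183517646848 17588876942616134116260263832148 = false := by decide +kernel
theorem run33_23 : dfs (leafN [6, 5, 4, 3, 2, 1] P5) cfg33 post33 1125908517818638 2536595874914416 576179260112896 12518351912954807155412177070676 = false := by decide +kernel
theorem run33_24 : dfs (leafN [6, 5, 4, 3, 2, 1] P5) cfg33 post33 2251809494208782 293591617380464 1693282541256704 9982973341244451899455202994772 = false := by decide +kernel
theorem run33_25 : dfs (leafN [6, 5, 4, 3, 2, 1] P5) cfg33 post33 2256207542817038 293574436462704 1688901673566208 9982934655913372128804383828564 = false := by decide +kernel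
theorem run33_26 : dfs (leafN [6, 5, 4, 3, 2, 1] P5) cfg33 post33 1125908517818638 297972485070960 2814802649956352 17588857600098168184074286475860 = false := by decide +kernel
def cfg24 : Cfg := ⟨[1, 2], [3, 4, 5, 6], 6, 120, 4,
  (.cons 1 3 (.cons 1 4 (.cons 1 5 (.cons 1 6 (.cons 2 3 (.cons 2 4 (.cons 2 5 (.cons 2 6 (.cons 1 2 (.cons 3 4 (.cons 3 5 (.cons 3 6 (.cons 4 5 (.cons 4 6 (.cons 5 6 .nil)))))))))))))))⟩
def pre24 : List Step := [.e 1 3, .e 1 4, .e 1 5, .e 1 6, .chk [1985229088, 1985167888, 1983140368, 1934909968, 1984246288, 1951805968, 1969500688], .e 2 3, .e 2 4, .e 2 5, .e 2 6, .chk [1985229088, 1985167888, 1983140368, 1934909968, 1984246288, 1951805968, 1969500688], .chk [1969500688, 1984246288, 1952789008, 1967534608, 1951805968, 1985167888, 1969439248, 1983201808, 1936015888, 1966490128, 1935032848, 1984123408, 1952666128, 1983140368, 1935954448, 1949717008, 1933988368, 1967350288, 1951621648, 1966367248, 1934909968, 1949655568, 1933926928, 1985229088, 1969500448, 1984246048,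 1952788768, 1967534368, 1951805728, 1985167648, 1969439008, 1983201568, 1936015648, 1966489888, 1935032608, 1984123168, 1952665888, 1983140128, 1935954208, 1949716768, 1933988128, 1967350048, 1951621408, 1966367008, 1934909728, 1949655328, 1933926688]]
def post24 : List Step := [.e 1 2, .chk [1985229088, 1985167888, 1983140368, 1934909968, 1984246288, 1951805968, 1969500688], .e 3 4, .e 3 5, .e 3 6, .e 4 5, .e 4 6, .e 5 6, .chk [1985229088, 1985167888, 1983140368, 1934909968, 1984246288, 1951805968, 1969500688], .chk [1969500688, 1984246288, 1952789008, 1967534608, 1951805968, 1985167888, 1969439248, 1983201808, 1936015888, 1966490128, 1935032848, 1984123408, 1952666128, 1983140368, 1935954448, 1949717008, 1933988368, 1967350288, 1951621648, 1966367248, 1934909968, 1949655568, 1933926928, 1985229088, 1969500448, 1984246048, 1952788768, 1967534368, 1951805728, 1985167648, 1969439008, 1983201568, 1936015648, 1966489888, 1935032608, 1984123168, 1952665888, 1983140128, 1935954208, 1949716768, 1933988128, 1967350048, 1951621408, 1966367008, 1934909728, 1949655328, 1933926688]]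
def ql24 : QL := (.cons 565157600262406 282578867716216 1130315140562944 4278386058760668365879878167188
  (.cons 1128107557861638 845528821153912 4415229526016 2059997508361266878076543904404
  (.cons 2207646824710 845528821153912 1130315140562944 4595298708817725716254322403988
  (.cons 1128107557861638 845528753520760 4415297159168 2059997508361271381951049181844
  (.cons 2207646824710 1971428664557688 4415297159168 3327648108589500801039938431636
  (.cons 1128107557861638 282578867716216 567365182963712 2376910158418324228450988141204
  (.cons 1130306583206150 284777890979960 562967134355456 2376876308495375010038070454932
  (.cons 4406672169222 284777890979960 1688867045392384 4912177508951833848215848954516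
  (.cons 1125908534597894 284777890979960 567365182963712 2376914994121602686967754074772
  (.cons 1130306583206150 284777823346808 562967201988608 2376876308495379513912575732372
  (.cons 4406672169222 1410677734383736 562967201988608 3644526908723608933001464982164
  (.cons 1125908534597894 289175871955064 562967201988608 2376895651308493352377417542292
  .nil))))))))))))
theorem pre_run24 : dfs (notMem ql24) cfg24 pre24 65798 282578800083064 0 158458742917061955547104881300 = false := by decide +kernel
theorem run24_0 : dfs (leafN [6, 5, 4, 3, 2, 1] P5) cfg24 post24 565157600262406 282578867716216 1130315140562944 4278386058760668365879878167188 = false := by decide +kernel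
theorem run24_1 : dfs (leafN [6, 5, 4, 3, 2, 1] P5) cfg24 post24 1128107557861638 845528821153912 4415229526016 2059997508361266878076543904404 = false := by decide +kernel
theorem run24_2 : dfs (leafN [6, 5, 4, 3, 2, 1] P5) cfg24 post24 2207646824710 845528821153912 1130315140562944 4595298708817725716254322403988 = false := by decide +kernel
theorem run24_3 : dfs (leafN [6, 5, 4, 3, 2, 1] P5) cfg24 post24 1128107557861638 845528753520760 4415297159168 2059997508361271381951049181844 = false := by decide +kernel
theorem run24_4 : dfs (leafN [6, 5, 4, 3, 2, 1] P5) cfg24 post24 2207646824710 1971428664557688 4415297159168 3327648108589500801039938431636 = false := by decide +kernel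
theorem run24_5 : dfs (leafN [6, 5, 4, 3, 2, 1] P5) cfg24 post24 1128107557861638 282578867716216 567365182963712 2376910158418324228450988141204 = false := by decide +kernel
theorem run24_6 : dfs (leafN [6, 5, 4, 3, 2, 1] P5) cfg24 post24 1130306583206150 284777890979960 562967134355456 2376876308495375010038070454932 = false := by decide +kernel
theorem run24_7 : dfs (leafN [6, 5, 4, 3, 2, 1] P5) cfg24 post24 4406672169222 284777890979960 1688867045392384 4912177508951833848215848954516 = false := by decide +kernel
theorem run24_8 : dfs (leafN [6, 5, 4, 3, 2, 1] P5) cfg24 post24 1125908534597894 284777890979960 567365182963712 2376914994121602686967754074772 = false := by decide +kernel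
theorem run24_9 : dfs (leafN [6, 5, 4, 3, 2, 1] P5) cfg24 post24 1130306583206150 284777823346808 562967201988608 2376876308495379513912575732372 = false := by decide +kernel
theorem run24_10 : dfs (leafN [6, 5, 4, 3, 2, 1] P5) cfg24 post24 4406672169222 1410677734383736 562967201988608 3644526908723608933001464982164 = false := by decide +kernel
theorem run24_11 : dfs (leafN [6, 5, 4, 3, 2, 1] P5) cfg24 post24 1125908534597894 289175871955064 562967201988608 2376895651308493352377417542292 = false := by decide +kernel
def cfg34 : Cfg := ⟨[1, 2, 3], [4, 5, 6, 7], 14, 240, 2,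
  (.cons 1 4 (.cons 1 5 (.cons 1 6 (.cons 1 7 (.cons 2 4 (.cons 2 5 (.cons 2 6 (.cons 2 7 (.cons 3 4 (.cons 3 5 (.cons 3 6 (.cons 3 7 (.cons 1 2 (.cons 1 3 (.cons 2 3 (.cons 4 5 (.cons 4 6 (.cons 4 7 (.cons 5 6 (.cons 5 7 (.cons 6 7 .nil)))))))))))))))))))))⟩
def pre34 : List Step := [.e 1 4, .e 1 5, .e 1 6, .e 1 7, .chk [1985229088, 1985221168, 1985225488, 1984246288, 1951805968, 1180119568, 1969500688, 1450455568, 1733571088], .e 2 4, .e 2 5, .e 2 6, .e 2 7, .chk [1985229088, 1985221168, 1985225488, 1984246288, 1951805968, 1180119568, 1969500688, 1450455568, 1733571088], .e 3 4, .e 3 5, .e 3 6, .e 3 7, .chk [1985229088, 1985221168, 1985225488, 1984246288, 1951805968, 1180119568, 1969500688, 1450455568, 1733571088], .chk [1733571088, 1969500688, 1466184208, 1702113808, 1450455568, 1984246288, 1732588048, 1952789008, 1197814288, 1685402128, 1182085648, 1967534608, 1464218128, 1951805968, 1196831248, 1417032208, 1165373968, 1699164688, 1447506448, 1683436048, 1180119568,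 1416049168, 1164390928, 1985225488, 1733567248, 1969496848, 1466180368, 1702109968, 1450451728, 1984242448, 1732584208, 1952785168, 1197810448, 1685398288, 1182081808, 1967530768, 1464214288, 1951802128, 1196827408, 1417028368, 1165370128, 1699160848, 1447502608, 1683432208, 1180115728, 1416045328, 1164387088, 1985229088, 1733570848, 1969500448, 1466183968, 1702113568, 1450455328, 1984246048, 1732587808, 1952788768, 1197814048, 1685401888, 1182085408, 1967534368, 1464217888, 1951805728, 1196831008, 1417031968, 1165373728, 1699164448, 1447506208, 1683435808, 1180119328, 1416048928, 1164390688, 1985221408, 1733563168, 1969492768, 1466176288, 1702105888, 1450447648, 1984238368, 1732580128, 1952781088, 1197806368, 1685394208, 1182077728, 1967526688, 1464210208, 1951798048, 1196823328, 1417024288, 1165366048, 1699156768, 1447498528, 1683428128, 1180111648, 1416041248, 1164383008, 1985225008, 1733566768, 1969496368, 1466179888, 1702109488, 1450451248, 1984241968, 1732583728, 1952784688, 1197809968, 1685397808, 1182081328, 1967530288, 1464213808, 1951801648, 1196826928, 1417027888, 1165369648, 1699160368, 1447502128, 1683431728, 1180115248, 1416044848, 1164386608, 1985221168, 1733562928,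 1969492528, 1466176048, 1702105648, 1450447408, 1984238128, 1732579888, 1952780848, 1197806128, 1685393968, 1182077488, 1967526448, 1464209968, 1951797808, 1196823088, 1417024048, 1165365808, 1699156528, 1447498288, 1683427888, 1180111408, 1416041008, 1164382768]]
def post34 : List Step := [.e 1 2, .e 1 3, .e 2 3, .chk [1985229088, 1985221168, 1985225488, 1984246288, 1951805968, 1180119568, 1969500688, 1450455568, 1733571088], .e 4 5, .e 4 6, .e 4 7, .e 5 6, .e 5 7, .e 6 7, .chk [1985229088, 1985221168, 1985225488, 1984246288, 1951805968, 1180119568, 1969500688, 1450455568, 1733571088]]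
def ql34 : QL := (.cons 288795533743583502 216455412706214128 579851649927872512 1131940205585969764134460130215438932
  (.cons 288795533743583502 216464174707933424 579842887926153216 1131940205508599692054571798331763284
  (.cons 288795533743583502 792916132528947440 3390930105139200 799633206639741971960500658167196244
  (.cons 289358483701182734 72903174583763184 722840938092724224 1152707174631558675247094313271798356
  (.cons 289358483701182734 72911936585482480 722832176091004928 1152707174554188603167205981388122708
  (.cons 577588861991989518 72903174583763184 434610559801917440 654246676212215213684935366300248660
  (.cons 577588861991989518 72911936585482480 434601797800198144 654246676134845141605047034416573012
  (.cons 577588861991989518 75154940843016432 432358793542664192 654241605609815480278086186329811540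
  (.cons 290484384677572878 649363894406496496 145254317293600768 820392569781729511390918036162718292
  (.cons 577588861991989518 363385299822199024 144128434563481600 571164855873258533369434155182565972
  .nil))))))))))
theorem pre_run34 : dfs (notMem ql34) cfg34 pre34 16843022 72340172821233904 0 10384752175812572318735064786643540 = false := by decide +kernel
theorem run34_0 : dfs (leafN [7, 6, 5, 4, 3, 2, 1] P4) cfg34 post34 288795533743583502 216455412706214128 579851649927872512 1131940205585969764134460130215438932 = false := by decide +kernel
theorem run34_1 : dfs (leafN [7, 6, 5, 4, 3, 2, 1] P4) cfg34 post34 288795533743583502 216464174707933424 579842887926153216 1131940205508599692054571798331763284 = false := by decide +kernel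
theorem run34_2 : dfs (leafN [7, 6, 5, 4, 3, 2, 1] P4) cfg34 post34 288795533743583502 792916132528947440 3390930105139200 799633206639741971960500658167196244 = false := by decide +kernel
theorem run34_3 : dfs (leafN [7, 6, 5, 4, 3, 2, 1] P4) cfg34 post34 289358483701182734 72903174583763184 722840938092724224 1152707174631558675247094313271798356 = false := by decide +kernel
theorem run34_4 : dfs (leafN [7, 6, 5, 4, 3, 2, 1] P4) cfg34 post34 289358483701182734 72911936585482480 722832176091004928 1152707174554188603167205981388122708 = false := by decide +kernel
theorem run34_5 : dfs (leafN [7, 6, 5, 4, 3, 2, 1] P4) cfg34 post34 577588861991989518 72903174583763184 434610559801917440 654246676212215213684935366300248660 = false := by decide +kernel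
theorem run34_6 : dfs (leafN [7, 6, 5, 4, 3, 2, 1] P4) cfg34 post34 577588861991989518 72911936585482480 434601797800198144 654246676134845141605047034416573012 = false := by decide +kernel
theorem run34_7 : dfs (leafN [7, 6, 5, 4, 3, 2, 1] P4) cfg34 post34 577588861991989518 75154940843016432 432358793542664192 654241605609815480278086186329811540 = false := by decide +kernel
theorem run34_8 : dfs (leafN [7, 6, 5, 4, 3, 2, 1] P4) cfg34 post34 290484384677572878 649363894406496496 145254317293600768 820392569781729511390918036162718292 = false := by decide +kernel
theorem run34_9 : dfs (leafN [7, 6, 5, 4, 3, 2, 1] P4) cfg34 post34 577588861991989518 363385299822199024 144128434563481600 571164855873258533369434155182565972 = false := by decide +kernel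
end R75

namespace R75

theorem frc_eq (n : Nat) (k : Nat → Bool) : frc n k = k n := rfl
theorem ifb_true (t e : Bool) : ifb true t e = t := rfl
theorem ifb_false (t e : Bool) : ifb false t e = e := rfl
theorem ifb_eq (b t e : Bool) : ifb b t e = if b then t else e := by cases b <;> rfl
theorem ifn_eq (b : Bool) (t e : Nat) : ifn b t e = if b then t else e := by cases b <;> rfl

/-- A good colouring of the complete graph on `{0, …, 11}`. -/
structure Good (χ : ℕ → ℕ → ℕ) : Prop where
  symm : ∀ i j, χ i j = χ j i
  rng : ∀ i j, i < 12 → j < 12 → i ≠ j → χ i j = 1 ∨ χ i j = 2 ∨ χ i j = 3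
  supp : ∀ i j, χ i j ≠ 0 → i < 12 ∧ j < 12 ∧ i ≠ j
  c4 : ∀ c, (c = 1 ∨ c = 2) → ∀ a b x y, a ≠ b → x ≠ y →
    χ a x = c → χ a y = c → χ b x = c → χ b y = c → False
  tri : ∀ a b c, χ a b = 3 → χ b c = 3 → χ a c = 3 → False

theorem tb_eq (n i : Nat) : tb n i = n.testBit i := by
  have h : Nat.land (Nat.shiftRight n i) 1 = (n >>> i) % 2 := Nat.and_one_is_mod _
  unfold tb
  rw [h, Nat.testBit_eq_decide_div_mod_eq, Nat.shiftRight_eq_div_pow]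
  cases h' : Nat.beq (n / 2 ^ i % 2) 1
  · have := Nat.ne_of_beq_eq_false h'
    simp [this]
  · have := Nat.eq_of_beq_eq_true h'
    simp [this]

theorem adj_testBit (A i b : Nat) : (adj A i).testBit b = (decide (b < 8) && A.testBit (8 * i + b)) := by
  have : adj A i = (A >>> (8 * i)) &&& (2 ^ 8 - 1) := rfl
  rw [this, Nat.and_two_pow_sub_one_eq_mod, Nat.testBit_mod_two_pow, Nat.testBit_shiftRight]

theorem beq_zero_iff (n : Nat) : Nat.beq n 0 = false ↔ ∃ b, n.testBit b = true := by
  constructor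
  · intro h
    exact Nat.exists_testBit_of_ne_zero (Nat.ne_of_beq_eq_false h)
  · rintro ⟨b, hb⟩
    cases n with
    | zero => simp at hb
    | succ n => rfl

theorem land_testBit (a b i : Nat) : (Nat.land a b).testBit i = (a.testBit i && b.testBit i) :=
  Nat.testBit_and a b i
theorem lor_testBit (a b i : Nat) : (Nat.lor a b).testBit i = (a.testBit i || b.testBit i) :=
  Nat.testBit_or a b i

theorem twoL_testBit (A a x : Nat) (l : List Nat) : (twoL A a l).testBit x = true ↔
    ∃ y ∈ l, a.testBit y = true ∧ (adj A y).testBit x = true := by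
  induction l with
  | nil => simp [twoL]
  | cons z l ih =>
    have : twoL A a (z :: l) = ifn (tb a z) (Nat.lor (adj A z) (twoL A a l)) (twoL A a l) := rfl
    rw [this, ifn_eq, tb_eq]
    split_ifs with h
    · rw [lor_testBit]
      simp [ih, h]
    · simp [ih, h]

theorem two_testBit (A i x : Nat) (h : (two A i).testBit x = true) :
    ∃ y < 8, x < 8 ∧ A.testBit (8 * i + y) = true ∧ A.testBit (8 * y + x) = true := by
  rw [two, twoL_testBit] at h
  obtain ⟨y, -, h1, h2⟩ := h
  rw [adj_testBit] at h1 h2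
  simp at h1 h2
  exact ⟨y, h1.1, h2.1, h1.2, h2.2⟩

theorem shl_testBit (c k b : Nat) : (Nat.shiftLeft c k).testBit b = (decide (k ≤ b) && c.testBit (b - k)) := by
  have : Nat.shiftLeft c k = c <<< k := rfl
  rw [this, Nat.testBit_shiftLeft]

theorem one_testBit (b : Nat) : (1 : Nat).testBit b = decide (b = 0) := by
  have := Nat.testBit_two_pow (n := 0) (m := b)
  simp at this
  rw [this]
  by_cases h : b = 0 <;> simp [h, eq_comm]

theorem addE_testBit (A i j b : Nat) : (addE A i j).testBit b = true ↔
    A.testBit b = true ∨ b = 8 * i + j ∨ b = 8 * j + i := by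
  have : addE A i j = Nat.lor A (Nat.lor (Nat.shiftLeft 1 (8 * i + j)) (Nat.shiftLeft 1 (8 * j + i))) := rfl
  rw [this]
  simp only [lor_testBit, shl_testBit, one_testBit, Bool.or_eq_true, Bool.and_eq_true, decide_eq_true_eq]
  constructor
  · rintro (h | h | h)
    · exact Or.inl h
    · right; left; omega
    · right; right; omega
  · rintro (h | h | h)
    · exact Or.inl h
    · right; left; omega
    · right; right; omega

theorem colAt_testBit (C i j b : Nat) :
    (colAt C i j).testBit b = (decide (b < 2) && C.testBit (16 * i + 2 * j + b)) := by
  have : colAt C i j = (C >>> (16 * i + 2 * j)) &&& (2 ^ 2 - 1) := rfl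
  rw [this, Nat.and_two_pow_sub_one_eq_mod, Nat.testBit_mod_two_pow, Nat.testBit_shiftRight]

theorem testBit_lt4 {c b : Nat} (hc : c < 4) (h : c.testBit b = true) : b < 2 := by
  by_contra hb
  have : c < 2 ^ b := lt_of_lt_of_le hc (by
    calc 4 = 2 ^ 2 := by norm_num
      _ ≤ 2 ^ b := Nat.pow_le_pow_right (by norm_num) (by omega))
  rw [Nat.testBit_lt_two_pow this] at h
  simp at h

theorem colAt_addC (C c i j a b : Nat) (hc : c < 4) (hi : i < 8) (hj : j < 8)
    (hb : b < 8) : colAt (addC C c i j) a b =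
    colAt C a b ||| ((if a = i ∧ b = j then c else 0) ||| (if a = j ∧ b = i then c else 0)) := by
  apply Nat.eq_of_testBit_eq
  intro t
  have h0 : addC C c i j = Nat.lor C (Nat.lor (Nat.shiftLeft c (16 * i + 2 * j)) (Nat.shiftLeft c (16 * j + 2 * i))) := rfl
  have aux : ∀ i j, j < 8 → (decide (t < 2) && (decide (16 * i + 2 * j ≤ 16 * a + 2 * b + t) &&
      c.testBit (16 * a + 2 * b + t - (16 * i + 2 * j)))) = (if a = i ∧ b = j then c else 0).testBit t := by
    intro i j hj
    split_ifs with h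
    · obtain ⟨rfl, rfl⟩ := h
      have : 16 * a + 2 * b + t - (16 * a + 2 * b) = t := by omega
      rw [this]
      cases h : c.testBit t
      · simp
      · have := testBit_lt4 hc h
        simp [this]
    · rw [Nat.zero_testBit, Bool.eq_false_iff]
      intro h'
      simp only [Bool.and_eq_true, decide_eq_true_eq] at h'
      have := testBit_lt4 hc h'.2.2
      apply h
      omega
  rw [Nat.testBit_or, Nat.testBit_or, ← aux i j hj, ← aux j i hi, colAt_testBit, colAt_testBit, h0,
    lor_testBit, lor_testBit, shl_testBit, shl_testBit, Bool.and_or_distrib_left, Bool.and_or_distrib_left]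

/-- The partial colouring recorded in the masks agrees with `χ`. -/
structure Inv (m : ℕ) (χ : ℕ → ℕ → ℕ) (A1 A2 A3 C : ℕ) : Prop where
  h1 : ∀ i j, j < 8 → A1.testBit (8 * i + j) = true → χ i j = 1 ∧ j ≤ m
  h2 : ∀ i j, j < 8 → A2.testBit (8 * i + j) = true → χ i j = 2 ∧ j ≤ m
  h3 : ∀ i j, j < 8 → A3.testBit (8 * i + j) = true → χ i j = 3 ∧ j ≤ m
  hC : ∀ i j, i < 8 → j < 8 → colAt C i j = 0 ∨ colAt C i j = χ i j

theorem bits_add {m c A i j : ℕ} {χ : ℕ → ℕ → ℕ} (hs : ∀ i j, χ i j = χ j i)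
    (h : ∀ i j, j < 8 → A.testBit (8 * i + j) = true → χ i j = c ∧ j ≤ m)
    (hi : i < 8) (hj : j < 8) (him : i ≤ m) (hjm : j ≤ m) (hij : χ i j = c) :
    ∀ a b, b < 8 → (addE A i j).testBit (8 * a + b) = true → χ a b = c ∧ b ≤ m := by
  intro a b hb hab
  rw [addE_testBit] at hab
  rcases hab with hab | hab | hab
  · exact h a b hb hab
  · obtain ⟨rfl, rfl⟩ : a = i ∧ b = j := by omega
    exact ⟨hij, hjm⟩
  · obtain ⟨rfl, rfl⟩ : a = j ∧ b = i := by omega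
    exact ⟨by rw [hs]; exact hij, him⟩

theorem col_add {C c i j : ℕ} {χ : ℕ → ℕ → ℕ} (hs : ∀ i j, χ i j = χ j i)
    (h : ∀ i j, i < 8 → j < 8 → colAt C i j = 0 ∨ colAt C i j = χ i j) (hc : c < 4)
    (hi : i < 8) (hj : j < 8) (hij : χ i j = c) :
    ∀ a b, a < 8 → b < 8 → colAt (addC C c i j) a b = 0 ∨ colAt (addC C c i j) a b = χ a b := by
  intro a b ha hb
  rw [colAt_addC C c i j a b hc hi hj hb]
  have key : ∀ x y : ℕ, (x = 0 ∨ x = χ a b) → (y = 0 ∨ y = χ a b) → (x ||| y = 0 ∨ x ||| y = χ a b) := by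
    rintro x y (rfl | rfl) (rfl | rfl) <;> simp
  apply key _ _ (h a b ha hb)
  apply key
  · split_ifs with h
    · obtain ⟨rfl, rfl⟩ := h
      exact Or.inr hij.symm
    · exact Or.inl rfl
  · split_ifs with h
    · obtain ⟨rfl, rfl⟩ := h
      exact Or.inr (by rw [hs]; exact hij.symm)
    · exact Or.inl rfl

theorem okE_sound {m c A i j : ℕ} {χ : ℕ → ℕ → ℕ} (g : Good χ) (hc : c = 1 ∨ c = 2)
    (h : ∀ i j, j < 8 → A.testBit (8 * i + j) = true → χ i j = c ∧ j ≤ m)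
    (f1 : A.testBit (8 * i + j) = false) (f2 : A.testBit (8 * j + i) = false)
    (hij : χ i j = c) : okE A i j = true := by
  cases ho : okE A i j
  · exfalso
    rw [okE, beq_zero_iff] at ho
    obtain ⟨x, hx⟩ := ho
    rw [land_testBit, Bool.and_eq_true, adj_testBit, Bool.and_eq_true] at hx
    obtain ⟨y, hy, hx8, h1, h2⟩ := two_testBit _ _ _ hx.1
    have h3 := hx.2.2
    refine g.c4 c hc i x y j ?_ ?_ (h _ _ hy h1).1 hij ?_ ?_
    · rintro rfl; simp [f2] at h3
    · rintro rfl; simp [f1] at h1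
    · rw [g.symm]; exact (h _ _ hx8 h2).1
    · rw [g.symm]; exact (h _ _ hx8 h3).1
  · rfl

theorem okT_sound {m A i j : ℕ} {χ : ℕ → ℕ → ℕ} (g : Good χ)
    (h : ∀ i j, j < 8 → A.testBit (8 * i + j) = true → χ i j = 3 ∧ j ≤ m)
    (hij : χ i j = 3) : okT A i j = true := by
  cases ho : okT A i j
  · exfalso
    rw [okT, beq_zero_iff] at ho
    obtain ⟨x, hx⟩ := ho
    rw [land_testBit, adj_testBit, adj_testBit] at hx
    simp at hx
    exact g.tri i j x hij (h _ _ hx.1.1 hx.2.2).1 (h _ _ hx.1.1 hx.1.2).1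
  · rfl

/-! weights -/

def covO (χ : ℕ → ℕ → ℕ) (v w : ℕ) : Prop :=
  ∃ y, (χ v y = 1 ∨ χ v y = 2) ∧ χ v y ≠ χ v w ∧ χ w y = χ v y
def covS (χ : ℕ → ℕ → ℕ) (v w : ℕ) : Prop :=
  ∃ y, χ v y = χ v w ∧ χ w y = χ v w

open Classical in
noncomputable def gw (χ : ℕ → ℕ → ℕ) (w : ℕ) : ℕ :=
  (if covO χ 0 w then 0 else 3) + (if covS χ 0 w then 0 else 1)

theorem mask_full {n mo y : ℕ} (h : Nat.beq (Nat.land n mo) mo = true) (hy : mo.testBit y = true) :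
    n.testBit y = true := by
  have h := Nat.eq_of_beq_eq_true h
  rw [← h, land_testBit, Bool.and_eq_true] at hy
  exact hy.1

theorem wt_sound {m cs co AO AS A3 mo ms : ℕ} {χ : ℕ → ℕ → ℕ}
    (hcs : (cs = 1 ∧ co = 2) ∨ (cs = 2 ∧ co = 1)) (g : Good χ)
    (hO : ∀ i j, j < 8 → AO.testBit (8 * i + j) = true → χ i j = cs ∧ j ≤ m)
    (hS : ∀ i j, j < 8 → AS.testBit (8 * i + j) = true → χ i j = co ∧ j ≤ m)
    (h3 : ∀ i j, j < 8 → A3.testBit (8 * i + j) = true → χ i j = 3 ∧ j ≤ m)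
    (hmo : ∀ y, χ 0 y = co → mo.testBit y = true)
    (hms : ∀ y, χ 0 y = cs → ms.testBit y = true)
    (l : List ℕ) (hl : ∀ w ∈ l, χ 0 w = cs) :
    wt A3 AO AS mo ms l ≤ (l.map (gw χ)).sum := by
  induction l with
  | nil => simp [wt]
  | cons w l ih =>
    have e : wt A3 AO AS mo ms (w :: l) =
      (ifn (Nat.beq (Nat.land (Nat.lor (adj AO w) (adj A3 w)) mo) mo) 3 0 +
      ifn (Nat.beq (Nat.land (Nat.lor (Nat.lor (adj AS w) (adj A3 w)) (Nat.shiftLeft 1 w)) ms) ms) 1 0) +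
       wt A3 AO AS mo ms l := rfl
    rw [e, List.map_cons, List.sum_cons]
    have hw := hl w (by simp)
    have ih := ih (fun w h => hl w (by simp [h]))
    refine Nat.add_le_add (Nat.add_le_add ?_ ?_) ih
    · rw [ifn_eq]
      split_ifs with h1 h2 h2
      · exfalso
        obtain ⟨y, hy, hne, hc⟩ := h2
        have hyo : χ 0 y = co := by
          rw [hw] at hne
          omega
        have := mask_full h1 (hmo y hyo)
        rw [lor_testBit, adj_testBit, adj_testBit] at this
        simp only [Bool.or_eq_true, Bool.and_eq_true, decide_eq_true_eq] at this
        rcases this with ⟨h8, hb⟩ | ⟨h8, hb⟩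
        · have := (hO _ _ h8 hb).1
          omega
        · have := (h3 _ _ h8 hb).1
          omega
      all_goals omega
    · rw [ifn_eq]
      split_ifs with h1 h2 h2
      · exfalso
        obtain ⟨y, hy, hc⟩ := h2
        have := mask_full h1 (hms y (by omega))
        rw [lor_testBit, lor_testBit, adj_testBit, adj_testBit, shl_testBit, one_testBit] at this
        simp only [Bool.or_eq_true, Bool.and_eq_true, decide_eq_true_eq] at this
        rcases this with (⟨h8, hb⟩ | ⟨h8, hb⟩) | h
        · have := (hS _ _ h8 hb).1
          omega
        · have := (h3 _ _ h8 hb).1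
          omega
        · have : y = w := by omega
          subst this
          exact (g.supp y y (by omega)).2.2 rfl
      all_goals omega

/-! lexicographic comparison -/

def lexle (χ χ' : ℕ → ℕ → ℕ) : EL → Prop
  | .nil => True
  | .cons i j t => χ i j < χ' i j ∨ (χ i j = χ' i j ∧ lexle χ χ' t)

def elOK (m : ℕ) : EL → Prop
  | .nil => True
  | .cons i j t => i < 8 ∧ j < 8 ∧ elOK m t

theorem lexok_sound {C s m : ℕ} {χ : ℕ → ℕ → ℕ}
    (hC : ∀ i j, i < 8 → j < 8 → colAt C i j = 0 ∨ colAt C i j = χ i j)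
    (hs : ∀ i < 8, sg s i < 8) :
    ∀ l : EL, elOK m l → lexle χ (fun i j => χ (sg s i) (sg s j)) l → lexok C s l = true
  | .nil, _, _ => rfl
  | .cons i j t, ho, h => by
    have ih := lexok_sound hC hs t ho.2.2
    have e : lexok C s (.cons i j t) = ifb (Nat.beq (colAt C i j) 0) true
      (ifb (Nat.beq (colAt C (sg s i) (sg s j)) 0) true
      (ifb (Nat.beq (colAt C i j) (colAt C (sg s i) (sg s j))) (lexok C s t)
        (Nat.ble (colAt C i j) (colAt C (sg s i) (sg s j))))) := rfl
    rw [e]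
    simp only [ifb_eq]
    split_ifs with h1 h2 h3
    · rfl
    · rfl
    · apply ih
      have h3 := Nat.eq_of_beq_eq_true h3
      have a1 := hC i j ho.1 ho.2.1
      have a2 := hC _ _ (hs i ho.1) (hs j ho.2.1)
      have b1 : colAt C i j ≠ 0 := fun h => h1 (by rw [h]; rfl)
      have b2 : colAt C (sg s i) (sg s j) ≠ 0 := fun h => h2 (by rw [h]; rfl)
      rcases h with h | h
      · simp only at h; omega
      · exact h.2
    · have a1 := hC i j ho.1 ho.2.1
      have a2 := hC _ _ (hs i ho.1) (hs j ho.2.1)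
      have b1 : colAt C i j ≠ 0 := fun h => h1 (by rw [h]; rfl)
      have b2 : colAt C (sg s i) (sg s j) ≠ 0 := fun h => h2 (by rw [h]; rfl)
      apply Nat.ble_eq_true_of_le
      rcases h with h | h
      · simp only at h; omega
      · have := h.1; simp only at this; omega

theorem lexall_sound {C : ℕ} {l : EL} {ss : List ℕ} (h : ∀ s ∈ ss, lexok C s l = true) :
    lexall C l ss = true := by
  induction ss with
  | nil => rfl
  | cons s ss ih =>
    have e : lexall C l (s :: ss) = ifb (lexok C s l) (lexall C l ss) false := rfl
    rw [e, h s (by simp), ifb_true]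
    exact ih (fun s hs => h s (by simp [hs]))

/-! the search -/

def fresh (A i j : ℕ) : Bool := !(tb A (8 * i + j)) && !(tb A (8 * j + i))

/-- Each step treats a new edge among `1, …, m`; each list of symmetries is admissible. -/
def stepsOK (m : ℕ) (V : ℕ → Bool) : List Step → Bool
  | [] => true
  | .e i j :: t => decide (i < 8) && decide (j < 8) && decide (i ≤ m) && decide (j ≤ m) &&
      decide (1 ≤ i) && decide (1 ≤ j) &&
      decide (i ≠ j) && t.all (fun s => match s with
        | .e a b => decide (8 * a + b ≠ 8 * i + j) && decide (8 * a + b ≠ 8 * j + i) &&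
            decide (8 * b + a ≠ 8 * i + j) && decide (8 * b + a ≠ 8 * j + i)
        | .chk _ => true) && stepsOK m V t
  | .chk ss :: t => ss.all V && stepsOK m V t

def freshAll (A : ℕ) (l : List Step) : Bool :=
  l.all (fun s => match s with
    | .e a b => fresh A a b
    | .chk _ => true)

theorem fresh_iff (A i j : ℕ) : fresh A i j = true ↔
    A.testBit (8 * i + j) = false ∧ A.testBit (8 * j + i) = false := by
  simp [fresh, tb_eq]

/-- Hypotheses on the colouring for a given configuration. -/
structure Hyp (m : ℕ) (χ : ℕ → ℕ → ℕ) (c : Cfg) (V : ℕ → Bool) : Prop where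
  good : Good χ
  m12 : m < 12
  hl1 : ∀ w ∈ c.l1, χ 0 w = 1
  hl2 : ∀ w ∈ c.l2, χ 0 w = 2
  hm1 : ∀ y, χ 0 y = 1 → c.m1.testBit y = true
  hm2 : ∀ y, χ 0 y = 2 → c.m2.testBit y = true
  hw : (c.l1.map (gw χ)).sum + (c.l2.map (gw χ)).sum ≤ c.bnd
  hel : elOK m c.el
  hV : ∀ s, V s = true → (∀ i < 8, sg s i < 8) ∧ lexle χ (fun i j => χ (sg s i) (sg s j)) c.el

theorem dfs_sound {m : ℕ} {χ : ℕ → ℕ → ℕ} {c : Cfg} {V : ℕ → Bool} (H : Hyp m χ c V)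
    (leaf : ℕ → ℕ → ℕ → ℕ → Bool)
    (hleaf : ∀ A1 A2 A3 C, Inv m χ A1 A2 A3 C → leaf A1 A2 A3 C = true) :
    ∀ (l : List Step), stepsOK m V l = true → ∀ A1 A2 A3 C, freshAll A1 l = true →
      freshAll A2 l = true → Inv m χ A1 A2 A3 C → dfs leaf c l A1 A2 A3 C = true
  | [], _, A1, A2, A3, C, _, _, hI => hleaf _ _ _ _ hI
  | .chk ss :: t, hS, A1, A2, A3, C, hf1, hf2, hI => by
    have e : dfs leaf c (.chk ss :: t) A1 A2 A3 C =
      ifb (chkW c ss A1 A2 A3 C) (dfs leaf c t A1 A2 A3 C) false := rfl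
    rw [stepsOK, Bool.and_eq_true] at hS
    have hchk : chkW c ss A1 A2 A3 C = true := by
      have e : chkW c ss A1 A2 A3 C = ifb (Nat.ble (Nat.add (wt A3 A1 A2 c.m2 c.m1 c.l1)
        (wt A3 A2 A1 c.m1 c.m2 c.l2)) c.bnd) (lexall C c.el ss) false := rfl
      have w1 := wt_sound (Or.inl ⟨rfl, rfl⟩) H.good hI.h1 hI.h2 hI.h3 H.hm2 H.hm1 c.l1 H.hl1
      have w2 := wt_sound (Or.inr ⟨rfl, rfl⟩) H.good hI.h2 hI.h1 hI.h3 H.hm1 H.hm2 c.l2 H.hl2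
      have hle : Nat.ble (Nat.add (wt A3 A1 A2 c.m2 c.m1 c.l1)
        (wt A3 A2 A1 c.m1 c.m2 c.l2)) c.bnd = true :=
        Nat.ble_eq_true_of_le ((Nat.add_le_add w1 w2).trans H.hw)
      rw [e, hle, ifb_true]
      apply lexall_sound
      intro s hs
      have := H.hV s (List.all_eq_true.1 hS.1 s hs)
      exact lexok_sound hI.hC this.1 c.el H.hel this.2
    rw [e, hchk, ifb_true]
    refine dfs_sound H leaf hleaf t hS.2 _ _ _ _ ?_ ?_ hI
    · rw [freshAll, List.all_cons, Bool.and_eq_true] at hf1; exact hf1.2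
    · rw [freshAll, List.all_cons, Bool.and_eq_true] at hf2; exact hf2.2
  | .e i j :: t, hS, A1, A2, A3, C, hf1, hf2, hI => by
    have e : dfs leaf c (.e i j :: t) A1 A2 A3 C =
        ifb (ifb (okE A1 i j) (dfs leaf c t (addE A1 i j) A2 A3 (addC C 1 i j)) false) true
        (ifb (ifb (okE A2 i j) (dfs leaf c t A1 (addE A2 i j) A3 (addC C 2 i j)) false) true
        (ifb (okT A3 i j) (dfs leaf c t A1 A2 (addE A3 i j) (addC C 3 i j)) false)) := rfl
    rw [stepsOK] at hS
    simp only [Bool.and_eq_true, decide_eq_true_eq] at hS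
    obtain ⟨⟨⟨⟨⟨⟨⟨⟨hi, hj⟩, him⟩, hjm⟩, hi1⟩, hj1⟩, hij⟩, hall⟩, hS⟩ := hS
    rw [freshAll, List.all_cons, Bool.and_eq_true] at hf1 hf2
    have hg := H.good
    have hm := H.m12
    have fa : ∀ A, freshAll A t = true → freshAll (addE A i j) t = true := by
      intro A hA
      rw [freshAll, List.all_eq_true] at hA ⊢
      rw [List.all_eq_true] at hall
      intro s hs
      have h1 := hA s hs
      have h2 := hall s hs
      cases s with
      | chk ss => rfl
      | e a b =>
        simp only [Bool.and_eq_true, decide_eq_true_eq] at h2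
        simp only [fresh_iff] at h1 ⊢
        constructor
        · rw [Bool.eq_false_iff]
          intro h
          rw [addE_testBit] at h
          rcases h with h | h | h
          · simp [h] at h1
          · omega
          · omega
        · rw [Bool.eq_false_iff]
          intro h
          rw [addE_testBit] at h
          rcases h with h | h | h
          · simp [h] at h1
          · omega
          · omega
    rcases hg.rng i j (by omega) (by omega) hij with h | h | h
    · have f := (fresh_iff _ _ _).1 hf1.1
      rw [e, okE_sound hg (Or.inl rfl) hI.h1 f.1 f.2 h, ifb_true,
        dfs_sound H leaf hleaf t hS _ _ _ _ (fa _ hf1.2) hf2.2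
          ⟨bits_add hg.symm hI.h1 hi hj him hjm h, hI.h2, hI.h3, col_add hg.symm hI.hC (by norm_num) hi hj h⟩,
        ifb_true]
    · have f := (fresh_iff _ _ _).1 hf2.1
      rw [e, okE_sound hg (Or.inr rfl) hI.h2 f.1 f.2 h, ifb_true,
        dfs_sound H leaf hleaf t hS _ _ _ _ hf1.2 (fa _ hf2.2)
          ⟨hI.h1, bits_add hg.symm hI.h2 hi hj him hjm h, hI.h3, col_add hg.symm hI.hC (by norm_num) hi hj h⟩,
        ifb_true]
      rw [ifb_eq]; split_ifs <;> rfl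
    · rw [e, okT_sound hg hI.h3 h, ifb_true,
        dfs_sound H leaf hleaf t hS _ _ _ _ hf1.2 hf2.2
          ⟨hI.h1, hI.h2, bits_add hg.symm hI.h3 hi hj him hjm h, col_add hg.symm hI.hC (by norm_num) hi hj h⟩]
      simp only [ifb_eq]; split_ifs <;> rfl

def qlAll (P : ℕ → ℕ → ℕ → ℕ → Prop) : QL → Prop
  | .nil => True
  | .cons a1 a2 a3 c t => P a1 a2 a3 c ∧ qlAll P t

theorem notMem_true {A1 A2 A3 C : ℕ} {P : ℕ → ℕ → ℕ → ℕ → Prop} (hP : ¬ P A1 A2 A3 C) :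
    ∀ {l : QL}, qlAll P l → notMem l A1 A2 A3 C = true
  | .nil, _ => rfl
  | .cons a1 a2 a3 c t, h => by
    have ih := notMem_true hP h.2
    have e : notMem (.cons a1 a2 a3 c t) A1 A2 A3 C =
      ifb (Nat.beq C c) (ifb (Nat.beq A1 a1) (ifb (Nat.beq A2 a2) (ifb (Nat.beq A3 a3) false
        (notMem t A1 A2 A3 C)) (notMem t A1 A2 A3 C)) (notMem t A1 A2 A3 C)) (notMem t A1 A2 A3 C) := rfl
    rw [e]
    simp only [ifb_eq]
    split_ifs with h1 h2 h3 h4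
    · have := Nat.eq_of_beq_eq_true h1
      have := Nat.eq_of_beq_eq_true h2
      have := Nat.eq_of_beq_eq_true h3
      have := Nat.eq_of_beq_eq_true h4
      subst_vars
      exact absurd h.1 hP
    all_goals exact ih

end R75

namespace R75

/-! arithmetic of packed lists -/

theorem land_pack (k a b x y : ℕ) (ha : a < 2 ^ k) (hb : b < 2 ^ k) :
    (a + 2 ^ k * x) &&& (b + 2 ^ k * y) = (a &&& b) + 2 ^ k * (x &&& y) := by
  have hab : a &&& b < 2 ^ k := Nat.and_lt_two_pow a hb
  apply Nat.eq_of_testBit_eq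
  intro i
  rw [Nat.testBit_and, add_comm a, add_comm b, add_comm (a &&& b), Nat.testBit_two_pow_mul_add _ ha,
    Nat.testBit_two_pow_mul_add _ hb, Nat.testBit_two_pow_mul_add _ hab]
  split_ifs <;> simp [Nat.testBit_and]

/-- lane width -/
def BB : ℕ := 2 ^ 168

def pk (l : List ℕ) : ℕ := l.foldr (fun a r => a + BB * r) 0

theorem pk_nil : pk [] = 0 := rfl
theorem pk_cons (a : ℕ) (l : List ℕ) : pk (a :: l) = a + BB * pk l := rfl

theorem pk_append (l l' : List ℕ) : pk (l ++ l') = pk l + BB ^ l.length * pk l' := by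
  induction l with
  | nil => simp [pk_nil]
  | cons a l ih => simp only [List.cons_append, pk_cons, ih, List.length_cons, pow_succ]; ring

theorem pk_map_mul (c : ℕ) (l : List ℕ) : pk (l.map (fun _ => 1)) * c = pk (l.map (fun _ => c)) := by
  induction l with
  | nil => simp [pk_nil]
  | cons a l ih => simp only [List.map_cons, pk_cons, ← ih]; ring

theorem pk_ones (l : List ℕ) : (BB - 1) * pk (l.map (fun _ => 1)) = BB ^ l.length - 1 := by
  have h : pk (l.map (fun _ => 1)) * (BB - 1) + 1 = BB ^ l.length := by
    induction l with
    | nil => simp [pk_nil]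
    | cons a l ih =>
      have hB : BB = (BB - 1) + 1 := by decide
      generalize BB - 1 = D at *
      simp only [List.map_cons, pk_cons, List.length_cons, pow_succ, ← ih]
      generalize pk (l.map (fun _ => 1)) = x
      rw [hB]; ring
  rw [← h, Nat.add_sub_cancel, mul_comm]

theorem pk_land (l : List ℕ) (f g : ℕ → ℕ) (hf : ∀ a ∈ l, f a < BB) (hg : ∀ a ∈ l, g a < BB) :
    pk (l.map f) &&& pk (l.map g) = pk (l.map (fun a => f a &&& g a)) := by
  induction l with
  | nil => simp [pk_nil]
  | cons a l ih =>
    simp only [List.map_cons, pk_cons]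
    rw [← ih (fun a h => hf a (by simp [h])) (fun a h => hg a (by simp [h]))]
    exact land_pack 168 _ _ _ _ (hf a (by simp)) (hg a (by simp))

theorem pk_add (l : List ℕ) (f g : ℕ → ℕ) :
    pk (l.map f) + pk (l.map g) = pk (l.map (fun a => f a + g a)) := by
  induction l with
  | nil => simp [pk_nil]
  | cons a l ih =>
    simp only [List.map_cons, pk_cons]
    rw [← ih]; ring

def pk2 (l : List Bool) : ℕ := l.foldr (fun a r => a.toNat + 2 * r) 0

theorem pk2_cons (a : Bool) (l : List Bool) : pk2 (a :: l) = a.toNat + 2 * pk2 l := rfl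

theorem pk2_lt (l : List Bool) : pk2 l < 2 ^ l.length := by
  induction l with
  | nil => simp [pk2]
  | cons a l ih =>
    rw [pk2_cons, List.length_cons, pow_succ]
    have := Bool.toNat_le a
    omega

theorem pk2_testBit (l : List Bool) : ∀ (r : ℕ), (pk2 l).testBit r = l.getD r false := by
  induction l with
  | nil => intro r; simp [pk2]
  | cons a l ih =>
    intro r
    rw [pk2_cons]
    cases r with
    | zero => cases a <;> simp [Nat.testBit_zero]
    | succ r =>
      have : (a.toNat + 2 * pk2 l) / 2 = pk2 l := by
        have := Bool.toNat_le a
        omega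
      rw [Nat.testBit_succ, this, ih]; simp

theorem pk_mod (l : List Bool) (hl : l.length ≤ 166) :
    pk (l.map (fun b => if b then 2 ^ 167 else 0)) % (2 ^ 167 - 1) = pk2 l := by
  have h : pk (l.map (fun b => if b then 2 ^ 167 else 0)) ≡ pk2 l [MOD (2 ^ 167 - 1)] := by
    clear hl
    induction l with
    | nil => rfl
    | cons a l ih =>
      rw [List.map_cons, pk_cons, pk2_cons]
      apply Nat.ModEq.add
      · cases a
        · rfl
        · show 2 ^ 167 % (2 ^ 167 - 1) = 1 % (2 ^ 167 - 1)
          norm_num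
      · apply Nat.ModEq.mul _ ih
        show BB % (2 ^ 167 - 1) = 2 % (2 ^ 167 - 1)
        norm_num [BB]
  rw [h]
  apply Nat.mod_eq_of_lt
  refine lt_of_lt_of_le (pk2_lt l) ?_
  calc 2 ^ l.length ≤ 2 ^ 166 := Nat.pow_le_pow_right (by norm_num) hl
    _ ≤ _ := by norm_num

theorem pk_digit (l : List ℕ) (h : ∀ a ∈ l, a < BB) : ∀ r, (hr : r < l.length) → pk l / BB ^ r % BB = l[r] := by
  have hB : 0 < BB := by decide
  induction l with
  | nil => intro r hr; simp at hr
  | cons a l ih =>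
    intro r hr
    have ha := h a (by simp)
    rw [pk_cons]
    cases r with
    | zero => simp [Nat.add_mul_mod_self_left, Nat.mod_eq_of_lt ha]
    | succ r =>
      rw [pow_succ', ← Nat.div_div_eq_div_mul, Nat.add_mul_div_left _ _ hB, Nat.div_eq_of_lt ha, zero_add]
      simpa using ih (fun a h' => h a (by simp [h'])) r (by simpa using hr)

theorem lane (u : ℕ) (hu : u < 2 ^ 161) :
    (u + (2 ^ 167 - 1)) &&& 2 ^ 167 = if decide (u ≠ 0) = true then 2 ^ 167 else 0 := by
  apply Nat.eq_of_testBit_eq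
  intro i
  rw [Nat.testBit_and, Nat.testBit_two_pow]
  by_cases hi : 167 = i
  · subst hi
    by_cases hz : u = 0
    · subst hz; decide
    · simp only [hz, ne_eq, not_false_eq_true, decide_true, if_true, Bool.and_true, Nat.testBit_two_pow_self]
      have : u + (2 ^ 167 - 1) = 2 ^ 167 * 1 + (u - 1) := by omega
      rw [this, Nat.testBit_two_pow_mul_add _ (by omega)]
      simp
  · simp only [hi, decide_false, Bool.and_false]
    split_ifs
    · rw [Nat.testBit_two_pow]; simp [hi]
    · simp

/-- The mask of lanes disjoint from `T`. -/
theorem mask_spec (L : List ℕ) (T : ℕ) (hL : ∀ a ∈ L, a < 2 ^ 161) (hT : T < BB) (hn : L.length ≤ 166)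
    (r : ℕ) (hr : r < L.length) (h0 : L[r] &&& T = 0) (ONES : ℕ) (hO : ONES = pk (L.map (fun _ => 1))) :
    (Nat.xor (Nat.mod (ONES * 2 ^ 167) (2 ^ 167 - 1)) (Nat.mod (Nat.land (Nat.add (Nat.land (pk L) (Nat.mul T ONES))
      (ONES * (2 ^ 167 - 1))) (ONES * 2 ^ 167)) (2 ^ 167 - 1))).testBit r = true := by
  have e1 : Nat.mul T ONES = pk (L.map (fun _ => T)) := by
    rw [hO, ← pk_map_mul T]; exact Nat.mul_comm _ _
  have e2 : Nat.land (pk L) (pk (L.map (fun _ => T))) = pk (L.map (fun a => a &&& T)) := by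
    have := pk_land L id (fun _ => T) (fun a h => (hL a h).trans (by decide)) (fun _ _ => hT)
    simpa using this
  have e3 : Nat.add (pk (L.map (fun a => a &&& T))) (ONES * (2 ^ 167 - 1)) =
      pk (L.map (fun a => (a &&& T) + (2 ^ 167 - 1))) := by
    rw [hO, pk_map_mul, ← pk_add]; rfl
  have hlt : ∀ a ∈ L, a &&& T < 2 ^ 161 := fun a h => lt_of_le_of_lt Nat.and_le_left (hL a h)
  have e4 : Nat.land (pk (L.map (fun a => (a &&& T) + (2 ^ 167 - 1)))) (ONES * 2 ^ 167) =
      pk ((L.map (fun a => decide (a &&& T ≠ 0))).map (fun b => if b then 2 ^ 167 else 0)) := by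
    rw [hO, pk_map_mul]
    refine (pk_land L _ _ ?_ (fun _ _ => by decide)).trans ?_
    · intro a ha
      have := hlt a ha
      have h2 : BB = 2 ^ 167 + 2 ^ 167 := by decide
      have h3 : 2 ^ 161 < 2 ^ 167 := by decide
      omega
    · rw [List.map_map]
      congr 1
      apply List.map_congr_left
      intro a ha
      have := hlt a ha
      exact lane _ this
  have e5 : ONES * 2 ^ 167 = pk ((L.map (fun _ => true)).map (fun b => if b then 2 ^ 167 else 0)) := by
    rw [hO, pk_map_mul, List.map_map]; rfl
  have e6 : Nat.mod (ONES * 2 ^ 167) (2 ^ 167 - 1) = pk2 (L.map (fun _ => true)) := by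
    rw [e5]; exact pk_mod _ (by simpa using hn)
  have e7 := pk_mod (L.map (fun a => decide (a &&& T ≠ 0))) (by simpa using hn)
  rw [e1, e2, e3, e4, e6]
  have e8 : ∀ x, Nat.mod x (2 ^ 167 - 1) = x % (2 ^ 167 - 1) := fun _ => rfl
  rw [e8, e7]
  have e9 : ∀ x y, Nat.xor x y = x ^^^ y := fun _ _ => rfl
  rw [e9, Nat.testBit_xor, pk2_testBit, pk2_testBit]
  simp [List.getD, hr, h0]

theorem lowbit (D : ℕ) (h : D ≠ 0) : ∃ a, (D ^^^ (D - 1)) + 1 = 2 * 2 ^ a := by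
  induction D using Nat.strong_induction_on with
  | _ D ih =>
    rcases Nat.even_or_odd' D with ⟨d, rfl | rfl⟩
    · obtain ⟨a, ha⟩ := ih d (by omega) (by omega)
      refine ⟨a + 1, ?_⟩
      have : (2 * d) ^^^ (2 * d - 1) = 2 * (d ^^^ (d - 1)) + 1 := by
        have h1 : 2 * d - 1 = 2 * (d - 1) + 1 := by omega
        rw [h1]
        apply Nat.eq_of_testBit_eq
        intro i
        rw [Nat.testBit_xor]
        cases i with
        | zero => simp [Nat.testBit_zero, Nat.add_mod]
        | succ i =>
          have a1 : (2 * d) / 2 = d := by omega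
          have a2 : (2 * (d - 1) + 1) / 2 = d - 1 := by omega
          have a3 : (2 * (d ^^^ (d - 1)) + 1) / 2 = d ^^^ (d - 1) := by omega
          rw [Nat.testBit_succ, Nat.testBit_succ, Nat.testBit_succ, a1, a2, a3, Nat.testBit_xor]
      rw [this, pow_succ]
      omega
    · refine ⟨0, ?_⟩
      have : (2 * d + 1) ^^^ (2 * d + 1 - 1) = 1 := by
        rw [Nat.add_sub_cancel]
        apply Nat.eq_of_testBit_eq
        intro i
        rw [Nat.testBit_xor]
        cases i with
        | zero => simp [Nat.testBit_zero, Nat.add_mod]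
        | succ i =>
          have a1 : (2 * d) / 2 = d := by omega
          have a2 : (2 * d + 1) / 2 = d := by omega
          rw [Nat.testBit_succ, Nat.testBit_succ, Nat.testBit_succ, a1, a2]
          simp
      rw [this]; norm_num

theorem bits_sound (k : ℕ → Bool) (r : ℕ) (hk : k (2 ^ r) = true) :
    ∀ fuel D, D.testBit r = true → bits fuel k D = true
  | 0, _, _ => rfl
  | f + 1, D, h => by
    have e : bits (f + 1) k D = ifb (Nat.beq D 0) false
      (ifb (k (((D ^^^ (D - 1)) + 1) / 2)) true (bits f k (D ^^^ (((D ^^^ (D - 1)) + 1) / 2)))) := rfl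
    have hD : D ≠ 0 := by rintro rfl; simp at h
    have hb : Nat.beq D 0 = false := (beq_zero_iff D).2 ⟨r, h⟩
    obtain ⟨a, ha⟩ := lowbit D hD
    rw [e, hb, ifb_false, ha, Nat.mul_div_cancel_left _ (by norm_num)]
    by_cases har : a = r
    · rw [har, hk, ifb_true]
    · rw [ifb_eq]
      split_ifs
      · rfl
      · apply bits_sound k r hk
        rw [Nat.testBit_xor, h, Nat.testBit_two_pow]
        simp [har]

end R75

namespace R75

def rowsL : IL → ℕ → ℕ → ℕ → ℕ → List ℕ
  | .nil, _, _, _, Z => [Z]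
  | .cons i a1 a2 a3 b1 b2 t, S1, S2, S3, Z =>
    (if Nat.beq (Nat.land S1 b1) 0 = true then rowsL t (Nat.lor S1 (Nat.shiftLeft 1 i)) S2 S3
        (Nat.lor Z (Nat.lor (Nat.shiftLeft S1 (8 * i + 32)) (Nat.lor (Nat.shiftLeft 1 i) (Nat.shiftLeft a1 16))))
      else []) ++
    ((if Nat.beq (Nat.land S2 b2) 0 = true then rowsL t S1 (Nat.lor S2 (Nat.shiftLeft 1 i)) S3
        (Nat.lor Z (Nat.lor (Nat.shiftLeft S2 (8 * i + 96)) (Nat.lor (Nat.shiftLeft 1 (i + 8)) (Nat.shiftLeft a2 24))))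
      else []) ++
    (if Nat.beq (Nat.land S3 a3) 0 = true then rowsL t S1 S2 (Nat.lor S3 (Nat.shiftLeft 1 i)) Z else []))

theorem rowsN_nil (S1 S2 S3 Z acc N : ℕ) (k : ℕ → ℕ → Bool) :
    rowsN .nil S1 S2 S3 Z acc N k = k (Nat.add (Nat.mul N Z) acc)
      (Nat.mul N 374144419156711147060143317175368453031918731001856) := by
  have e : rowsN .nil S1 S2 S3 Z acc N k = frc (Nat.add (Nat.mul N Z) acc) fun acc =>
    frc (Nat.mul N 374144419156711147060143317175368453031918731001856) (k acc) := rfl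
  rw [e, frc_eq, frc_eq]

theorem rowsN_cons (i a1 a2 a3 b1 b2 : ℕ) (t : IL) (S1 S2 S3 Z acc N : ℕ) (k : ℕ → ℕ → Bool) :
    rowsN (.cons i a1 a2 a3 b1 b2 t) S1 S2 S3 Z acc N k =
     (fun k1 : Nat → Nat → Bool => ifb (Nat.beq (Nat.land S1 b1) 0)
       (rowsN t (Nat.lor S1 (Nat.shiftLeft 1 i)) S2 S3 (Nat.lor Z (Nat.lor (Nat.shiftLeft S1 (Nat.add (Nat.mul 8 i) 32)) (Nat.lor (Nat.shiftLeft 1 i) (Nat.shiftLeft a1 16)))) acc N k1) (k1 acc N))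
     (fun acc N =>
     (fun k1 : Nat → Nat → Bool => ifb (Nat.beq (Nat.land S2 b2) 0)
       (rowsN t S1 (Nat.lor S2 (Nat.shiftLeft 1 i)) S3 (Nat.lor Z (Nat.lor (Nat.shiftLeft S2 (Nat.add (Nat.mul 8 i) 96)) (Nat.lor (Nat.shiftLeft 1 (Nat.add i 8)) (Nat.shiftLeft a2 24)))) acc N k1) (k1 acc N))
     fun acc N =>
     (ifb (Nat.beq (Nat.land S3 a3) 0)
       (rowsN t S1 S2 (Nat.lor S3 (Nat.shiftLeft 1 i)) Z acc N k) (k acc N))) := rfl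

theorem rowsN_eq : ∀ (I : IL) (S1 S2 S3 Z acc N : ℕ) (k : ℕ → ℕ → Bool),
    rowsN I S1 S2 S3 Z acc N k = k (acc + N * pk (rowsL I S1 S2 S3 Z)) (N * BB ^ (rowsL I S1 S2 S3 Z).length)
  | .nil, S1, S2, S3, Z, acc, N, k => by
    have hB : (374144419156711147060143317175368453031918731001856 : ℕ) = BB := by norm_num [BB]
    rw [rowsN_nil, hB, Nat.add_eq, Nat.mul_eq, Nat.mul_eq]
    simp only [rowsL, pk_cons, pk_nil, List.length_singleton, pow_one, mul_zero, add_zero, add_comm]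
  | .cons i a1 a2 a3 b1 b2 t, S1, S2, S3, Z, acc, N, k => by
    rw [rowsN_cons, rowsL]
    simp only [Nat.add_eq, Nat.mul_eq]
    simp only [ifb_eq, rowsN_eq t, pk_append, List.length_append, pow_add]
    generalize BB = B
    split_ifs <;>
      (try simp only [pk_nil, List.length_nil, pow_zero, mul_zero, add_zero, zero_add, mul_one, one_mul]) <;>
      congr 1 <;> ring

def Bd (Z : ℕ) : Prop := ∀ b, Z.testBit b = true → b < 160

theorem Bd.lt {Z : ℕ} (h : Bd Z) : Z < 2 ^ 160 := by
  apply Nat.lt_pow_two_of_testBit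
  intro i hi
  rw [Bool.eq_false_iff]
  intro h'
  have := h i h'
  omega

/-- What the bits of the row of a vertex `n` mean. -/
def RP (m : ℕ) (χ : ℕ → ℕ → ℕ) (n Z : ℕ) : Prop := ∀ b, Z.testBit b = true →
  (b < 8 ∧ b ≤ m ∧ χ n b = 1) ∨ (8 ≤ b ∧ b < 16 ∧ b - 8 ≤ m ∧ χ n (b - 8) = 2) ∨
  (16 ≤ b ∧ b < 24 ∧ ∃ j ≤ m, χ n j = 1 ∧ χ j (b - 16) = 1) ∨
  (24 ≤ b ∧ b < 32 ∧ ∃ j ≤ m, χ n j = 2 ∧ χ j (b - 24) = 2) ∨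
  (∃ i j, i < 8 ∧ j < 8 ∧ b = 8 * i + 32 + j ∧ i ≠ j ∧ χ n i = 1 ∧ χ n j = 1) ∨
  (∃ i j, i < 8 ∧ j < 8 ∧ b = 8 * i + 96 + j ∧ i ≠ j ∧ χ n i = 2 ∧ χ n j = 2)

def IOK (m : ℕ) (χ : ℕ → ℕ → ℕ) : ℕ → IL → Prop
  | _, .nil => True
  | lo, .cons i a1 a2 a3 b1 b2 t => lo ≤ i ∧ i ≤ m ∧
    (∀ x, a1.testBit x = true → x < 8 ∧ χ i x = 1) ∧
    (∀ x, a2.testBit x = true → x < 8 ∧ χ i x = 2) ∧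
    (∀ x, a3.testBit x = true → x < 8 ∧ χ i x = 3) ∧
    (∀ x, b1.testBit x = true → ∃ l ≤ m, χ i l = 1 ∧ χ l x = 1) ∧
    (∀ x, b2.testBit x = true → ∃ l ≤ m, χ i l = 2 ∧ χ l x = 2) ∧ IOK m χ (i + 1) t

def SI (m : ℕ) (χ : ℕ → ℕ → ℕ) (n lo c S : ℕ) : Prop := ∀ b, S.testBit b = true → b < lo ∧ b ≤ m ∧ χ n b = c

theorem SI.up {m : ℕ} {χ : ℕ → ℕ → ℕ} {n lo c S i : ℕ} (h : SI m χ n lo c S) (hi : lo ≤ i) :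
    SI m χ n (i + 1) c S := fun b hb => by
  have := h b hb
  exact ⟨by omega, this.2⟩

theorem SI.add {m : ℕ} {χ : ℕ → ℕ → ℕ} {n lo c S i : ℕ} (h : SI m χ n lo c S) (hi : lo ≤ i) (him : i ≤ m)
    (hn : χ n i = c) : SI m χ n (i + 1) c (Nat.lor S (Nat.shiftLeft 1 i)) := fun b hb => by
  rw [lor_testBit, shl_testBit, one_testBit] at hb
  simp only [Bool.or_eq_true, Bool.and_eq_true, decide_eq_true_eq] at hb
  rcases hb with hb | hb
  · exact h.up hi b hb
  · have : b = i := by omega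
    subst this
    exact ⟨by omega, him, hn⟩

theorem ok_of_not {x : ℕ} (h : (∃ b, x.testBit b = true) → False) : Nat.beq x 0 = true := by
  cases hb : Nat.beq x 0
  · exact (h ((beq_zero_iff x).1 hb)).elim
  · rfl

theorem rows_mem {m : ℕ} {χ : ℕ → ℕ → ℕ} (g : Good χ) (hm : m < 8) {n : ℕ} (hmn : m < n) (hn : n < 12) :
    ∀ (I : IL) (lo S1 S2 S3 Z : ℕ), IOK m χ lo I → SI m χ n lo 1 S1 → SI m χ n lo 2 S2 → SI m χ n lo 3 S3 →
      RP m χ n Z → ∃ Z' ∈ rowsL I S1 S2 S3 Z, RP m χ n Z'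
  | .nil, lo, S1, S2, S3, Z, _, _, _, _, hZ => ⟨Z, by simp [rowsL], hZ⟩
  | .cons i a1 a2 a3 b1 b2 t, lo, S1, S2, S3, Z, ⟨hlo, him, ha1, ha2, ha3, hb1, hb2, hI⟩, h1, h2, h3, hZ => by
    have cyc : ∀ c, (c = 1 ∨ c = 2) → ∀ S b, SI m χ n lo c S →
        (∀ x, b.testBit x = true → ∃ l ≤ m, χ i l = c ∧ χ l x = c) → χ n i = c →
        Nat.beq (Nat.land S b) 0 = true := by
      intro c hc S b hS hb h
      apply ok_of_not
      rintro ⟨x, hx⟩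
      rw [land_testBit, Bool.and_eq_true] at hx
      obtain ⟨l, hl, hil, hlx⟩ := hb x hx.2
      have hx1 := hS x hx.1
      refine g.c4 c hc n l i x ?_ ?_ h hx1.2.2 (by rw [g.symm]; exact hil) hlx
      · omega
      · omega
    rcases g.rng n i hn (by omega) (by omega) with h | h | h
    · have := cyc 1 (Or.inl rfl) S1 b1 h1 hb1 h
      obtain ⟨Z', hZ', hR⟩ := rows_mem g hm hmn hn t (i + 1) (Nat.lor S1 (Nat.shiftLeft 1 i)) S2 S3
        (Nat.lor Z (Nat.lor (Nat.shiftLeft S1 (8 * i + 32)) (Nat.lor (Nat.shiftLeft 1 i) (Nat.shiftLeft a1 16))))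
        hI (h1.add hlo him h) (h2.up hlo) (h3.up hlo) (by
          intro b hb
          simp only [lor_testBit, shl_testBit, one_testBit, Bool.or_eq_true, Bool.and_eq_true, decide_eq_true_eq] at hb
          rcases hb with hb | ⟨hb, hb'⟩ | hb | ⟨hb, hb'⟩
          · exact hZ b hb
          · have := h1 _ hb'
            right; right; right; right; left
            exact ⟨i, b - (8 * i + 32), by omega, by omega, by omega, by omega, h, this.2.2⟩
          · obtain rfl : b = i := by omega
            left
            exact ⟨by omega, him, h⟩
          · have := ha1 _ hb'
            right; right; left
            exact ⟨hb, by omega, i, him, h, this.2⟩)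
      refine ⟨Z', ?_, hR⟩
      rw [rowsL, this, if_pos rfl]
      exact List.mem_append_left _ hZ'
    · have := cyc 2 (Or.inr rfl) S2 b2 h2 hb2 h
      obtain ⟨Z', hZ', hR⟩ := rows_mem g hm hmn hn t (i + 1) S1 (Nat.lor S2 (Nat.shiftLeft 1 i)) S3
        (Nat.lor Z (Nat.lor (Nat.shiftLeft S2 (8 * i + 96)) (Nat.lor (Nat.shiftLeft 1 (i + 8)) (Nat.shiftLeft a2 24))))
        hI (h1.up hlo) (h2.add hlo him h) (h3.up hlo) (by
          intro b hb
          simp only [lor_testBit, shl_testBit, one_testBit, Bool.or_eq_true, Bool.and_eq_true, decide_eq_true_eq] at hb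
          rcases hb with hb | ⟨hb, hb'⟩ | hb | ⟨hb, hb'⟩
          · exact hZ b hb
          · have := h2 _ hb'
            right; right; right; right; right
            exact ⟨i, b - (8 * i + 96), by omega, by omega, by omega, by omega, h, this.2.2⟩
          · obtain rfl : b = i + 8 := by omega
            right; left
            exact ⟨by omega, by omega, by omega, by simpa using h⟩
          · have := ha2 _ hb'
            right; right; right; left
            exact ⟨hb, by omega, i, him, h, this.2⟩)
      refine ⟨Z', ?_, hR⟩
      rw [rowsL, this, if_pos rfl]
      exact List.mem_append_right _ (List.mem_append_left _ hZ')
    · have : Nat.beq (Nat.land S3 a3) 0 = true := by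
        apply ok_of_not
        rintro ⟨x, hx⟩
        rw [land_testBit, Bool.and_eq_true] at hx
        exact g.tri n i x h (ha3 x hx.2).2 (h3 x hx.1).2.2
      obtain ⟨Z', hZ', hR⟩ := rows_mem g hm hmn hn t (i + 1) S1 S2 (Nat.lor S3 (Nat.shiftLeft 1 i)) Z
        hI (h1.up hlo) (h2.up hlo) (h3.add hlo him h) hZ
      refine ⟨Z', ?_, hR⟩
      rw [rowsL, this, if_pos rfl]
      exact List.mem_append_right _ (List.mem_append_right _ hZ')

def IB : IL → Prop
  | .nil => True
  | .cons i a1 a2 _ _ _ t => i < 8 ∧ (∀ x, a1.testBit x = true → x < 8) ∧ (∀ x, a2.testBit x = true → x < 8) ∧ IB t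

theorem IOK.ib {m : ℕ} {χ : ℕ → ℕ → ℕ} (hm : m < 8) : ∀ {lo : ℕ} {I : IL}, IOK m χ lo I → IB I
  | _, .nil, _ => trivial
  | _, .cons _ _ _ _ _ _ _, h => ⟨by have := h.2.1; omega, fun x hx => (h.2.2.1 x hx).1,
      fun x hx => (h.2.2.2.1 x hx).1, IOK.ib hm h.2.2.2.2.2.2.2⟩

theorem rows_bd : ∀ (I : IL) (S1 S2 S3 Z : ℕ), IB I → (∀ x, S1.testBit x = true → x < 8) →
    (∀ x, S2.testBit x = true → x < 8) → Bd Z → ∀ Z' ∈ rowsL I S1 S2 S3 Z, Bd Z'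
  | .nil, S1, S2, S3, Z, _, _, _, hZ, Z', h => by
    simp [rowsL] at h; rw [h]; exact hZ
  | .cons i a1 a2 a3 b1 b2 t, S1, S2, S3, Z, ⟨hi, ha1, ha2, hI⟩, h1, h2, hZ, Z', h => by
    have up : ∀ S, (∀ x, S.testBit x = true → x < 8) → ∀ x, (Nat.lor S (Nat.shiftLeft 1 i)).testBit x = true → x < 8 := by
      intro S hS x hx
      simp only [lor_testBit, shl_testBit, one_testBit, Bool.or_eq_true, Bool.and_eq_true, decide_eq_true_eq] at hx
      rcases hx with hx | hx
      · exact hS x hx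
      · omega
    rw [rowsL, List.mem_append, List.mem_append] at h
    rcases h with h | h | h
    · split_ifs at h
      · refine rows_bd t _ _ _ _ hI (up _ h1) h2 ?_ Z' h
        intro b hb
        simp only [lor_testBit, shl_testBit, one_testBit, Bool.or_eq_true, Bool.and_eq_true, decide_eq_true_eq] at hb
        rcases hb with hb | ⟨hb, hb'⟩ | hb | ⟨hb, hb'⟩
        · exact hZ b hb
        · have := h1 _ hb'; omega
        · omega
        · have := ha1 _ hb'; omega
      · simp at h
    · split_ifs at h
      · refine rows_bd t _ _ _ _ hI h1 (up _ h2) ?_ Z' h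
        intro b hb
        simp only [lor_testBit, shl_testBit, one_testBit, Bool.or_eq_true, Bool.and_eq_true, decide_eq_true_eq] at hb
        rcases hb with hb | ⟨hb, hb'⟩ | hb | ⟨hb, hb'⟩
        · exact hZ b hb
        · have := h2 _ hb'; omega
        · omega
        · have := ha2 _ hb'; omega
      · simp at h
    · split_ifs at h
      · exact rows_bd t _ _ _ _ hI h1 h2 hZ Z' h
      · simp at h

noncomputable def ilOf (A1 A2 A3 : ℕ) : List ℕ → IL → IL
  | [], acc => acc
  | i :: l, acc => ilOf A1 A2 A3 l (.cons i (adj A1 i) (adj A2 i) (adj A3 i) (two A1 i) (two A2 i) acc)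

theorem mkIL_eq (A1 A2 A3 : ℕ) (k : IL → Bool) : ∀ (l : List ℕ) (acc : IL),
    mkIL A1 A2 A3 l acc k = k (ilOf A1 A2 A3 l acc)
  | [], _ => rfl
  | i :: l, acc => by
    rw [ilOf, ← mkIL_eq A1 A2 A3 k l]; rfl

def desc : ℕ → List ℕ
  | 0 => []
  | t + 1 => (t + 1) :: desc t

theorem ilOf_ok {m : ℕ} {χ : ℕ → ℕ → ℕ} {A1 A2 A3 C : ℕ} (hI : Inv m χ A1 A2 A3 C) :
    ∀ (t : ℕ) (acc : IL), t ≤ m → IOK m χ (t + 1) acc → IOK m χ 1 (ilOf A1 A2 A3 (desc t) acc)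
  | 0, acc, _, h => h
  | t + 1, acc, ht, h => by
    rw [desc, ilOf]
    refine ilOf_ok hI t _ (by omega) ⟨le_rfl, ht, ?_, ?_, ?_, ?_, ?_, h⟩
    · intro x hx
      rw [adj_testBit, Bool.and_eq_true, decide_eq_true_eq] at hx
      exact ⟨hx.1, (hI.h1 _ _ hx.1 hx.2).1⟩
    · intro x hx
      rw [adj_testBit, Bool.and_eq_true, decide_eq_true_eq] at hx
      exact ⟨hx.1, (hI.h2 _ _ hx.1 hx.2).1⟩
    · intro x hx
      rw [adj_testBit, Bool.and_eq_true, decide_eq_true_eq] at hx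
      exact ⟨hx.1, (hI.h3 _ _ hx.1 hx.2).1⟩
    · intro x hx
      obtain ⟨y, hy, hx8, h1, h2⟩ := two_testBit _ _ _ hx
      exact ⟨y, (hI.h1 _ _ hy h1).2, (hI.h1 _ _ hy h1).1, (hI.h1 _ _ hx8 h2).1⟩
    · intro x hx
      obtain ⟨y, hy, hx8, h1, h2⟩ := two_testBit _ _ _ hx
      exact ⟨y, (hI.h2 _ _ hy h1).2, (hI.h2 _ _ hy h1).1, (hI.h2 _ _ hx8 h2).1⟩

end R75

namespace R75

/-- colour of a pair in a pattern with colour-1 edges `E` -/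
def pcol (E : List (ℕ × ℕ)) (i j : ℕ) : ℕ := if (E.contains (i, j) || E.contains (j, i)) = true then 1 else 2
/-- do `i`, `j` have a common neighbour in colour `c`? -/
def pche (k : ℕ) (E : List (ℕ × ℕ)) (c i j : ℕ) : Bool :=
  (List.range k).any fun l => decide (l ≠ i) && decide (l ≠ j) && decide (pcol E i l = c) && decide (pcol E j l = c)

def pF1 (k : ℕ) (E : List (ℕ × ℕ)) (i j : ℕ) : ℕ :=
  1461501637330902918203684832716283019651637575680 |||
    ((if pche k E 1 i j = true then 255 else 0) ||| (if pche k E 2 i j = true then 65280 else 0))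
def pF2 (E : List (ℕ × ℕ)) (i j : ℕ) : ℕ := if pcol E i j = 1 then 255 else 65280

def mkF (k : ℕ) (E O : List (ℕ × ℕ)) (j : ℕ) : ℕ → FL
  | 0 => .nil
  | i + 1 => .cons (pF1 k E i j) (pF2 E i j) (O.contains (i, j)) (mkF k E O j i)

def patF (k : ℕ) (P : List (ℕ × ℕ) × List (ℕ × ℕ)) : List FL :=
  (List.range' 0 k).map (fun j => mkF k P.1 P.2 j j)

def Q5 : List (List (ℕ × ℕ) × List (ℕ × ℕ)) :=
  [([(0,1),(0,2),(1,2),(0,3),(1,4)], [(0,1)]),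
   ([(0,1),(0,2),(1,3),(2,4),(3,4)], [(0,1),(0,2),(0,3),(0,4),(1,2)])]
def Q4 : List (List (ℕ × ℕ) × List (ℕ × ℕ)) :=
  [([(0,1),(0,2)], [(1,2)]),
   ([(0,1),(0,2),(0,3)], [(1,2),(2,3)]),
   ([(0,1),(0,2),(1,3)], [(0,1)]),
   ([(0,3),(1,2),(1,3),(2,3)], [(1,2)]),
   ([(1,2),(1,3),(2,3)], [(1,2),(2,3)])]

theorem P5_eq : P5 = Q5.map (patF 5) := by rfl
theorem P4_eq : P4 = Q4.map (patF 4) := by rfl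

noncomputable def clOf (Zf r : ℕ → ℕ) : ℕ → CL
  | 0 => .nil
  | j + 1 => .cons (Zf j) (2 ^ r j) (clOf Zf r j)

theorem tcomb_bits (k : ℕ) (E O : List (ℕ × ℕ)) (Zf r : ℕ → ℕ) (j b : ℕ) : ∀ i,
    (tcomb (mkF k E O j i) (clOf Zf r i)).testBit b = true → b = 160 ∨ ∃ i' < i,
      ((Zf i').testBit b = true ∧ (pF1 k E i' j).testBit b = true) ∨
      ((Zf i').testBit (16 + b) = true ∧ (pF2 E i' j).testBit b = true)
  | 0, h => by
    left
    have e : tcomb (mkF k E O j 0) (clOf Zf r 0) = 2 ^ 160 := by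
      show (1461501637330902918203684832716283019655932542976 : ℕ) = 2 ^ 160
      norm_num
    rw [e, Nat.testBit_two_pow, decide_eq_true_eq] at h
    exact h.symm
  | i + 1, h => by
    have e : tcomb (mkF k E O j (i + 1)) (clOf Zf r (i + 1)) =
      Nat.lor (Nat.lor (Nat.land (Zf i) (pF1 k E i j)) (Nat.land (Nat.shiftRight (Zf i) 16) (pF2 E i j)))
        (tcomb (mkF k E O j i) (clOf Zf r i)) := rfl
    have e2 : Nat.shiftRight (Zf i) 16 = (Zf i) >>> 16 := rfl
    rw [e, e2, lor_testBit, lor_testBit, land_testBit, land_testBit, Nat.testBit_shiftRight] at h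
    simp only [Bool.or_eq_true, Bool.and_eq_true] at h
    rcases h with h | h
    · exact Or.inr ⟨i, by omega, h⟩
    · rcases tcomb_bits k E O Zf r j b i h with h | ⟨i', hi', h⟩
      · exact Or.inl h
      · exact Or.inr ⟨i', by omega, h⟩

theorem bnd_bit (k : ℕ) (E O : List (ℕ × ℕ)) (Zf r : ℕ → ℕ) (j : ℕ) : ∀ i D, D.testBit (r j) = true →
    (∀ i' < i, O.contains (i', j) = true → r j ≤ r i') →
    (bnd (mkF k E O j i) (clOf Zf r i) D).testBit (r j) = true
  | 0, _, h, _ => h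
  | i + 1, D, h, ho => by
    have e : bnd (mkF k E O j (i + 1)) (clOf Zf r (i + 1)) D = bnd (mkF k E O j i) (clOf Zf r i)
      (ifn (O.contains (i, j)) (Nat.mod D (Nat.mul 2 (2 ^ r i))) D) := rfl
    rw [e]
    apply bnd_bit k E O Zf r j i _ _ (fun i' h' => ho i' (by omega))
    rw [ifn_eq]
    split_ifs with hc
    · have e2 : Nat.mod D (Nat.mul 2 (2 ^ r i)) = D % 2 ^ (r i + 1) := by
        rw [pow_succ, mul_comm (2 ^ r i)]; rfl
      have := ho i (by omega) hc
      rw [e2, Nat.testBit_mod_two_pow, h]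
      simp; omega
    · exact h

theorem pF1_bit {k : ℕ} {E : List (ℕ × ℕ)} {i j b : ℕ} (h : (pF1 k E i j).testBit b = true) :
    32 ≤ b ∨ (b < 8 ∧ pche k E 1 i j = true) ∨ (8 ≤ b ∧ b < 16 ∧ pche k E 2 i j = true) := by
  rw [pF1, Nat.testBit_or, Nat.testBit_or] at h
  simp only [Bool.or_eq_true] at h
  rcases h with h | h | h
  · left
    have e : (1461501637330902918203684832716283019651637575680 : ℕ) = 2 ^ 32 * (2 ^ 128 - 1) := by norm_num
    rw [e, Nat.testBit_two_pow_mul] at h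
    simp at h
    exact h.1
  · split_ifs at h with hc
    · right; left
      have e : (255 : ℕ) = 2 ^ 8 - 1 := by norm_num
      rw [e, Nat.testBit_two_pow_sub_one] at h
      exact ⟨by simpa using h, hc⟩
    · simp at h
  · split_ifs at h with hc
    · right; right
      have e : (65280 : ℕ) = 2 ^ 8 * (2 ^ 8 - 1) := by norm_num
      rw [e, Nat.testBit_two_pow_mul, Nat.testBit_two_pow_sub_one] at h
      simp at h
      exact ⟨h.1, by omega, hc⟩
    · simp at h

theorem pF2_bit {E : List (ℕ × ℕ)} {i j b : ℕ} (h : (pF2 E i j).testBit b = true) :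
    (b < 8 ∧ pcol E i j = 1) ∨ (8 ≤ b ∧ b < 16 ∧ pcol E i j = 2) := by
  rw [pF2] at h
  split_ifs at h with hc
  · left
    have e : (255 : ℕ) = 2 ^ 8 - 1 := by norm_num
    rw [e, Nat.testBit_two_pow_sub_one] at h
    exact ⟨by simpa using h, hc⟩
  · right
    have e : (65280 : ℕ) = 2 ^ 8 * (2 ^ 8 - 1) := by norm_num
    rw [e, Nat.testBit_two_pow_mul, Nat.testBit_two_pow_sub_one] at h
    simp at h
    refine ⟨h.1, by omega, ?_⟩
    unfold pcol at hc ⊢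
    split_ifs at hc ⊢ <;> simp_all

/-- The vertices `ν 0, …, ν (k-1)` realise the pattern. -/
structure PM (m k : ℕ) (χ : ℕ → ℕ → ℕ) (E O : List (ℕ × ℕ)) (ν r : ℕ → ℕ) : Prop where
  hν : ∀ i < k, m < ν i
  hne : ∀ i j, i < k → j < k → i ≠ j → ν i ≠ ν j
  hcol : ∀ i j, i < k → j < k → i ≠ j → χ (ν i) (ν j) = pcol E i j
  hord : ∀ i j, i < j → j < k → O.contains (i, j) = true → r j ≤ r i

theorem compat {m k : ℕ} {χ : ℕ → ℕ → ℕ} {E O : List (ℕ × ℕ)} {ν r : ℕ → ℕ} (g : Good χ) (hm : m < 8)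
    (h : PM m k χ E O ν r) (Zf : ℕ → ℕ) (hZ : ∀ i < k, RP m χ (ν i) (Zf i)) (hB : ∀ i < k, Bd (Zf i)) (j : ℕ) (hj : j < k) :
    Zf j &&& tcomb (mkF k E O j j) (clOf Zf r j) = 0 := by
  apply Nat.eq_of_testBit_eq
  intro b
  rw [Nat.zero_testBit, Bool.eq_false_iff]
  intro hb
  rw [Nat.testBit_and, Bool.and_eq_true] at hb
  obtain ⟨hb1, hb2⟩ := hb
  have hlt := hB j hj b hb1
  rcases tcomb_bits k E O Zf r j b j hb2 with h0 | ⟨i, hij, ⟨h1, h2⟩ | ⟨h1, h2⟩⟩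
  · omega
  · have hi : i < k := by omega
    have hne := h.hne i j hi hj (by omega)
    rcases pF1_bit h2 with hc | ⟨hb8, hc⟩ | ⟨hb8, hb16, hc⟩
    · rcases hZ i hi b h1 with q | q | q | q | ⟨x, y, hx, hy, hxy, hn, q1, q2⟩ | ⟨x, y, hx, hy, hxy, hn, q1, q2⟩
      · omega
      · omega
      · omega
      · omega
      · rcases hZ j hj b hb1 with p | p | p | p | ⟨x', y', hx', hy', hxy', hn', p1, p2⟩ | ⟨x', y', hx', hy', hxy', hn', p1, p2⟩
        · omega
        · omega
        · omega
        · omega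
        · obtain ⟨rfl, rfl⟩ : x = x' ∧ y = y' := by omega
          exact g.c4 1 (Or.inl rfl) _ _ _ _ hne hn q1 q2 p1 p2
        · omega
      · rcases hZ j hj b hb1 with p | p | p | p | ⟨x', y', hx', hy', hxy', hn', p1, p2⟩ | ⟨x', y', hx', hy', hxy', hn', p1, p2⟩
        · omega
        · omega
        · omega
        · omega
        · omega
        · obtain ⟨rfl, rfl⟩ : x = x' ∧ y = y' := by omega
          exact g.c4 2 (Or.inr rfl) _ _ _ _ hne hn q1 q2 p1 p2
    · simp only [pche, List.any_eq_true, List.mem_range, Bool.and_eq_true, decide_eq_true_eq] at hc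
      obtain ⟨l, hl, ⟨⟨hli, hlj⟩, c1⟩, c2⟩ := hc
      have d1 := h.hcol i l hi hl (Ne.symm hli)
      have d2 := h.hcol j l hj hl (Ne.symm hlj)
      have hνl := h.hν l hl
      have z1 : b ≤ m ∧ χ (ν i) b = 1 := by
        rcases hZ i hi b h1 with q | q | q | q | ⟨x, y, q⟩ | ⟨x, y, q⟩
        · exact q.2
        all_goals omega
      have z2 : b ≤ m ∧ χ (ν j) b = 1 := by
        rcases hZ j hj b hb1 with q | q | q | q | ⟨x, y, q⟩ | ⟨x, y, q⟩
        · exact q.2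
        all_goals omega
      exact g.c4 1 (Or.inl rfl) _ _ b (ν l) hne (by omega) z1.2 (by omega) z2.2 (by omega)
    · simp only [pche, List.any_eq_true, List.mem_range, Bool.and_eq_true, decide_eq_true_eq] at hc
      obtain ⟨l, hl, ⟨⟨hli, hlj⟩, c1⟩, c2⟩ := hc
      have d1 := h.hcol i l hi hl (Ne.symm hli)
      have d2 := h.hcol j l hj hl (Ne.symm hlj)
      have hνl := h.hν l hl
      have z1 : b - 8 ≤ m ∧ χ (ν i) (b - 8) = 2 := by
        rcases hZ i hi b h1 with q | q | q | q | ⟨x, y, q⟩ | ⟨x, y, q⟩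
        · omega
        · exact q.2.2
        all_goals omega
      have z2 : b - 8 ≤ m ∧ χ (ν j) (b - 8) = 2 := by
        rcases hZ j hj b hb1 with q | q | q | q | ⟨x, y, q⟩ | ⟨x, y, q⟩
        · omega
        · exact q.2.2
        all_goals omega
      exact g.c4 2 (Or.inr rfl) _ _ (b - 8) (ν l) hne (by omega) z1.2 (by omega) z2.2 (by omega)
  · have hi : i < k := by omega
    have hcol := h.hcol i j hi hj (by omega)
    have hνi := h.hν i hi
    have hνj := h.hν j hj
    rcases pF2_bit h2 with ⟨hb8, hc⟩ | ⟨hb8, hb16, hc⟩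
    · have z2 : b ≤ m ∧ χ (ν j) b = 1 := by
        rcases hZ j hj b hb1 with q | q | q | q | ⟨x, y, q⟩ | ⟨x, y, q⟩
        · exact q.2
        all_goals omega
      have z1 : ∃ t ≤ m, χ (ν i) t = 1 ∧ χ t b = 1 := by
        rcases hZ i hi _ h1 with q | q | q | q | ⟨x, y, q⟩ | ⟨x, y, q⟩
        · omega
        · omega
        · have := q.2.2
          rwa [Nat.add_sub_cancel_left] at this
        all_goals omega
      obtain ⟨t, ht, t1, t2⟩ := z1
      refine g.c4 1 (Or.inl rfl) (ν i) b t (ν j) (by omega) (by omega) t1 (by omega) ?_ ?_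
      · rw [g.symm]; exact t2
      · rw [g.symm]; exact z2.2
    · have z2 : b - 8 ≤ m ∧ χ (ν j) (b - 8) = 2 := by
        rcases hZ j hj b hb1 with q | q | q | q | ⟨x, y, q⟩ | ⟨x, y, q⟩
        · omega
        · exact q.2.2
        all_goals omega
      have z1 : ∃ t ≤ m, χ (ν i) t = 2 ∧ χ t (b - 8) = 2 := by
        rcases hZ i hi _ h1 with q | q | q | q | ⟨x, y, q⟩ | ⟨x, y, q⟩
        · omega
        · omega
        · omega
        · have := q.2.2
          have e : 16 + b - 24 = b - 8 := by omega
          rwa [e] at this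
        all_goals omega
      obtain ⟨t, ht, t1, t2⟩ := z1
      refine g.c4 2 (Or.inr rfl) (ν i) (b - 8) t (ν j) (by omega) (by omega) t1 (by omega) ?_ ?_
      · rw [g.symm]; exact t2
      · rw [g.symm]; exact z2.2

theorem goN_sound {m k : ℕ} {χ : ℕ → ℕ → ℕ} {E O : List (ℕ × ℕ)} {ν r : ℕ → ℕ} (g : Good χ) (hm : m < 8)
    (h : PM m k χ E O ν r) (L : List ℕ) (hL : ∀ a ∈ L, a < 2 ^ 161) (hn : L.length ≤ 166)
    (Zf : ℕ → ℕ) (hr : ∀ i < k, ∃ hi : r i < L.length, L[r i] = Zf i)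
    (hZ : ∀ i < k, RP m χ (ν i) (Zf i)) (hB : ∀ i < k, Bd (Zf i)) (ONES : ℕ) (hO : ONES = pk (L.map (fun _ => 1))) :
    ∀ d j, j + d = k → goN (pk L) ONES (ONES * (2 ^ 167 - 1)) (ONES * 2 ^ 167) (Nat.mod (ONES * 2 ^ 167) (2 ^ 167 - 1))
      ((List.range' j d).map (fun j => mkF k E O j j)) (clOf Zf r j) = true
  | 0, _, _ => rfl
  | d + 1, j, hjd => by
    have hj : j < k := by omega
    have ih := goN_sound g hm h L hL hn Zf hr hZ hB ONES hO d (j + 1) (by omega)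
    have hc : (187072209578355573530071658587684226515959365500927 : ℕ) = 2 ^ 167 - 1 := by norm_num
    have hc2 : (374144419156711147060143317175368453031918731001856 : ℕ) = BB := by norm_num [BB]
    have e : ∀ (ZZ ONES LOW HIGH ALL : ℕ) (fl : FL) (P : List FL) (cl : CL), goN ZZ ONES LOW HIGH ALL (fl :: P) cl =
      frc (bnd fl cl (Nat.xor ALL (Nat.mod (Nat.land (Nat.add (Nat.land ZZ (Nat.mul (tcomb fl cl) ONES)) LOW) HIGH) 187072209578355573530071658587684226515959365500927)))
     (bits 200 (fun pos => frc (Nat.mod (Nat.div ZZ (Nat.pow pos 168)) 374144419156711147060143317175368453031918731001856)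
       fun Z => goN ZZ ONES LOW HIGH ALL P (CL.cons Z pos cl))) := fun _ _ _ _ _ _ _ _ => rfl
    rw [List.range'_succ, List.map_cons, e, frc_eq, hc, hc2]
    obtain ⟨hrj, hrZ⟩ := hr j hj
    apply bits_sound _ (r j)
    · rw [frc_eq]
      have e1 : Nat.mod (Nat.div (pk L) (Nat.pow (2 ^ r j) 168)) BB = Zf j := by
        have e2 : Nat.pow (2 ^ r j) 168 = BB ^ r j := by
          show (2 ^ r j) ^ 168 = BB ^ r j
          rw [BB, ← pow_mul, ← pow_mul, mul_comm]
        have e3 := pk_digit L (fun a ha => (hL a ha).trans (by norm_num [BB])) (r j) hrj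
        rw [e2, ← hrZ, ← e3]
        rfl
      rw [e1]
      exact ih
    · apply bnd_bit
      · apply mask_spec L _ hL _ hn (r j) hrj _ ONES hO
        · apply Nat.lt_pow_two_of_testBit
          intro b hb
          rw [Bool.eq_false_iff]
          intro hb'
          rcases tcomb_bits k E O Zf r j b j hb' with h0 | ⟨i, hij, ⟨h1, h2⟩ | ⟨h1, h2⟩⟩
          · omega
          · have := hB i (by omega) _ h1; omega
          · have := hB i (by omega) _ h1; omega
        · rw [hrZ]
          exact compat g hm h Zf hZ hB j hj
      · exact fun i' hi' => h.hord i' j hi' hj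

theorem anyP_true {ZZ ONES LOW HIGH ALL : ℕ} {P : List FL} : ∀ {Ps : List (List FL)}, P ∈ Ps →
    goN ZZ ONES LOW HIGH ALL P CL.nil = true → anyP ZZ ONES LOW HIGH ALL Ps = true
  | [], h, _ => by simp at h
  | Q :: Ps, h, hg => by
    have e : anyP ZZ ONES LOW HIGH ALL (Q :: Ps) =
      ifb (goN ZZ ONES LOW HIGH ALL Q CL.nil) true (anyP ZZ ONES LOW HIGH ALL Ps) := rfl
    rw [e, ifb_eq]
    split_ifs with hq
    · rfl
    · rcases List.mem_cons.1 h with rfl | h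
      · exact absurd hg hq
      · exact anyP_true h hg

end R75

namespace R75
set_option maxRecDepth 100000

/-! ## Pattern existence among the last vertices -/

def gb (n a b : ℕ) : Bool := if a < b then n.testBit (b * (b - 1) / 2 + a) else n.testBit (a * (a - 1) / 2 + b)

def qc4 (n : ℕ) : ℕ × ℕ × ℕ × ℕ → Bool
  | (x, y, z, w) => (gb n x z == gb n x w) && (gb n x z == gb n y z) && (gb n x z == gb n y w) &&
    (decide (x < y) && decide (z < w) && decide (x ≠ z) && decide (x ≠ w) && decide (y ≠ z) && decide (y ≠ w))

def quads (k : ℕ) : List (ℕ × ℕ × ℕ × ℕ) :=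
  ((List.range k).flatMap fun x => (List.range k).flatMap fun y => (List.range k).flatMap fun z =>
    (List.range k).map fun w => (x, y, z, w)).filter fun q =>
      decide (q.1 < q.2.1) && decide (q.2.2.1 < q.2.2.2) && decide (q.1 < q.2.2.1) && decide (q.1 ≠ q.2.2.2)
        && decide (q.2.1 ≠ q.2.2.1) && decide (q.2.1 ≠ q.2.2.2)

def permL : ℕ → List (List ℕ)
  | 0 => [[]]
  | k + 1 => (permL k).flatMap fun p => (List.range (k + 1)).map fun i => p.insertIdx i k

def pairL (k : ℕ) : List (ℕ × ℕ) :=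
  (List.range k).flatMap fun j => (List.range j).map fun i => (i, j)

def okPat (n k : ℕ) (Q : List (ℕ × ℕ) × List (ℕ × ℕ)) (ch : List ℕ) : Bool :=
  (pairL k).all fun p => (gb n (ch.getD p.1 0) (ch.getD p.2 0) == decide (pcol Q.1 p.1 p.2 = 1)) &&
    decide (ch.getD p.1 0 ≠ ch.getD p.2 0) && decide (ch.getD p.1 0 < k) && decide (ch.getD p.2 0 < k) &&
    (! Q.2.contains p || decide (ch.getD p.1 0 ≤ ch.getD p.2 0))

def patAll (k N : ℕ) (Qs : List (List (ℕ × ℕ) × List (ℕ × ℕ))) : Bool :=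
  (List.range N).all fun n => (quads k).any (qc4 n) || Qs.any fun Q => (permL k).any (okPat n k Q)

theorem patAll5 : patAll 5 1024 Q5 = true := by decide +kernel
theorem patAll4 : patAll 4 64 Q4 = true := by decide +kernel

theorem pcol_cases (E : List (ℕ × ℕ)) (i j : ℕ) : pcol E i j = 1 ∨ pcol E i j = 2 := by
  unfold pcol; split_ifs <;> simp

theorem pcol_symm (E : List (ℕ × ℕ)) (i j : ℕ) : pcol E i j = pcol E j i := by
  unfold pcol; rw [Bool.or_comm]

theorem pat_exists {k N : ℕ} {Qs : List (List (ℕ × ℕ) × List (ℕ × ℕ))} (hall : patAll k N Qs = true)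
    (hN : 2 ^ (pairL k).length = N) (hp : ∀ b < k, ∀ a < b, (pairL k)[b * (b - 1) / 2 + a]? = some (a, b))
    (hq : ∀ q ∈ quads k, q.1 < k ∧ q.2.1 < k ∧ q.2.2.1 < k ∧ q.2.2.2 < k)
    {χ : ℕ → ℕ → ℕ} (g : Good χ) (ν : ℕ → ℕ) (hinj : ∀ i j, i < k → j < k → i ≠ j → ν i ≠ ν j)
    (h12 : ∀ i j, i < k → j < k → i ≠ j → χ (ν i) (ν j) = 1 ∨ χ (ν i) (ν j) = 2) :
    ∃ Q ∈ Qs, ∃ ch : ℕ → ℕ, ∀ i j, i < j → j < k → ch i < k ∧ ch j < k ∧ ch i ≠ ch j ∧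
      χ (ν (ch i)) (ν (ch j)) = pcol Q.1 i j ∧ (Q.2.contains (i, j) = true → ch i ≤ ch j) := by
  set l : List Bool := (pairL k).map (fun p => decide (χ (ν p.1) (ν p.2) = 1)) with hl
  have hlt : pk2 l < N := by
    have := pk2_lt l
    rwa [hl, List.length_map, hN] at this
  have hg0 : ∀ a b, a < b → b < k → (pk2 l).testBit (b * (b - 1) / 2 + a) = decide (χ (ν a) (ν b) = 1) := by
    intro a b hab hb
    rw [pk2_testBit, hl, List.getD_eq_getElem?_getD, List.getElem?_map, hp b hb a hab]
    rfl
  have hg : ∀ a b, a ≠ b → a < k → b < k → gb (pk2 l) a b = decide (χ (ν a) (ν b) = 1) := by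
    intro a b hab ha hb
    unfold gb
    split_ifs with h
    · exact hg0 a b h hb
    · rw [hg0 b a (by omega) ha, g.symm]
  have h := List.all_eq_true.1 hall (pk2 l) (List.mem_range.2 hlt)
  rw [Bool.or_eq_true] at h
  rcases h with h | h
  · exfalso
    obtain ⟨⟨x, y, z, w⟩, hmem, hc⟩ := List.any_eq_true.1 h
    obtain ⟨hx, hy, hz, hw⟩ := hq _ hmem
    simp only at hx hy hz hw
    simp only [qc4, Bool.and_eq_true, decide_eq_true_eq, beq_iff_eq] at hc
    obtain ⟨⟨⟨e1, e2⟩, e3⟩, ⟨⟨⟨⟨n1, n2⟩, n3⟩, n4⟩, n5⟩, n6⟩ := hc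
    rw [hg x z n3 hx hz] at e1 e2 e3
    rw [hg x w n4 hx hw] at e1
    rw [hg y z n5 hy hz] at e2
    rw [hg y w n6 hy hw] at e3
    have k1 := h12 x z hx hz n3
    have k2 := h12 x w hx hw n4
    have k3 := h12 y z hy hz n5
    have k4 := h12 y w hy hw n6
    have hxy := hinj x y hx hy (by omega)
    have hzw := hinj z w hz hw (by omega)
    simp only [decide_eq_decide] at e1 e2 e3
    rcases k1 with k1 | k1
    · exact g.c4 1 (Or.inl rfl) _ _ _ _ hxy hzw k1 (e1.1 k1) (e2.1 k1) (e3.1 k1)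
    · have u1 : χ (ν x) (ν w) = 2 := by omega
      have u2 : χ (ν y) (ν z) = 2 := by omega
      have u3 : χ (ν y) (ν w) = 2 := by omega
      exact g.c4 2 (Or.inr rfl) _ _ _ _ hxy hzw k1 u1 u2 u3
  · obtain ⟨Q, hQ, h⟩ := List.any_eq_true.1 h
    obtain ⟨ch, -, h⟩ := List.any_eq_true.1 h
    refine ⟨Q, hQ, fun i => ch.getD i 0, ?_⟩
    intro i j hij hj
    have hmem : (i, j) ∈ pairL k := List.mem_of_getElem? (hp j hj i hij)
    have h := List.all_eq_true.1 h _ hmem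
    simp only [Bool.and_eq_true, Bool.or_eq_true, decide_eq_true_eq, beq_iff_eq, Bool.not_eq_true'] at h
    obtain ⟨⟨⟨⟨h1, h2⟩, h3⟩, h4⟩, h5⟩ := h
    refine ⟨h3, h4, h2, ?_, ?_⟩
    · rw [hg _ _ h2 h3 h4] at h1
      have t1 := h12 _ _ h3 h4 h2
      have t2 := pcol_cases Q.1 i j
      rw [decide_eq_decide] at h1
      rcases t1 with t1 | t1
      · exact t1.trans (h1.1 t1).symm
      · rcases t2 with t2 | t2
        · exact (h1.2 t2).trans t2.symm
        · exact t1.trans t2.symm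
    · intro hc
      rcases h5 with h5 | h5
      · rw [hc] at h5; cases h5
      · exact h5

theorem exists_sorted (k : ℕ) (r : ℕ → ℕ) : ∃ σ : ℕ → ℕ, (∀ i < k, σ i < k) ∧
    (∀ i j, i < k → j < k → i ≠ j → σ i ≠ σ j) ∧ ∀ i j, i ≤ j → j < k → r (σ j) ≤ r (σ i) := by
  let f : Fin k → ℕᵒᵈ := fun i => OrderDual.toDual (r i)
  have hm := Tuple.monotone_sort f
  refine ⟨fun i => if h : i < k then (Tuple.sort f ⟨i, h⟩ : ℕ) else 0, ?_, ?_, ?_⟩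
  · intro i hi; simp [hi]
  · intro i j hi hj hij
    simp only [hi, hj, dif_pos]
    intro h
    have := (Tuple.sort f).injective (Fin.ext h)
    simp at this; exact hij this
  · intro i j hij hj
    have hi : i < k := by omega
    simp only [hi, hj, dif_pos]
    exact hm (show (⟨i, hi⟩ : Fin k) ≤ ⟨j, hj⟩ from hij)

theorem leaf_sound {m k N : ℕ} {Qs : List (List (ℕ × ℕ) × List (ℕ × ℕ))} (hall : patAll k N Qs = true)
    (hN : 2 ^ (pairL k).length = N) (hp : ∀ b < k, ∀ a < b, (pairL k)[b * (b - 1) / 2 + a]? = some (a, b))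
    (hq : ∀ q ∈ quads k, q.1 < k ∧ q.2.1 < k ∧ q.2.2.1 < k ∧ q.2.2.2 < k)
    (hmk : m + k = 11) (hm : m < 8) {χ : ℕ → ℕ → ℕ} (g : Good χ) (h3 : ∀ n, m < n → n < 12 → χ 0 n = 3)
    (A1 A2 A3 C : ℕ) (hI : Inv m χ A1 A2 A3 C) : leafN (desc m) (Qs.map (patF k)) A1 A2 A3 C = true := by
  have h160 : (1461501637330902918203684832716283019655932542976 : ℕ) = 2 ^ 160 := by norm_num
  have h168 : (374144419156711147060143317175368453031918731001856 : ℕ) = BB := by norm_num [BB]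
  have h167 : (187072209578355573530071658587684226515959365500927 : ℕ) = 2 ^ 167 - 1 := by norm_num
  have e : leafN (desc m) (Qs.map (patF k)) A1 A2 A3 C =
    frc A1 fun A1 => frc A2 fun A2 => frc A3 fun A3 => mkIL A1 A2 A3 (desc m) .nil fun I => rowsN I 0 0 0 0
    (Nat.add 1461501637330902918203684832716283019655932542976 (Nat.mod (Nat.add A1 (Nat.mul 3 A2)) 1461501637330902918203684832716283019655932542976)) 374144419156711147060143317175368453031918731001856 fun ZZ NN =>
  ifb (Nat.ble NN (Nat.pow 2 27000)) (frc (Nat.div (Nat.sub NN 1) (Nat.sub (Nat.pow 2 168) 1)) fun ONES =>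
  frc (Nat.mul ONES (Nat.sub (Nat.pow 2 167) 1)) fun LOW =>
  frc (Nat.mul ONES (Nat.pow 2 167)) fun HIGH =>
   frc (Nat.mod HIGH 187072209578355573530071658587684226515959365500927) fun ALL =>
   anyP ZZ ONES LOW HIGH ALL (Qs.map (patF k))) true := rfl
  rw [e, frc_eq, frc_eq, frc_eq, mkIL_eq, rowsN_eq, ifb_eq]
  clear e
  split_ifs with hle
  swap
  · rfl
  rw [frc_eq, frc_eq, frc_eq, frc_eq]
  set I := ilOf A1 A2 A3 (desc m) .nil with hIdef
  have hIOK : IOK m χ 1 I := ilOf_ok hI m .nil le_rfl trivial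
  rw [h160, h168] at *
  rw [h167]
  set Z0 := Nat.add (2 ^ 160) (Nat.mod (Nat.add A1 (Nat.mul 3 A2)) (2 ^ 160)) with hZ0
  have hZ0lt : Z0 < 2 ^ 161 := by
    have h1 : Nat.mod (Nat.add A1 (Nat.mul 3 A2)) (2 ^ 160) < 2 ^ 160 := Nat.mod_lt _ (by positivity)
    have h2 : Z0 = 2 ^ 160 + Nat.mod (Nat.add A1 (Nat.mul 3 A2)) (2 ^ 160) := rfl
    rw [h2, pow_succ 2 160]
    omega
  clear_value Z0
  set L := rowsL I 0 0 0 0 with hL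
  have eZ : Z0 + BB * pk L = pk (Z0 :: L) := rfl
  have eN : BB * BB ^ L.length = BB ^ (Z0 :: L).length := by
    rw [List.length_cons, pow_succ, mul_comm]
  rw [eZ]
  rw [eN] at hle ⊢
  have hlen : (Z0 :: L).length ≤ 166 := by
    have h1 : BB ^ (Z0 :: L).length ≤ 2 ^ 27000 := Nat.le_of_ble_eq_true hle
    rw [BB, ← pow_mul] at h1
    have := (Nat.pow_le_pow_iff_right (by norm_num : 1 < 2)).1 h1
    omega
  clear hle
  have hO : Nat.div (Nat.sub (BB ^ (Z0 :: L).length) 1) (Nat.sub (Nat.pow 2 168) 1) = pk ((Z0 :: L).map (fun _ => 1)) := by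
    have h1 := pk_ones (Z0 :: L)
    have h2 : Nat.div (Nat.sub (BB ^ (Z0 :: L).length) 1) (Nat.sub (Nat.pow 2 168) 1) = (BB ^ (Z0 :: L).length - 1) / (BB - 1) := rfl
    rw [h2, ← h1]
    exact Nat.mul_div_cancel_left _ (by norm_num [BB])
  rw [hO]
  have hbd : ∀ Z ∈ L, Bd Z := rows_bd I 0 0 0 0 (hIOK.ib hm) (by simp) (by simp) (by intro b hb; simp at hb)
  have hrow : ∀ i, ∃ rr, i < k → ∃ h : rr < (Z0 :: L).length, RP m χ (m + 1 + i) (Z0 :: L)[rr] ∧ Bd (Z0 :: L)[rr] := by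
    intro i
    by_cases hi : i < k
    · obtain ⟨Z', hZ', hRP⟩ := rows_mem g hm (n := m + 1 + i) (by omega) (by omega) I 1 0 0 0 0 hIOK
        (fun b hb => by simp at hb) (fun b hb => by simp at hb) (fun b hb => by simp at hb) (fun b hb => by simp at hb)
      obtain ⟨t, ht, hte⟩ := List.getElem_of_mem (List.mem_cons_of_mem Z0 hZ')
      refine ⟨t, fun _ => ⟨ht, ?_⟩⟩
      rw [hte]
      exact ⟨hRP, hbd _ hZ'⟩
    · exact ⟨0, fun h => absurd h hi⟩
  choose r0 hr0 using hrow
  obtain ⟨σ, s1, s2, s3⟩ := exists_sorted k r0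
  obtain ⟨Q, hQ, ch, hch⟩ := pat_exists hall hN hp hq g (fun i => m + 1 + σ i)
    (fun i j hi hj hij => by have := s2 i j hi hj hij; omega)
    (fun i j hi hj hij => by
      have hne := s2 i j hi hj hij
      have u1 := s1 i hi
      have u2 := s1 j hj
      have h1 := h3 (m + 1 + σ i) (by omega) (by omega)
      have h2 := h3 (m + 1 + σ j) (by omega) (by omega)
      rcases g.rng (m + 1 + σ i) (m + 1 + σ j) (by omega) (by omega) (by omega) with h | h | h
      · exact Or.inl h
      · exact Or.inr h
      · exact (g.tri _ _ _ h1 h h2).elim)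
  have hk1 : 1 < k := by omega
  have hchk : ∀ i < k, ch i < k := by
    intro i hi
    by_cases h0 : i = 0
    · rw [h0]; exact (hch 0 1 (by omega) hk1).1
    · exact (hch 0 i (by omega) hi).2.1
  have PMh : PM m k χ Q.1 Q.2 (fun i => m + 1 + σ (ch i)) (fun i => r0 (σ (ch i))) := by
    refine ⟨fun i _ => by omega, ?_, ?_, ?_⟩
    · intro i j hi hj hij
      have : ch i ≠ ch j := by
        rcases Nat.lt_or_gt_of_ne hij with h | h
        · exact (hch i j h hj).2.2.1
        · exact (hch j i h hi).2.2.1.symm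
      have := s2 _ _ (hchk i hi) (hchk j hj) this
      show m + 1 + σ (ch i) ≠ m + 1 + σ (ch j)
      omega
    · intro i j hi hj hij
      rcases Nat.lt_or_gt_of_ne hij with h | h
      · exact (hch i j h hj).2.2.2.1
      · rw [g.symm, pcol_symm]
        exact (hch j i h hi).2.2.2.1
    · intro i j hij hj hc
      exact s3 _ _ ((hch i j hij hj).2.2.2.2 hc) (hchk j hj)
  refine anyP_true (List.mem_map_of_mem hQ) ?_
  have hfin := goN_sound g hm PMh (Z0 :: L) ?_ hlen (fun i => (Z0 :: L).getD (r0 (σ (ch i))) 0) ?_ ?_ ?_ _ rfl k 0 (by omega)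
  · exact hfin
  · intro a ha
    rcases List.mem_cons.1 ha with rfl | ha
    · exact hZ0lt
    · exact (hbd a ha).lt.trans (by norm_num)
  · intro i hi
    obtain ⟨h1, h2⟩ := hr0 (σ (ch i)) (s1 _ (hchk i hi))
    exact ⟨h1, (List.getD_eq_getElem _ _ h1).symm⟩
  · intro i hi
    obtain ⟨h1, h2, _⟩ := hr0 (σ (ch i)) (s1 _ (hchk i hi))
    simp only [List.getD_eq_getElem _ _ h1]
    exact h2
  · intro i hi
    obtain ⟨h1, _, h2⟩ := hr0 (σ (ch i)) (s1 _ (hchk i hi))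
    simp only [List.getD_eq_getElem _ _ h1]
    exact h2

theorem leaf5 {χ : ℕ → ℕ → ℕ} (g : Good χ) (h3 : ∀ n, 6 < n → n < 12 → χ 0 n = 3)
    (A1 A2 A3 C : ℕ) (hI : Inv 6 χ A1 A2 A3 C) : leafN [6, 5, 4, 3, 2, 1] P5 A1 A2 A3 C = true := by
  rw [P5_eq]
  exact leaf_sound patAll5 (by decide) (by decide) (by decide) rfl (by omega) g h3 A1 A2 A3 C hI

theorem leaf4 {χ : ℕ → ℕ → ℕ} (g : Good χ) (h3 : ∀ n, 7 < n → n < 12 → χ 0 n = 3)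
    (A1 A2 A3 C : ℕ) (hI : Inv 7 χ A1 A2 A3 C) : leafN [7, 6, 5, 4, 3, 2, 1] P4 A1 A2 A3 C = true := by
  rw [P4_eq]
  exact leaf_sound patAll4 (by decide) (by decide) (by decide) rfl (by omega) g h3 A1 A2 A3 C hI
end R75

namespace R75
set_option maxRecDepth 100000

/-! ## No configuration occurs -/

theorem nbeq (a b : ℕ) : Nat.beq a b = true ↔ a = b :=
  ⟨Nat.eq_of_beq_eq_true, fun h => by rw [h]; exact Nat.beq_refl b⟩

/-- `χ` has the configuration `c` at the vertex `0`. -/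
structure Conf (c : Cfg) (χ : ℕ → ℕ → ℕ) : Prop where
  good : Good χ
  h1 : ∀ w, χ 0 w = 1 ↔ w ∈ c.l1
  h2 : ∀ w, χ 0 w = 2 ↔ w ∈ c.l2
  hw : (c.l1.map (gw χ)).sum + (c.l2.map (gw χ)).sum ≤ c.bnd

def hs (s i : ℕ) : ℕ := if i < 8 then sg s i else i

def VV (c : Cfg) (s : ℕ) : Bool :=
  ((List.range 8).map (sg s)).isPerm (List.range 8) && (sg s 0).beq 0 &&
    (c.l1.map (hs s)).isPerm c.l1 && (c.l2.map (hs s)).isPerm c.l2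

def act (s : ℕ) (χ : ℕ → ℕ → ℕ) (i j : ℕ) : ℕ := χ (hs s i) (hs s j)

theorem VV.spec {c : Cfg} {s : ℕ} (h : VV c s = true) : Function.Bijective (hs s) ∧ (∀ i < 8, hs s i < 8) ∧
    hs s 0 = 0 ∧ (c.l1.map (hs s)).Perm c.l1 ∧ (c.l2.map (hs s)).Perm c.l2 := by
  unfold VV at h
  simp only [Bool.and_eq_true, List.isPerm_iff, nbeq] at h
  obtain ⟨⟨⟨h0, hz⟩, h1⟩, h2⟩ := h
  have e : ∀ i < 8, hs s i = sg s i := fun i hi => if_pos hi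
  have e' : ∀ i, ¬ i < 8 → hs s i = i := fun i hi => if_neg hi
  have lt : ∀ i < 8, hs s i < 8 := by
    intro i hi
    rw [e i hi]
    have : sg s i ∈ (List.range 8).map (sg s) := List.mem_map_of_mem (List.mem_range.2 hi)
    exact List.mem_range.1 (h0.mem_iff.1 this)
  have inj8 : ∀ i j, i < 8 → j < 8 → sg s i = sg s j → i = j := by
    intro i j hi hj hij
    have hn : ((List.range 8).map (sg s)).Nodup := h0.nodup_iff.2 List.nodup_range
    exact List.inj_on_of_nodup_map hn (List.mem_range.2 hi) (List.mem_range.2 hj) hij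
  refine ⟨⟨?_, ?_⟩, lt, by rw [e 0 (by omega)]; exact hz, h1, h2⟩
  · intro i j hij
    by_cases hi : i < 8 <;> by_cases hj : j < 8
    · rw [e i hi, e j hj] at hij
      exact inj8 i j hi hj hij
    · have := lt i hi; rw [hij, e' j hj] at this; omega
    · have := lt j hj; rw [← hij, e' i hi] at this; omega
    · rwa [e' i hi, e' j hj] at hij
  · intro b
    by_cases hb : b < 8
    · have := h0.mem_iff.2 (List.mem_range.2 hb)
      obtain ⟨a, ha, hab⟩ := List.mem_map.1 this
      exact ⟨a, by rw [e a (List.mem_range.1 ha)]; exact hab⟩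
    · exact ⟨b, e' b hb⟩

theorem hs_lt12 {s i : ℕ} (lt : ∀ i < 8, hs s i < 8) : hs s i < 12 ↔ i < 12 := by
  by_cases hi : i < 8
  · have := lt i hi; omega
  · have : hs s i = i := if_neg hi
    omega

theorem Good.act {χ : ℕ → ℕ → ℕ} (g : Good χ) {c : Cfg} {s : ℕ} (h : VV c s = true) : Good (act s χ) := by
  obtain ⟨bij, lt, -, -, -⟩ := (VV.spec h)
  refine ⟨fun i j => g.symm _ _, fun i j hi hj hij => ?_, fun i j hij => ?_, ?_, ?_⟩
  · exact g.rng _ _ ((hs_lt12 lt).2 hi) ((hs_lt12 lt).2 hj) (fun h => hij (bij.1 h))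
  · obtain ⟨h1, h2, h3⟩ := g.supp _ _ hij
    exact ⟨(hs_lt12 lt).1 h1, (hs_lt12 lt).1 h2, fun h => h3 (by rw [h])⟩
  · intro c hc a b x y hab hxy
    exact g.c4 c hc _ _ _ _ (fun h => hab (bij.1 h)) (fun h => hxy (bij.1 h))
  · intro a b c
    exact g.tri _ _ _

theorem gw_act {χ : ℕ → ℕ → ℕ} {s : ℕ} (bij : Function.Bijective (hs s)) (h0 : hs s 0 = 0) (w : ℕ) :
    gw (act s χ) w = gw χ (hs s w) := by
  have hO : covO (act s χ) 0 w ↔ covO χ 0 (hs s w) := by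
    unfold covO act
    rw [h0]
    constructor
    · rintro ⟨y, hy⟩; exact ⟨hs s y, hy⟩
    · rintro ⟨y, hy⟩
      obtain ⟨x, rfl⟩ := bij.2 y
      exact ⟨x, hy⟩
  have hS : covS (act s χ) 0 w ↔ covS χ 0 (hs s w) := by
    unfold covS act
    rw [h0]
    constructor
    · rintro ⟨y, hy⟩; exact ⟨hs s y, hy⟩
    · rintro ⟨y, hy⟩
      obtain ⟨x, rfl⟩ := bij.2 y
      exact ⟨x, hy⟩
  classical
  unfold gw
  rw [if_congr hO rfl rfl, if_congr hS rfl rfl]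

theorem Conf.act {c : Cfg} {χ : ℕ → ℕ → ℕ} (H : Conf c χ) {s : ℕ} (h : VV c s = true) : Conf c (act s χ) := by
  obtain ⟨bij, lt, h0, p1, p2⟩ := (VV.spec h)
  have key : ∀ l : List ℕ, (l.map (hs s)).Perm l → ∀ w, hs s w ∈ l ↔ w ∈ l := by
    intro l hl w
    rw [← hl.mem_iff, List.mem_map]
    constructor
    · rintro ⟨x, hx, hxw⟩
      rwa [← bij.1 hxw]
    · exact fun hw => ⟨w, hw, rfl⟩
  have sm : ∀ l : List ℕ, (l.map (hs s)).Perm l → (l.map (gw (R75.act s χ))).sum = (l.map (gw χ)).sum := by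
    intro l hl
    have e : l.map (gw (R75.act s χ)) = (l.map (hs s)).map (gw χ) := by
      rw [List.map_map]
      apply List.map_congr_left
      intro w _
      exact gw_act bij h0 w
    rw [e]
    exact (hl.map _).sum_eq
  refine ⟨H.good.act h, fun w => ?_, fun w => ?_, ?_⟩
  · show χ (hs s 0) (hs s w) = 1 ↔ _
    rw [h0, H.h1, key _ p1]
  · show χ (hs s 0) (hs s w) = 2 ↔ _
    rw [h0, H.h2, key _ p2]
  · rw [sm _ p1, sm _ p2]; exact H.hw

def elen : EL → ℕ
  | .nil => 0
  | .cons _ _ t => elen t + 1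

def code (χ : ℕ → ℕ → ℕ) : EL → ℕ
  | .nil => 0
  | .cons i j t => χ i j * 4 ^ elen t + code χ t

theorem code_lt {χ : ℕ → ℕ → ℕ} (h : ∀ i j, χ i j < 4) : ∀ l, code χ l < 4 ^ elen l
  | .nil => by simp [code, elen]
  | .cons i j t => by
    have h1 := code_lt h t
    have h2 := h i j
    rw [code, elen, pow_succ]
    nlinarith

theorem lexle_of_code {χ χ' : ℕ → ℕ → ℕ} (h : ∀ i j, χ i j < 4) (h' : ∀ i j, χ' i j < 4) :
    ∀ l, code χ l ≤ code χ' l → lexle χ χ' l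
  | .nil, _ => trivial
  | .cons i j t, hc => by
    have h1 := code_lt h t
    have h2 := code_lt h' t
    rw [code, code] at hc
    rw [lexle]
    rcases lt_trichotomy (χ i j) (χ' i j) with hl | hl | hl
    · exact Or.inl hl
    · refine Or.inr ⟨hl, lexle_of_code h h' t ?_⟩
      rw [hl] at hc; omega
    · exfalso
      have : (χ' i j + 1) * 4 ^ elen t ≤ χ i j * 4 ^ elen t := Nat.mul_le_mul_right _ hl
      rw [add_mul] at this
      omega

theorem Good.lt4 {χ : ℕ → ℕ → ℕ} (g : Good χ) (i j : ℕ) : χ i j < 4 := by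
  by_cases h : χ i j = 0
  · omega
  · obtain ⟨h1, h2, h3⟩ := g.supp i j h
    have := g.rng i j h1 h2 h3
    omega

theorem exists_min {c : Cfg} {χ : ℕ → ℕ → ℕ} (H : Conf c χ) :
    ∃ χ', Conf c χ' ∧ ∀ s, VV c s = true → code χ' c.el ≤ code (act s χ') c.el := by
  classical
  have hex : ∃ n, ∃ χ', Conf c χ' ∧ code χ' c.el = n := ⟨_, χ, H, rfl⟩
  obtain ⟨χ', H', hc⟩ := Nat.find_spec hex
  refine ⟨χ', H', fun s hs => ?_⟩
  rw [hc]
  exact Nat.find_min' hex ⟨_, H'.act hs, rfl⟩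

def elB : EL → Bool
  | .nil => true
  | .cons i j t => decide (i < 8) && decide (j < 8) && elB t

theorem elB_ok (m : ℕ) : ∀ l, elB l = true → elOK m l
  | .nil, _ => trivial
  | .cons i j t, h => by
    simp only [elB, Bool.and_eq_true, decide_eq_true_eq] at h
    exact ⟨h.1.1, h.1.2, elB_ok m t h.2⟩

theorem lexle_congr {χ χ1 χ2 : ℕ → ℕ → ℕ} (h : ∀ i j, i < 8 → j < 8 → χ1 i j = χ2 i j) :
    ∀ l, elB l = true → lexle χ χ1 l → lexle χ χ2 l
  | .nil, _, _ => trivial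
  | .cons i j t, hB, hl => by
    simp only [elB, Bool.and_eq_true, decide_eq_true_eq] at hB
    rw [lexle] at hl ⊢
    rw [← h i j hB.1.1 hB.1.2]
    rcases hl with hl | ⟨h1, h2⟩
    · exact Or.inl hl
    · exact Or.inr ⟨h1, lexle_congr h t hB.2 h2⟩

def cfgB (c : Cfg) : Bool := elB c.el && c.l1.all (tb c.m1) && c.l2.all (tb c.m2)

theorem Conf.hyp {c : Cfg} {χ : ℕ → ℕ → ℕ} (H : Conf c χ) (hc : cfgB c = true)
    (hmin : ∀ s, VV c s = true → code χ c.el ≤ code (R75.act s χ) c.el) {m : ℕ} (hm : m < 12) : Hyp m χ c (VV c) := by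
  simp only [cfgB, Bool.and_eq_true, List.all_eq_true] at hc
  obtain ⟨⟨h0, h1⟩, h2⟩ := hc
  refine ⟨H.good, hm, fun w hw => (H.h1 w).2 hw, fun w hw => (H.h2 w).2 hw, ?_, ?_, H.hw, elB_ok m _ h0, ?_⟩
  · intro y hy
    rw [← tb_eq]; exact h1 y ((H.h1 y).1 hy)
  · intro y hy
    rw [← tb_eq]; exact h2 y ((H.h2 y).1 hy)
  · intro s hs
    obtain ⟨bij, lt, -, -, -⟩ := (VV.spec hs)
    have e : ∀ i < 8, R75.hs s i = sg s i := fun i hi => if_pos hi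
    refine ⟨fun i hi => by rw [← e i hi]; exact lt i hi, ?_⟩
    refine lexle_congr ?_ _ h0 (lexle_of_code H.good.lt4 (H.act hs).good.lt4 _ (hmin s hs))
    intro i j hi hj
    show χ (R75.hs s i) (R75.hs s j) = χ (sg s i) (sg s j)
    rw [e i hi, e j hj]

def sideB (m : ℕ) (l : List ℕ) (A : ℕ) : Bool := decide (A < 2 ^ 64) &&
  (List.range 8).all fun i => (List.range 8).all fun j => ! tb A (8 * i + j) ||
    (((i.beq 0 && l.contains j) || (j.beq 0 && l.contains i)) && decide (j ≤ m))

def initB (c : Cfg) (m A1 A2 C : ℕ) : Bool := sideB m c.l1 A1 && sideB m c.l2 A2 &&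
  (List.range 8).all fun i => (List.range 8).all fun j => (colAt C i j).beq 0 ||
    ((colAt C i j).beq 1 && ((i.beq 0 && c.l1.contains j) || (j.beq 0 && c.l1.contains i))) ||
    ((colAt C i j).beq 2 && ((i.beq 0 && c.l2.contains j) || (j.beq 0 && c.l2.contains i)))

theorem sideB_ok {m : ℕ} {l : List ℕ} {A k : ℕ} {χ : ℕ → ℕ → ℕ} (hsym : ∀ i j, χ i j = χ j i)
    (hl : ∀ w ∈ l, χ 0 w = k) (h : sideB m l A = true) (i j : ℕ) (hj : j < 8)
    (hA : A.testBit (8 * i + j) = true) : χ i j = k ∧ j ≤ m := by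
  simp only [sideB, Bool.and_eq_true, decide_eq_true_eq, List.all_eq_true, List.mem_range, Bool.or_eq_true,
    Bool.not_eq_true', nbeq, List.contains_iff_mem] at h
  obtain ⟨h0, h⟩ := h
  have hi : i < 8 := by
    by_contra hi
    have : A < 2 ^ (8 * i + j) := h0.trans_le (Nat.pow_le_pow_right (by norm_num) (by omega))
    rw [Nat.testBit_lt_two_pow this] at hA
    cases hA
  rcases h i hi j hj with h | ⟨⟨rfl, h⟩ | ⟨rfl, h⟩, hm⟩
  · rw [tb_eq, hA] at h; cases h
  · exact ⟨hl _ h, hm⟩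
  · exact ⟨by rw [hsym]; exact hl _ h, hm⟩

theorem initB_ok {c : Cfg} {m A1 A2 C : ℕ} {χ : ℕ → ℕ → ℕ} (H : Conf c χ) (h : initB c m A1 A2 C = true) :
    Inv m χ A1 A2 0 C := by
  rw [initB, Bool.and_eq_true, Bool.and_eq_true] at h
  obtain ⟨⟨h1, h2⟩, h3⟩ := h
  have hsym := H.good.symm
  refine ⟨sideB_ok hsym (fun w hw => (H.h1 w).2 hw) h1, sideB_ok hsym (fun w hw => (H.h2 w).2 hw) h2, ?_, ?_⟩
  · intro i j _ h; simp at h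
  · intro i j hi hj
    simp only [Bool.and_eq_true, List.all_eq_true, List.mem_range, Bool.or_eq_true,
      nbeq, List.contains_iff_mem] at h3
    rcases h3 i hi j hj with (h | ⟨h, ⟨rfl, h'⟩ | ⟨rfl, h'⟩⟩) | ⟨h, ⟨rfl, h'⟩ | ⟨rfl, h'⟩⟩
    · exact Or.inl h
    · right; rw [h, (H.h1 _).2 h']
    · right; rw [h, hsym, (H.h1 _).2 h']
    · right; rw [h, (H.h2 _).2 h']
    · right; rw [h, hsym, (H.h2 _).2 h']

def allB (c : Cfg) (m : ℕ) (l : List Step) (A1 A2 C : ℕ) : Bool :=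
  cfgB c && decide (m < 12) && stepsOK m (VV c) l && freshAll A1 l && freshAll A2 l && initB c m A1 A2 C

theorem no_conf_small {c : Cfg} (m : ℕ) {l : List Step} {A1 A2 C : ℕ}
    (hrun : dfs (fun _ _ _ _ => true) c l A1 A2 0 C = false) (hB : allB c m l A1 A2 C = true)
    (χ : ℕ → ℕ → ℕ) : ¬ Conf c χ := by
  intro H0
  obtain ⟨χ, H, hmin⟩ := exists_min H0
  simp only [allB, Bool.and_eq_true, decide_eq_true_eq] at hB
  obtain ⟨⟨⟨⟨⟨h1, h2⟩, h3⟩, h4⟩, h5⟩, h6⟩ := hB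
  have := dfs_sound (H.hyp h1 hmin h2) (fun _ _ _ _ => true) (fun _ _ _ _ _ => rfl) l h3 A1 A2 0 C h4 h5 (initB_ok H h6)
  rw [hrun] at this
  cases this

theorem no_conf06 : ∀ χ, ¬ Conf cfg06 χ := no_conf_small 6 run06 (by decide +kernel)
theorem no_conf15 : ∀ χ, ¬ Conf cfg15 χ := no_conf_small 6 run15 (by decide +kernel)
theorem no_conf07 : ∀ χ, ¬ Conf cfg07 χ := no_conf_small 7 run07 (by decide +kernel)
theorem no_conf16 : ∀ χ, ¬ Conf cfg16 χ := no_conf_small 7 run16 (by decide +kernel)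
theorem no_conf05 : ∀ χ, ¬ Conf cfg05 χ := no_conf_small 5 run05 (by decide +kernel)
theorem no_conf14 : ∀ χ, ¬ Conf cfg14 χ := no_conf_small 5 run14 (by decide +kernel)
theorem no_conf23 : ∀ χ, ¬ Conf cfg23 χ := no_conf_small 5 run23 (by decide +kernel)
theorem no_conf25 : ∀ χ, ¬ Conf cfg25 χ := no_conf_small 7 run25 (by decide +kernel)

def qlFresh (l : List Step) : QL → Bool
  | .nil => true
  | .cons a1 a2 _ _ t => freshAll a1 l && freshAll a2 l && qlFresh l t

theorem qlAll_and {l : List Step} {P : ℕ → ℕ → ℕ → ℕ → Prop} : ∀ {q : QL}, qlFresh l q = true → qlAll P q →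
    qlAll (fun A1 A2 A3 C => P A1 A2 A3 C ∧ freshAll A1 l = true ∧ freshAll A2 l = true) q
  | .nil, _, _ => trivial
  | .cons a1 a2 a3 c t, h, hp => by
    rw [qlFresh, Bool.and_eq_true, Bool.and_eq_true] at h
    exact ⟨⟨hp.1, h.1.1, h.1.2⟩, qlAll_and h.2 hp.2⟩

theorem no_conf_big {c : Cfg} (m : ℕ) {pre post : List Step} {q : QL} {A1 A2 C : ℕ} {leaf : ℕ → ℕ → ℕ → ℕ → Bool}
    (hleaf : ∀ χ, Conf c χ → ∀ A1 A2 A3 C, Inv m χ A1 A2 A3 C → leaf A1 A2 A3 C = true)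
    (hpre : dfs (notMem q) c pre A1 A2 0 C = false)
    (hq : qlAll (fun A1 A2 A3 C => dfs leaf c post A1 A2 A3 C = false) q)
    (hB : allB c m pre A1 A2 C = true) (hB2 : (stepsOK m (VV c) post && qlFresh post q) = true)
    (χ : ℕ → ℕ → ℕ) : ¬ Conf c χ := by
  intro H0
  obtain ⟨χ, H, hmin⟩ := exists_min H0
  simp only [allB, Bool.and_eq_true, decide_eq_true_eq] at hB
  obtain ⟨⟨⟨⟨⟨h1, h2⟩, h3⟩, h4⟩, h5⟩, h6⟩ := hB
  rw [Bool.and_eq_true] at hB2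
  have hH := H.hyp h1 hmin h2
  have := dfs_sound hH (notMem q) ?_ pre h3 A1 A2 0 C h4 h5 (initB_ok H h6)
  · rw [hpre] at this
    cases this
  · intro B1 B2 B3 D hI
    refine notMem_true ?_ (qlAll_and hB2.2 hq)
    rintro ⟨hf, f1, f2⟩
    have := dfs_sound hH leaf (hleaf χ H) post hB2.1 B1 B2 B3 D f1 f2 hI
    rw [hf] at this
    cases this

theorem Conf.three {c : Cfg} {χ : ℕ → ℕ → ℕ} (H : Conf c χ) {m : ℕ} (h1 : ∀ w ∈ c.l1, w ≤ m) (h2 : ∀ w ∈ c.l2, w ≤ m)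
    (n : ℕ) (hn : m < n) (hn2 : n < 12) : χ 0 n = 3 := by
  rcases H.good.rng 0 n (by omega) hn2 (by omega) with h | h | h
  · have := h1 n ((H.h1 n).1 h); omega
  · have := h2 n ((H.h2 n).1 h); omega
  · exact h

theorem no_conf33 : ∀ χ, ¬ Conf cfg33 χ := no_conf_big 6
  (fun _ H => leaf5 H.good (H.three (by decide) (by decide))) pre_run33
  ⟨run33_0, run33_1, run33_2, run33_3, run33_4, run33_5, run33_6, run33_7, run33_8, run33_9, run33_10, run33_11, run33_12, run33_13, run33_14, run33_15, run33_16, run33_17, run33_18, run33_19, run33_20, run33_21, run33_22, run33_23, run33_24, run33_25, run33_26, trivial⟩ (by decide +kernel) (by decide +kernel)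
theorem no_conf24 : ∀ χ, ¬ Conf cfg24 χ := no_conf_big 6
  (fun _ H => leaf5 H.good (H.three (by decide) (by decide))) pre_run24
  ⟨run24_0, run24_1, run24_2, run24_3, run24_4, run24_5, run24_6, run24_7, run24_8, run24_9, run24_10, run24_11, trivial⟩ (by decide +kernel) (by decide +kernel)
theorem no_conf34 : ∀ χ, ¬ Conf cfg34 χ := no_conf_big 7
  (fun _ H => leaf4 H.good (H.three (by decide) (by decide))) pre_run34
  ⟨run34_0, run34_1, run34_2, run34_3, run34_4, run34_5, run34_6, run34_7, run34_8, run34_9, trivial⟩ (by decide +kernel) (by decide +kernel)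
end R75

namespace R75
set_option maxRecDepth 100000

/-! ## Relabelling -/

noncomputable def nb (χ : ℕ → ℕ → ℕ) (v c : ℕ) : Finset ℕ := (Finset.range 12).filter (fun w => χ v w = c)

open Classical in
noncomputable def gv (χ : ℕ → ℕ → ℕ) (v w : ℕ) : ℕ :=
  (if covO χ v w then 0 else 3) + (if covS χ v w then 0 else 1)

theorem mem_nb {χ : ℕ → ℕ → ℕ} (g : Good χ) {v c w : ℕ} (hc : c ≠ 0) : w ∈ nb χ v c ↔ χ v w = c := by
  unfold nb
  rw [Finset.mem_filter, Finset.mem_range]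
  refine ⟨fun h => h.2, fun h => ⟨?_, h⟩⟩
  exact (g.supp v w (by omega)).2.1

theorem Good.diag {χ : ℕ → ℕ → ℕ} (g : Good χ) (v : ℕ) : χ v v = 0 := by
  by_contra h
  exact (g.supp v v h).2.2 rfl

theorem exists_label {χ : ℕ → ℕ → ℕ} (g : Good χ) {v : ℕ} (hv : v < 12) {p q : ℕ} (hp : (nb χ v 1).card = p)
    (hq : (nb χ v 2).card = q) : ∃ π : ℕ → ℕ, Function.Bijective π ∧ π 0 = v ∧ (∀ i, π i < 12 ↔ i < 12) ∧
      (List.range' 1 p).map π = (nb χ v 1).toList ∧ (List.range' (1 + p) q).map π = (nb χ v 2).toList := by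
  set L1 := (nb χ v 1).toList with hL1
  set L2 := (nb χ v 2).toList with hL2
  set L3 := (nb χ v 3).toList with hL3
  set L := (v :: L1) ++ (L2 ++ L3) with hL
  have m1 : ∀ w, w ∈ L1 ↔ χ v w = 1 := fun w => by rw [hL1, Finset.mem_toList, mem_nb g (by omega)]
  have m2 : ∀ w, w ∈ L2 ↔ χ v w = 2 := fun w => by rw [hL2, Finset.mem_toList, mem_nb g (by omega)]
  have m3 : ∀ w, w ∈ L3 ↔ χ v w = 3 := fun w => by rw [hL3, Finset.mem_toList, mem_nb g (by omega)]
  have d0 := g.diag v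
  have hn : L.Nodup := by
    rw [hL, List.nodup_append, List.nodup_append, List.nodup_cons]
    refine ⟨⟨?_, Finset.nodup_toList _⟩, ⟨Finset.nodup_toList _, Finset.nodup_toList _, ?_⟩, ?_⟩
    · rw [m1]; omega
    · intro a ha b hb hab
      rw [m2] at ha
      rw [m3, ← hab] at hb
      omega
    · intro a ha b hb hab
      rw [List.mem_append, m2, m3, ← hab] at hb
      rw [List.mem_cons, m1] at ha
      rcases ha with rfl | ha
      · omega
      · omega
  have hmem : ∀ x, x ∈ L ↔ x < 12 := by
    intro x
    rw [hL, List.mem_append, List.mem_append, List.mem_cons, m1, m2, m3]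
    constructor
    · rintro ((rfl | h) | h | h)
      · exact hv
      all_goals exact (g.supp v x (by omega)).2.1
    · intro hx
      by_cases hxv : x = v
      · exact Or.inl (Or.inl hxv)
      · have := g.rng v x hv hx (Ne.symm hxv)
        tauto
  have hlen : L.length = 12 := by
    have h1 : L.toFinset = Finset.range 12 := by
      ext x; rw [List.mem_toFinset, hmem, Finset.mem_range]
    rw [← List.toFinset_card_of_nodup hn, h1, Finset.card_range]
  have l1 : L1.length = p := by rw [hL1, Finset.length_toList, hp]
  have l2 : L2.length = q := by rw [hL2, Finset.length_toList, hq]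
  have hlen2 : 1 + p + q + L3.length = 12 := by
    rw [hL] at hlen
    simp only [List.length_append, List.length_cons, l1, l2] at hlen
    omega
  let π : ℕ → ℕ := fun i => if i < 12 then L.getD i 0 else i
  have π1 : ∀ i, ∀ h : i < 12, π i = L[i]'(by omega) := by
    intro i h
    show (if i < 12 then L.getD i 0 else i) = _
    rw [if_pos h, List.getD_eq_getElem]
  have π2 : ∀ i, ¬ i < 12 → π i = i := fun i h => if_neg h
  have lt : ∀ i, π i < 12 ↔ i < 12 := by
    intro i
    by_cases h : i < 12
    · rw [π1 i h]
      exact ⟨fun _ => h, fun _ => (hmem _).1 (List.getElem_mem _)⟩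
    · rw [π2 i h]
  have hmap : (List.range 12).map π = L := by
    apply List.ext_getElem
    · simp [hlen]
    · intro i h1 h2
      rw [List.getElem_map, List.getElem_range]
      exact π1 i (by omega)
  have hsplit : List.range 12 = (0 :: List.range' 1 p) ++ (List.range' (1 + p) q ++ List.range' (1 + p + q) L3.length) := by
    have e1 : (0 :: List.range' 1 p) = List.range' 0 (p + 1) := by
      rw [List.range'_succ]
    rw [e1, List.range'_append_1]
    have e2 := @List.range'_append_1 0 (p + 1) (q + L3.length)
    rw [show 0 + (p + 1) = 1 + p by omega] at e2
    rw [e2, List.range_eq_range']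
    congr 1
    omega
  rw [hsplit, List.map_append, List.map_append, hL, List.map_cons] at hmap
  have s1 := List.append_inj hmap (by simp [l1])
  have s2 := List.append_inj s1.2 (by simp [l2])
  have s3 := s1.1
  rw [List.cons_eq_cons] at s3
  refine ⟨π, ⟨?_, ?_⟩, s3.1, lt, s3.2, s2.1⟩
  · intro i j hij
    by_cases hi : i < 12 <;> by_cases hj : j < 12
    · rw [π1 i hi, π1 j hj] at hij
      exact (hn.getElem_inj_iff).1 hij
    · have := (lt i).2 hi; rw [hij, lt] at this; omega
    · have := (lt j).2 hj; rw [← hij, lt] at this; omega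
    · rwa [π2 i hi, π2 j hj] at hij
  · intro b
    by_cases hb : b < 12
    · obtain ⟨i, hi, hib⟩ := List.getElem_of_mem ((hmem b).2 hb)
      exact ⟨i, by rw [π1 i (by omega)]; exact hib⟩
    · exact ⟨b, π2 b hb⟩

theorem conf_of_label {χ : ℕ → ℕ → ℕ} (g : Good χ) {v : ℕ} (hv : v < 12) {p q : ℕ} (hp : (nb χ v 1).card = p)
    (hq : (nb χ v 2).card = q) {c : Cfg} (h1 : c.l1 = List.range' 1 p) (h2 : c.l2 = List.range' (1 + p) q)
    (hw : ∑ w ∈ nb χ v 1, gv χ v w + ∑ w ∈ nb χ v 2, gv χ v w ≤ c.bnd) : ∃ χ', Conf c χ' := by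
  obtain ⟨π, bij, h0, lt, e1, e2⟩ := exists_label g hv hp hq
  rw [← h1] at e1
  rw [← h2] at e2
  have g' : Good (fun i j => χ (π i) (π j)) := by
    refine ⟨fun i j => g.symm _ _, fun i j hi hj hij => ?_, fun i j hij => ?_, ?_, ?_⟩
    · exact g.rng _ _ ((lt i).2 hi) ((lt j).2 hj) (fun h => hij (bij.1 h))
    · obtain ⟨h1, h2, h3⟩ := g.supp _ _ hij
      exact ⟨(lt i).1 h1, (lt j).1 h2, fun h => h3 (by rw [h])⟩
    · intro c hc a b x y hab hxy
      exact g.c4 c hc _ _ _ _ (fun h => hab (bij.1 h)) (fun h => hxy (bij.1 h))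
    · intro a b c
      exact g.tri _ _ _
  have key : ∀ (l : List ℕ) (k : ℕ), k ≠ 0 → l.map π = (nb χ v k).toList → ∀ w, χ (π 0) (π w) = k ↔ w ∈ l := by
    intro l k hk hl w
    rw [h0, ← mem_nb g hk, ← Finset.mem_toList, ← hl, List.mem_map]
    constructor
    · rintro ⟨x, hx, hxw⟩
      rwa [← bij.1 hxw]
    · exact fun hw => ⟨w, hw, rfl⟩
  have hgw : ∀ w, gw (fun i j => χ (π i) (π j)) w = gv χ v (π w) := by
    intro w
    have hO : covO (fun i j => χ (π i) (π j)) 0 w ↔ covO χ v (π w) := by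
      simp only [covO, h0]
      constructor
      · rintro ⟨y, hy⟩; exact ⟨π y, hy⟩
      · rintro ⟨y, hy⟩
        obtain ⟨x, rfl⟩ := bij.2 y
        exact ⟨x, hy⟩
    have hS : covS (fun i j => χ (π i) (π j)) 0 w ↔ covS χ v (π w) := by
      simp only [covS, h0]
      constructor
      · rintro ⟨y, hy⟩; exact ⟨π y, hy⟩
      · rintro ⟨y, hy⟩
        obtain ⟨x, rfl⟩ := bij.2 y
        exact ⟨x, hy⟩
    classical
    unfold gw gv
    rw [if_congr hO rfl rfl, if_congr hS rfl rfl]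
  have hsum : ∀ (l : List ℕ) (k : ℕ), l.map π = (nb χ v k).toList →
      (l.map (gw (fun i j => χ (π i) (π j)))).sum = ∑ w ∈ nb χ v k, gv χ v w := by
    intro l k hl
    rw [← Finset.sum_map_toList, ← hl, List.map_map]
    congr 1
    apply List.map_congr_left
    intro w _
    exact hgw w
  refine ⟨_, g', key _ 1 (by omega) e1, key _ 2 (by omega) e2, ?_⟩
  rw [hsum _ 1 e1, hsum _ 2 e2]
  exact hw

theorem no_vertex {χ : ℕ → ℕ → ℕ} (g : Good χ) {v : ℕ} (hv : v < 12) {p q : ℕ} (hp : (nb χ v 1).card = p)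
    (hq : (nb χ v 2).card = q) (hpq : p ≤ q) (h11 : p + q ≤ 11)
    (hw : ((∑ w ∈ nb χ v 1, gv χ v w + ∑ w ∈ nb χ v 2, gv χ v w : ℕ) : ℤ) ≤
      4 * (p + q) + 3 * (p + q) * (11 - (p + q)) - 110) : False := by
  set W := ∑ w ∈ nb χ v 1, gv χ v w + ∑ w ∈ nb χ v 2, gv χ v w with hW
  have fin : ∀ c : Cfg, c.l1 = List.range' 1 p → c.l2 = List.range' (1 + p) q → W ≤ c.bnd → (∀ χ, ¬ Conf c χ) → False := by
    intro c h1 h2 h3 h4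
    obtain ⟨χ', h⟩ := conf_of_label g hv hp hq h1 h2 h3
    exact h4 χ' h
  clear_value W
  have hd : p + q = 5 ∨ p + q = 6 ∨ p + q = 7 := by
    have hs : ((p : ℤ) + q) = ((p + q : ℕ) : ℤ) := by push_cast; ring
    rw [hs] at hw
    generalize p + q = d at hw h11
    have : (0 : ℤ) ≤ (W : ℤ) := Int.natCast_nonneg _
    interval_cases d <;> omega
  have h5 : p + q = 5 → W ≤ 0 := by
    intro h
    have hs : ((p : ℤ) + q) = 5 := by exact_mod_cast h
    rw [hs] at hw; norm_num at hw; omega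
  have h6 : p + q = 6 → W ≤ 4 := by
    intro h
    have hs : ((p : ℤ) + q) = 6 := by exact_mod_cast h
    rw [hs] at hw; norm_num at hw; omega
  have h7 : p + q = 7 → W ≤ 2 := by
    intro h
    have hs : ((p : ℤ) + q) = 7 := by exact_mod_cast h
    rw [hs] at hw; norm_num at hw; omega
  have hp3 : p ≤ 3 := by omega
  clear hp hq hw
  rcases hd with hd | hd | hd
  · have hq : q = 5 - p := by omega
    have hb := h5 hd
    clear h5 h6 h7
    subst hq
    interval_cases p
    · exact fin cfg05 rfl rfl hb no_conf05
    · exact fin cfg14 rfl rfl hb no_conf14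
    · exact fin cfg23 rfl rfl hb no_conf23
    · omega
  · have hq : q = 6 - p := by omega
    have hb := h6 hd
    clear h5 h6 h7
    subst hq
    interval_cases p
    · exact fin cfg06 rfl rfl hb no_conf06
    · exact fin cfg15 rfl rfl hb no_conf15
    · exact fin cfg24 rfl rfl hb no_conf24
    · exact fin cfg33 rfl rfl hb no_conf33
  · have hq : q = 7 - p := by omega
    have hb := h7 hd
    clear h5 h6 h7
    subst hq
    interval_cases p
    · exact fin cfg07 rfl rfl hb no_conf07
    · exact fin cfg16 rfl rfl hb no_conf16
    · exact fin cfg25 rfl rfl hb no_conf25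
    · exact fin cfg34 rfl rfl hb no_conf34

/-- exchange colours 1 and 2 -/
def sw (n : ℕ) : ℕ := if n = 1 then 2 else if n = 2 then 1 else n

theorem sw_spec (n : ℕ) : (sw n = 1 ↔ n = 2) ∧ (sw n = 2 ↔ n = 1) ∧ (sw n = 3 ↔ n = 3) ∧ (sw n = 0 ↔ n = 0) := by
  unfold sw
  refine ⟨?_, ?_, ?_, ?_⟩ <;> split_ifs <;> first | omega | simp_all

theorem sw_inj {a b : ℕ} : sw a = sw b ↔ a = b := by
  unfold sw
  split_ifs <;> omega

theorem Good.swap {χ : ℕ → ℕ → ℕ} (g : Good χ) : Good (fun i j => sw (χ i j)) := by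
  refine ⟨fun i j => by show sw (χ i j) = sw (χ j i); rw [g.symm i j], fun i j hi hj hij => ?_, fun i j hij => ?_, ?_, ?_⟩
  · have := g.rng i j hi hj hij
    have := sw_spec (χ i j)
    show sw (χ i j) = 1 ∨ sw (χ i j) = 2 ∨ sw (χ i j) = 3
    omega
  · apply g.supp
    intro h
    exact hij ((sw_spec _).2.2.2.2 h)
  · rintro c (rfl | rfl) a b x y hab hxy h1 h2 h3 h4
    · exact g.c4 2 (Or.inr rfl) a b x y hab hxy ((sw_spec _).1.1 h1) ((sw_spec _).1.1 h2) ((sw_spec _).1.1 h3) ((sw_spec _).1.1 h4)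
    · exact g.c4 1 (Or.inl rfl) a b x y hab hxy ((sw_spec _).2.1.1 h1) ((sw_spec _).2.1.1 h2) ((sw_spec _).2.1.1 h3) ((sw_spec _).2.1.1 h4)
  · intro a b c h1 h2 h3
    exact g.tri a b c ((sw_spec _).2.2.1.1 h1) ((sw_spec _).2.2.1.1 h2) ((sw_spec _).2.2.1.1 h3)

theorem gv_swap (χ : ℕ → ℕ → ℕ) (v w : ℕ) : gv (fun i j => sw (χ i j)) v w = gv χ v w := by
  have hO : covO (fun i j => sw (χ i j)) v w ↔ covO χ v w := by
    unfold covO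
    simp only [sw_inj, ne_eq, (sw_spec _).1, (sw_spec _).2.1, or_comm]
  have hS : covS (fun i j => sw (χ i j)) v w ↔ covS χ v w := by
    unfold covS
    simp only [sw_inj]
  classical
  unfold gv
  rw [if_congr hO rfl rfl, if_congr hS rfl rfl]

theorem no_vertex' {χ : ℕ → ℕ → ℕ} (g : Good χ) {v : ℕ} (hv : v < 12) {p q : ℕ} (hp : (nb χ v 1).card = p)
    (hq : (nb χ v 2).card = q) (h11 : p + q ≤ 11)
    (hw : ((∑ w ∈ nb χ v 1, gv χ v w + ∑ w ∈ nb χ v 2, gv χ v w : ℕ) : ℤ) ≤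
      4 * (p + q) + 3 * (p + q) * (11 - (p + q)) - 110) : False := by
  rcases le_total p q with h | h
  · exact no_vertex g hv hp hq h h11 hw
  · have e1 : nb (fun i j => sw (χ i j)) v 1 = nb χ v 2 := by
      unfold nb; simp only [(sw_spec _).1]
    have e2 : nb (fun i j => sw (χ i j)) v 2 = nb χ v 1 := by
      unfold nb; simp only [(sw_spec _).2.1]
    refine no_vertex g.swap hv (p := q) (q := p) (by rw [e1, hq]) (by rw [e2, hp]) h (by omega) ?_
    simp only [gv_swap]
    rw [e1, e2, add_comm (∑ w ∈ nb χ v 2, gv χ v w), add_comm (q : ℤ)]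
    exact hw
end R75

namespace R75

/-! ## Goodman counting -/

section Goodman
variable {V : Type*}

theorem perm132 (s : Finset V) (F : V → V → V → ℤ) :
    ∑ x ∈ s, ∑ y ∈ s, ∑ z ∈ s, F x z y = ∑ x ∈ s, ∑ y ∈ s, ∑ z ∈ s, F x y z :=
  Finset.sum_congr rfl fun _ _ => Finset.sum_comm

theorem perm213 (s : Finset V) (F : V → V → V → ℤ) :
    ∑ x ∈ s, ∑ y ∈ s, ∑ z ∈ s, F y x z = ∑ x ∈ s, ∑ y ∈ s, ∑ z ∈ s, F x y z :=
  Finset.sum_comm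

theorem perm231 (s : Finset V) (F : V → V → V → ℤ) :
    ∑ x ∈ s, ∑ y ∈ s, ∑ z ∈ s, F y z x = ∑ x ∈ s, ∑ y ∈ s, ∑ z ∈ s, F x y z := by
  exact (perm213 s (fun x y z => F x z y)).trans (perm132 s F)

theorem perm312 (s : Finset V) (F : V → V → V → ℤ) :
    ∑ x ∈ s, ∑ y ∈ s, ∑ z ∈ s, F z x y = ∑ x ∈ s, ∑ y ∈ s, ∑ z ∈ s, F x y z := by
  exact (perm231 s (fun x y z => F z x y)).symm

/-- number of ordered triangles of a weighted graph -/
def Tr (s : Finset V) (a : V → V → ℤ) : ℤ := ∑ x ∈ s, ∑ y ∈ s, ∑ z ∈ s, a x y * a x z * a y z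

theorem goodman [DecidableEq V] (s : Finset V) (a : V → V → ℤ) (hs : ∀ x y, a x y = a y x) (h0 : ∀ x, a x x = 0)
    (hi : ∀ x y, a x y * a x y = a x y) :
    Tr s a + Tr s (fun x y => (if x = y then 0 else 1) - a x y) =
      (s.card : ℤ) * (s.card - 1) * (s.card - 2) -
        3 * ∑ x ∈ s, (∑ y ∈ s, a x y) * ((s.card - 1) - ∑ y ∈ s, a x y) := by
  set u : V → V → ℤ := fun x y => if x = y then 0 else 1 with hu
  set n : ℤ := (s.card : ℤ) with hn
  have us : ∀ x y, u x y = u y x := fun x y => by simp only [hu, eq_comm]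
  have u0 : ∀ x, u x x = 0 := fun x => by simp only [hu, if_true]
  have u1 : ∀ x y, u x y = 1 - if x = y then 1 else 0 := fun x y => by
    simp only [hu]; split_ifs <;> ring
  have au : ∀ x y, a x y * u x y = a x y := fun x y => by
    by_cases h : x = y
    · rw [h, h0, zero_mul]
    · simp only [hu, if_neg h, mul_one]
  have su : ∀ x ∈ s, ∑ y ∈ s, u x y = n - 1 := by
    intro x hx
    simp only [u1]
    rw [Finset.sum_sub_distrib, Finset.sum_ite_eq, if_pos hx, Finset.sum_const, nsmul_eq_mul, mul_one]
  -- common u-neighbours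
  have suu : ∀ x ∈ s, ∀ y ∈ s, ∑ z ∈ s, u x z * u y z = n - 2 + if x = y then 1 else 0 := by
    intro x hx y hy
    have : ∀ z, u x z * u y z = u x z - (if y = z then u x z else 0) := by
      intro z
      rw [u1 y z]
      split_ifs <;> ring
    simp only [this]
    rw [Finset.sum_sub_distrib, su x hx, Finset.sum_ite_eq, if_pos hy, u1]
    ring
  have S0 : ∑ x ∈ s, ∑ y ∈ s, ∑ z ∈ s, u x y * u x z * u y z = n * (n - 1) * (n - 2) := by
    have : ∀ x ∈ s, ∑ y ∈ s, ∑ z ∈ s, u x y * u x z * u y z = (n - 1) * (n - 2) := by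
      intro x hx
      rw [← su x hx, Finset.sum_mul]
      refine Finset.sum_congr rfl fun y hy => ?_
      simp only [mul_assoc]
      rw [← Finset.mul_sum, suu x hx y hy]
      by_cases h : x = y
      · rw [h, u0]; ring
      · rw [if_neg h]; ring
    rw [Finset.sum_congr rfl this, Finset.sum_const, nsmul_eq_mul]
    ring
  have S1 : ∑ x ∈ s, ∑ y ∈ s, ∑ z ∈ s, a x y * u x z * u y z = ∑ x ∈ s, (n - 2) * ∑ y ∈ s, a x y := by
    refine Finset.sum_congr rfl fun x hx => ?_
    rw [Finset.mul_sum]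
    refine Finset.sum_congr rfl fun y hy => ?_
    simp only [mul_assoc]
    rw [← Finset.mul_sum, suu x hx y hy]
    by_cases h : x = y
    · rw [h, h0]; ring
    · rw [if_neg h]; ring
  have S2 : ∑ x ∈ s, ∑ y ∈ s, ∑ z ∈ s, a x y * a x z * u y z =
      ∑ x ∈ s, ((∑ y ∈ s, a x y) * (∑ y ∈ s, a x y) - ∑ y ∈ s, a x y) := by
    refine Finset.sum_congr rfl fun x hx => ?_
    rw [Finset.sum_mul_sum, ← Finset.sum_sub_distrib]
    refine Finset.sum_congr rfl fun y hy => ?_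
    have : ∀ z, a x y * a x z * u y z = a x y * a x z - (if y = z then a x y * a x z else 0) := by
      intro z
      rw [u1 y z]
      split_ifs <;> ring
    simp only [this]
    rw [Finset.sum_sub_distrib, Finset.sum_ite_eq, if_pos hy, hi]
  have S1b := perm132 s (fun x y z => a x y * u x z * u y z)
  have S1c := perm231 s (fun x y z => a x y * u x z * u y z)
  have S2b := perm213 s (fun x y z => a x y * a x z * u y z)
  have S2c := perm312 s (fun x y z => a x y * a x z * u y z)
  have main : Tr s a + Tr s (fun x y => u x y - a x y) =
      ∑ x ∈ s, ∑ y ∈ s, ∑ z ∈ s, u x y * u x z * u y z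
      - ∑ x ∈ s, ∑ y ∈ s, ∑ z ∈ s, a x y * u x z * u y z
      - ∑ x ∈ s, ∑ y ∈ s, ∑ z ∈ s, a x z * u x y * u z y
      - ∑ x ∈ s, ∑ y ∈ s, ∑ z ∈ s, a y z * u y x * u z x
      + ∑ x ∈ s, ∑ y ∈ s, ∑ z ∈ s, a x y * a x z * u y z
      + ∑ x ∈ s, ∑ y ∈ s, ∑ z ∈ s, a y x * a y z * u x z
      + ∑ x ∈ s, ∑ y ∈ s, ∑ z ∈ s, a z x * a z y * u x y := by
    unfold Tr
    simp only [← Finset.sum_add_distrib, ← Finset.sum_sub_distrib]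
    refine Finset.sum_congr rfl fun x _ => Finset.sum_congr rfl fun y _ => Finset.sum_congr rfl fun z _ => ?_
    rw [us z y, us y x, us z x, hs y x, hs z x, hs z y]
    ring
  rw [main, S1b, S1c, S2b, S2c, S0, S1, S2, Finset.mul_sum]
  have : ∀ A B C : ℤ, C = 3 * A - 3 * B → n * (n - 1) * (n - 2) - A - A - A + B + B + B = n * (n - 1) * (n - 2) - C := by
    intro A B C h; rw [h]; ring
  apply this
  rw [Finset.mul_sum, Finset.mul_sum, ← Finset.sum_sub_distrib]
  refine Finset.sum_congr rfl fun x _ => ?_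
  ring

end Goodman

/-! ## Twelve vertices -/

theorem lemmaA (χ : ℕ → ℕ → ℕ) : ¬ Good χ := by
  intro g
  classical
  let s := Finset.range 12
  let e : ℕ → ℕ → ℕ → ℤ := fun c x y => if χ x y = c then 1 else 0
  let a : ℕ → ℕ → ℤ := fun x y => e 1 x y + e 2 x y
  have es : ∀ c x y, e c x y = e c y x := fun c x y => by simp only [e, g.symm x y]
  have ha : ∀ x y, a x y = if χ x y = 1 ∨ χ x y = 2 then 1 else 0 := by
    intro x y
    simp only [a, e]
    split_ifs <;> omega
  have as : ∀ x y, a x y = a y x := fun x y => by simp only [a, es _ x y]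
  have a0 : ∀ x, a x x = 0 := fun x => by rw [ha, g.diag, if_neg (by omega)]
  have ai : ∀ x y, a x y * a x y = a x y := fun x y => by rw [ha]; split_ifs <;> rfl
  have G := goodman s a as a0 ai
  have Tb : Tr s (fun x y => (if x = y then 0 else 1) - a x y) = 0 := by
    unfold Tr
    refine Finset.sum_eq_zero fun x hx => Finset.sum_eq_zero fun y hy => Finset.sum_eq_zero fun z hz => ?_
    have hb : ∀ x ∈ s, ∀ y ∈ s, χ x y ≠ 3 → (if x = y then 0 else 1) - a x y = 0 := by
      intro x hx y hy h
      by_cases hxy : x = y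
      · rw [if_pos hxy, hxy, a0]; rfl
      · have := g.rng x y (Finset.mem_range.1 hx) (Finset.mem_range.1 hy) hxy
        rw [if_neg hxy, ha, if_pos (by omega)]; rfl
    beta_reduce
    by_cases h1 : χ x y = 3
    · by_cases h2 : χ x z = 3
      · by_cases h3 : χ y z = 3
        · exact (g.tri x y z h1 h3 h2).elim
        · rw [hb y hy z hz h3, mul_zero]
      · rw [hb x hx z hz h2, mul_zero, zero_mul]
    · rw [hb x hx y hy h1, zero_mul, zero_mul]
  rw [Tb, add_zero] at G
  -- codegrees
  have cod : ∀ c, c = 1 ∨ c = 2 → ∀ x y, x ≠ y →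
      ∑ z ∈ s, e c x z * e c y z ≤ if ∃ z, χ x z = c ∧ χ y z = c then 1 else 0 := by
    intro c hc x y hxy
    split_ifs with h
    · obtain ⟨z, hz1, hz2⟩ := h
      have : ∀ w ∈ s, e c x w * e c y w ≤ if w = z then 1 else 0 := by
        intro w _
        simp only [e]
        by_cases hw : w = z
        · rw [if_pos hw]; split_ifs <;> norm_num
        · rw [if_neg hw]
          by_cases hw1 : χ x w = c
          · by_cases hw2 : χ y w = c
            · exact (g.c4 c hc x y z w hxy (Ne.symm hw) hz1 hw1 hz2 hw2).elim
            · rw [if_neg hw2, mul_zero]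
          · rw [if_neg hw1, zero_mul]
      refine (Finset.sum_le_sum this).trans ?_
      rw [Finset.sum_ite_eq']
      split_ifs <;> norm_num
    · refine le_of_eq (Finset.sum_eq_zero fun z _ => ?_)
      simp only [e]
      by_cases hw1 : χ x z = c
      · by_cases hw2 : χ y z = c
        · exact (h ⟨z, hw1, hw2⟩).elim
        · rw [if_neg hw2, mul_zero]
      · rw [if_neg hw1, zero_mul]
  let m : ℕ → ℕ → ℕ → ℤ := fun x y z => e 1 x y * (e 1 x z * e 1 y z) + e 2 x y * (e 2 x z * e 2 y z)
  let o : ℕ → ℕ → ℕ → ℤ := fun x y z => e 1 x y * (e 2 x z * e 2 y z) + e 2 x y * (e 1 x z * e 1 y z)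
  have Ta : Tr s a = ∑ x ∈ s, ∑ y ∈ s, ∑ z ∈ s, (m x y z + 3 * o x y z) := by
    have p1 := perm132 s o
    have p2 := perm231 s o
    have : Tr s a = ∑ x ∈ s, ∑ y ∈ s, ∑ z ∈ s, m x y z + ∑ x ∈ s, ∑ y ∈ s, ∑ z ∈ s, o x y z
      + ∑ x ∈ s, ∑ y ∈ s, ∑ z ∈ s, o x z y + ∑ x ∈ s, ∑ y ∈ s, ∑ z ∈ s, o y z x := by
      unfold Tr
      simp only [← Finset.sum_add_distrib]
      refine Finset.sum_congr rfl fun x _ => Finset.sum_congr rfl fun y _ => Finset.sum_congr rfl fun z _ => ?_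
      simp only [a, m, o]
      rw [es 1 z y, es 2 z y, es 1 y x, es 2 y x, es 1 z x, es 2 z x]
      ring
    rw [this, p1, p2]
    simp only [Finset.sum_add_distrib, ← Finset.mul_sum]
    ring
  have bound : ∀ x y, ∑ z ∈ s, (m x y z + 3 * o x y z) ≤ a x y * (4 - gv χ x y) := by
    intro x y
    have e1 : ∑ z ∈ s, (m x y z + 3 * o x y z) =
        e 1 x y * (∑ z ∈ s, e 1 x z * e 1 y z + 3 * ∑ z ∈ s, e 2 x z * e 2 y z) +
        e 2 x y * (∑ z ∈ s, e 2 x z * e 2 y z + 3 * ∑ z ∈ s, e 1 x z * e 1 y z) := by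
      simp only [Finset.mul_sum, mul_add, ← Finset.sum_add_distrib]
      refine Finset.sum_congr rfl fun z _ => ?_
      simp only [m, o]
      ring
    rw [e1, ha]
    by_cases hxy : x = y
    · have := g.diag y
      subst hxy
      simp [e, this]
    have c1 := cod 1 (Or.inl rfl) x y hxy
    have c2 := cod 2 (Or.inr rfl) x y hxy
    by_cases h1 : χ x y = 1
    · have hS : covS χ x y ↔ ∃ z, χ x z = 1 ∧ χ y z = 1 := by simp only [covS, h1]
      have hO : covO χ x y ↔ ∃ z, χ x z = 2 ∧ χ y z = 2 := by
        simp only [covO, h1]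
        refine exists_congr fun z => ?_
        omega
      rw [← if_congr hS rfl rfl] at c1
      rw [← if_congr hO rfl rfl] at c2
      have t1 : e 1 x y = 1 := if_pos h1
      have t2 : e 2 x y = 0 := if_neg (by omega)
      rw [t1, t2, if_pos (Or.inl h1)]
      unfold gv
      split_ifs at * <;> push_cast <;> linarith
    · by_cases h2 : χ x y = 2
      · have hS : covS χ x y ↔ ∃ z, χ x z = 2 ∧ χ y z = 2 := by simp only [covS, h2]
        have hO : covO χ x y ↔ ∃ z, χ x z = 1 ∧ χ y z = 1 := by
          simp only [covO, h2]
          refine exists_congr fun z => ?_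
          omega
        rw [← if_congr hS rfl rfl] at c2
        rw [← if_congr hO rfl rfl] at c1
        have t1 : e 1 x y = 0 := if_neg h1
        have t2 : e 2 x y = 1 := if_pos h2
        rw [t1, t2, if_pos (Or.inr h2)]
        unfold gv
        split_ifs at * <;> push_cast <;> linarith
      · have t1 : e 1 x y = 0 := if_neg h1
        have t2 : e 2 x y = 0 := if_neg h2
        rw [t1, t2, if_neg (by omega)]
        simp
  have hd : ∀ x, ∑ y ∈ s, a x y = (nb χ x 1).card + (nb χ x 2).card := by
    intro x
    simp only [a, e, Finset.sum_add_distrib, nb, Finset.card_filter]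
    push_cast
    rfl
  have hW : ∀ x, ∑ y ∈ s, a x y * (gv χ x y : ℤ) =
      ((∑ w ∈ nb χ x 1, gv χ x w + ∑ w ∈ nb χ x 2, gv χ x w : ℕ) : ℤ) := by
    intro x
    simp only [a, e, add_mul, Finset.sum_add_distrib, nb, Finset.sum_filter, ite_mul, one_mul, zero_mul]
    push_cast
    rfl
  have tot : ∑ x ∈ s, (((∑ w ∈ nb χ x 1, gv χ x w + ∑ w ∈ nb χ x 2, gv χ x w : ℕ) : ℤ) -
      (4 * ((nb χ x 1).card + (nb χ x 2).card) + 3 * ((nb χ x 1).card + (nb χ x 2).card) *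
        (11 - ((nb χ x 1).card + (nb χ x 2).card)) - 110)) ≤ 0 := by
    have b2 : Tr s a ≤ ∑ x ∈ s, ∑ y ∈ s, a x y * (4 - gv χ x y) := by
      rw [Ta]
      exact Finset.sum_le_sum fun x _ => Finset.sum_le_sum fun y _ => bound x y
    have hc : (s.card : ℤ) = 12 := by simp [s]
    rw [G, hc] at b2
    rw [← sub_nonneg, Finset.mul_sum] at b2
    have e1 : (12 : ℤ) * (12 - 1) * (12 - 2) = ∑ x ∈ s, (110 : ℤ) := by simp [s]
    rw [e1, ← Finset.sum_sub_distrib, ← Finset.sum_sub_distrib] at b2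
    rw [← neg_nonneg, ← Finset.sum_neg_distrib]
    refine b2.trans (le_of_eq (Finset.sum_congr rfl fun x _ => ?_))
    rw [← hW, ← hd]
    simp only [mul_sub, Finset.sum_sub_distrib, ← Finset.sum_mul]
    ring
  have : ∃ x ∈ s, (((∑ w ∈ nb χ x 1, gv χ x w + ∑ w ∈ nb χ x 2, gv χ x w : ℕ) : ℤ) -
      (4 * ((nb χ x 1).card + (nb χ x 2).card) + 3 * ((nb χ x 1).card + (nb χ x 2).card) *
        (11 - ((nb χ x 1).card + (nb χ x 2).card)) - 110)) ≤ 0 := by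
    by_contra hcon
    push Not at hcon
    exact absurd tot (not_le.2 (Finset.sum_pos hcon ⟨0, by simp [s]⟩))
  obtain ⟨v, hv, hle⟩ := this
  have h11 : (nb χ v 1).card + (nb χ v 2).card ≤ 11 := by
    rw [← Finset.card_union_of_disjoint]
    · have : nb χ v 1 ∪ nb χ v 2 ⊆ s.erase v := by
        intro w hw
        rw [Finset.mem_union, mem_nb g (by omega), mem_nb g (by omega)] at hw
        obtain ⟨_, h2, h3⟩ := g.supp v w (by omega)
        exact Finset.mem_erase.2 ⟨Ne.symm h3, Finset.mem_range.2 h2⟩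
      refine (Finset.card_le_card this).trans ?_
      rw [Finset.card_erase_of_mem hv]
      simp [s]
    · rw [Finset.disjoint_left]
      intro w h1 h2
      rw [mem_nb g (by omega)] at h1 h2
      omega
  exact no_vertex' g (Finset.mem_range.1 hv) rfl rfl h11 (by linarith)
end R75

namespace R75

/-! ## The upper levels -/

section Top
set_option linter.unusedSectionVars false
variable {V : Type*} [DecidableEq V]

/-- symmetric colouring of a complete graph with colours 1, 2, 3, 4 and no `C₄` in colours 1 and 2 -/
structure Col (k : V → V → ℕ) : Prop where
  symm : ∀ x y, k x y = k y x
  diag : ∀ x, k x x = 0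
  rng : ∀ x y, x ≠ y → k x y = 1 ∨ k x y = 2 ∨ k x y = 3 ∨ k x y = 4
  c4 : ∀ c, c = 1 ∨ c = 2 → ∀ a b x y, a ≠ b → x ≠ y → k a x = c → k a y = c → k b x = c → k b y = c → False

theorem small {k : V → V → ℕ} (h : Col k) (W : Finset V) (t : ℕ)
    (hW : ∀ x ∈ W, ∀ y ∈ W, x ≠ y → k x y = 1 ∨ k x y = 2 ∨ k x y = t)
    (tri : ∀ x ∈ W, ∀ y ∈ W, ∀ z ∈ W, k x y = t → k y z = t → k x z = t → False) : W.card ≤ 11 := by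
  by_contra hc
  obtain ⟨W', hsub, hcard⟩ := Finset.exists_subset_card_eq (show 12 ≤ W.card by omega)
  let e : Fin 12 ≃ W' := (W'.equivFinOfCardEq hcard).symm
  let f : ℕ → V := fun i => if hi : i < 12 then (e ⟨i, hi⟩ : V) else (e ⟨0, by omega⟩ : V)
  have f1 : ∀ i (hi : i < 12), f i = (e ⟨i, hi⟩ : V) := fun i hi => dif_pos hi
  have fW : ∀ i, i < 12 → f i ∈ W := fun i hi => by rw [f1 i hi]; exact hsub (e ⟨i, hi⟩).2
  have finj : ∀ i j, i < 12 → j < 12 → i ≠ j → f i ≠ f j := by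
    intro i j hi hj hij hf
    rw [f1 i hi, f1 j hj] at hf
    have := e.injective (Subtype.ext hf)
    exact hij (by simpa using this)
  let χ : ℕ → ℕ → ℕ := fun i j => if i < 12 ∧ j < 12 ∧ i ≠ j then
    (if k (f i) (f j) = 1 then 1 else if k (f i) (f j) = 2 then 2 else 3) else 0
  have supp : ∀ i j, χ i j ≠ 0 → i < 12 ∧ j < 12 ∧ i ≠ j := by
    intro i j hij
    by_contra hn
    exact hij (if_neg hn)
  have val : ∀ i j, i < 12 ∧ j < 12 ∧ i ≠ j →
      χ i j = if k (f i) (f j) = 1 then 1 else if k (f i) (f j) = 2 then 2 else 3 := fun i j hij => if_pos hij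
  have v12 : ∀ i j c, c = 1 ∨ c = 2 → χ i j = c → (i < 12 ∧ j < 12 ∧ i ≠ j) ∧ k (f i) (f j) = c := by
    intro i j c hc hij
    have hs := supp i j (by omega)
    refine ⟨hs, ?_⟩
    rw [val i j hs] at hij
    split_ifs at hij <;> omega
  have v3 : ∀ i j, χ i j = 3 → (i < 12 ∧ j < 12 ∧ i ≠ j) ∧ k (f i) (f j) = t := by
    intro i j hij
    have hs := supp i j (by omega)
    refine ⟨hs, ?_⟩
    rw [val i j hs] at hij
    have := hW _ (fW i hs.1) _ (fW j hs.2.1) (finj i j hs.1 hs.2.1 hs.2.2)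
    split_ifs at hij <;> omega
  apply lemmaA χ
  refine ⟨?_, ?_, supp, ?_, ?_⟩
  · intro i j
    simp only [χ, h.symm (f i) (f j)]
    refine if_congr ⟨fun h => ⟨h.2.1, h.1, Ne.symm h.2.2⟩, fun h => ⟨h.2.1, h.1, Ne.symm h.2.2⟩⟩ rfl rfl
  · intro i j hi hj hij
    rw [val i j ⟨hi, hj, hij⟩]
    split_ifs <;> omega
  · intro c hc a b x y hab hxy h1 h2 h3 h4
    obtain ⟨s1, h1⟩ := v12 _ _ c hc h1
    obtain ⟨s2, h2⟩ := v12 _ _ c hc h2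
    obtain ⟨s3, h3⟩ := v12 _ _ c hc h3
    obtain ⟨s4, h4⟩ := v12 _ _ c hc h4
    exact h.c4 c hc _ _ _ _ (finj a b s1.1 s3.1 hab) (finj x y s1.2.1 s2.2.1 hxy) h1 h2 h3 h4
  · intro a b c h1 h2 h3
    obtain ⟨s1, h1⟩ := v3 _ _ h1
    obtain ⟨s2, h2⟩ := v3 _ _ h2
    obtain ⟨s3, h3⟩ := v3 _ _ h3
    exact tri _ (fW a s1.1) _ (fW b s1.2.1) _ (fW c s2.2.1) h1 h2 h3

/-- indicator of a colour -/
def ei (k : V → V → ℕ) (c : ℕ) (x y : V) : ℤ := if k x y = c then 1 else 0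

/-- colour degree -/
def dg (k : V → V → ℕ) (s : Finset V) (c : ℕ) (x : V) : ℤ := ∑ y ∈ s, ei k c x y

theorem dg_card (k : V → V → ℕ) (s : Finset V) (c : ℕ) (x : V) :
    dg k s c x = ((s.filter (fun y => k x y = c)).card : ℤ) := by
  unfold dg ei
  rw [Finset.card_filter]
  push_cast
  rfl

theorem ei_nonneg (k : V → V → ℕ) (c : ℕ) (x y : V) : 0 ≤ ei k c x y := by
  unfold ei; split_ifs <;> norm_num

theorem ei_symm {k : V → V → ℕ} (h : Col k) (c : ℕ) (x y : V) : ei k c x y = ei k c y x := by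
  unfold ei; rw [h.symm]

theorem ei_diag {k : V → V → ℕ} (h : Col k) {c : ℕ} (hc : c ≠ 0) (x : V) : ei k c x x = 0 := by
  unfold ei; rw [h.diag, if_neg hc.symm]

theorem ei_idem (k : V → V → ℕ) (c : ℕ) (x y : V) : ei k c x y * ei k c x y = ei k c x y := by
  unfold ei; split_ifs <;> norm_num

theorem ei_sum {k : V → V → ℕ} (h : Col k) (x y : V) :
    ei k 1 x y + ei k 2 x y + ei k 3 x y + ei k 4 x y = if x = y then 0 else 1 := by
  unfold ei
  by_cases hxy : x = y
  · rw [hxy, h.diag]; simp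
  · rw [if_neg hxy]
    rcases h.rng x y hxy with h | h | h | h <;> rw [h] <;> norm_num

theorem dg_sum {k : V → V → ℕ} (h : Col k) (s : Finset V) {x : V} (hx : x ∈ s) :
    dg k s 1 x + dg k s 2 x + dg k s 3 x + dg k s 4 x = s.card - 1 := by
  unfold dg
  simp only [← Finset.sum_add_distrib, ei_sum h]
  have : ∀ y, (if x = y then (0 : ℤ) else 1) = 1 - if x = y then 1 else 0 := by
    intro y; split_ifs <;> norm_num
  simp only [this]
  rw [Finset.sum_sub_distrib, Finset.sum_ite_eq, if_pos hx]
  simp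

theorem ei_mul (k : V → V → ℕ) (s : Finset V) (c c' : ℕ) (x y : V) :
    ∑ z ∈ s, ei k c x z * ei k c' y z = ((s.filter (fun z => k x z = c ∧ k y z = c')).card : ℤ) := by
  rw [Finset.card_filter]
  push_cast
  refine Finset.sum_congr rfl fun z _ => ?_
  unfold ei
  by_cases h1 : k x z = c <;> by_cases h2 : k y z = c' <;> simp [h1, h2]

theorem codeg {k : V → V → ℕ} (h : Col k) (s : Finset V) {c : ℕ} (hc : c = 1 ∨ c = 2) {x y : V} (hxy : x ≠ y) :
    ∑ z ∈ s, ei k c x z * ei k c y z ≤ 1 := by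
  rw [ei_mul]
  have : (s.filter (fun z => k x z = c ∧ k y z = c)).card ≤ 1 := by
    rw [Finset.card_le_one]
    intro a ha b hb
    rw [Finset.mem_filter] at ha hb
    by_contra hab
    exact h.c4 c hc x y a b hxy hab ha.2.1 hb.2.1 ha.2.2 hb.2.2
  exact_mod_cast this

theorem cherry {k : V → V → ℕ} (h : Col k) (s : Finset V) {c : ℕ} (hc : c = 1 ∨ c = 2) :
    ∑ x ∈ s, (dg k s c x * dg k s c x - dg k s c x) ≤ s.card * (s.card - 1) := by
  have e1 : ∑ x ∈ s, dg k s c x * dg k s c x = ∑ y ∈ s, ∑ z ∈ s, ∑ x ∈ s, ei k c y x * ei k c z x := by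
    rw [← perm231 s (fun y z x => ei k c y x * ei k c z x)]
    refine Finset.sum_congr rfl fun x _ => ?_
    unfold dg
    rw [Finset.sum_mul_sum]
    refine Finset.sum_congr rfl fun y _ => Finset.sum_congr rfl fun z _ => ?_
    rw [ei_symm h c x y, ei_symm h c x z]
  have e2 : ∀ y ∈ s, ∑ z ∈ s, ∑ x ∈ s, ei k c y x * ei k c z x ≤ (s.card - 1) + dg k s c y := by
    intro y hy
    have : ∀ z ∈ s, ∑ x ∈ s, ei k c y x * ei k c z x ≤ 1 + if y = z then dg k s c y - 1 else 0 := by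
      intro z _
      by_cases hyz : y = z
      · rw [if_pos hyz, ← hyz]
        simp only [ei_idem]
        unfold dg
        linarith
      · rw [if_neg hyz, add_zero]
        exact codeg h s hc hyz
    refine (Finset.sum_le_sum this).trans ?_
    rw [Finset.sum_add_distrib, Finset.sum_ite_eq, if_pos hy]
    simp
    linarith
  rw [Finset.sum_sub_distrib, e1]
  have := Finset.sum_le_sum e2
  rw [Finset.sum_add_distrib, Finset.sum_const, nsmul_eq_mul] at this
  linarith

theorem lemmaC {k : V → V → ℕ} (h : Col k) (W : Finset V)
    (tri3 : ∀ x ∈ W, ∀ y ∈ W, ∀ z ∈ W, k x y = 3 → k y z = 3 → k x z = 3 → False)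
    (tri4 : ∀ x ∈ W, ∀ y ∈ W, ∀ z ∈ W, k x y = 4 → k y z = 4 → k x z = 4 → False) : W.card ≤ 35 := by
  by_contra hc
  obtain ⟨s, hsub, hcard⟩ := Finset.exists_subset_card_eq (show 36 ≤ W.card by omega)
  have hcZ : (s.card : ℤ) = 36 := by rw [hcard]; norm_num
  have d3 : ∀ x ∈ s, dg k s 3 x ≤ 11 := by
    intro x hx
    rw [dg_card]
    have := small h (s.filter (fun y => k x y = 3)) 4 ?_ ?_
    · exact_mod_cast this
    · intro a ha b hb hab
      rw [Finset.mem_filter] at ha hb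
      have h1 := h.rng a b hab
      have h2 : k a b ≠ 3 := fun h3 => tri3 x (hsub hx) a (hsub ha.1) b (hsub hb.1) ha.2 h3 hb.2
      omega
    · intro a ha b hb c hc
      rw [Finset.mem_filter] at ha hb hc
      exact tri4 a (hsub ha.1) b (hsub hb.1) c (hsub hc.1)
  have d4 : ∀ x ∈ s, dg k s 4 x ≤ 11 := by
    intro x hx
    rw [dg_card]
    have := small h (s.filter (fun y => k x y = 4)) 3 ?_ ?_
    · exact_mod_cast this
    · intro a ha b hb hab
      rw [Finset.mem_filter] at ha hb
      have h1 := h.rng a b hab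
      have h2 : k a b ≠ 4 := fun h3 => tri4 x (hsub hx) a (hsub ha.1) b (hsub hb.1) ha.2 h3 hb.2
      omega
    · intro a ha b hb c hc
      rw [Finset.mem_filter] at ha hb hc
      exact tri3 a (hsub ha.1) b (hsub hb.1) c (hsub hc.1)
  have c1 := cherry h s (c := 1) (Or.inl rfl)
  have c2 := cherry h s (c := 2) (Or.inr rfl)
  have low : ∀ x ∈ s, 71 ≤ (dg k s 1 x * dg k s 1 x - dg k s 1 x) + (dg k s 2 x * dg k s 2 x - dg k s 2 x) := by
    intro x hx
    have e := dg_sum h s hx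
    have := d3 x hx
    have := d4 x hx
    rw [hcZ] at e
    nlinarith [sq_nonneg (dg k s 1 x - dg k s 2 x), sq_nonneg (dg k s 1 x + dg k s 2 x - 13)]
  have := Finset.sum_le_sum low
  rw [Finset.sum_add_distrib, Finset.sum_const, hcard, nsmul_eq_mul] at this
  rw [hcZ] at c1 c2
  push_cast at this
  linarith

theorem Tr12_le {k : V → V → ℕ} (h : Col k) (s : Finset V) :
    Tr s (fun x y => ei k 1 x y + ei k 2 x y) ≤ ∑ x ∈ s, 4 * (dg k s 1 x + dg k s 2 x) := by
  let m : V → V → V → ℤ := fun x y z =>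
    ei k 1 x y * (ei k 1 x z * ei k 1 y z) + ei k 2 x y * (ei k 2 x z * ei k 2 y z)
  let o : V → V → V → ℤ := fun x y z =>
    ei k 1 x y * (ei k 2 x z * ei k 2 y z) + ei k 2 x y * (ei k 1 x z * ei k 1 y z)
  have Ta : Tr s (fun x y => ei k 1 x y + ei k 2 x y) = ∑ x ∈ s, ∑ y ∈ s, ∑ z ∈ s, (m x y z + 3 * o x y z) := by
    have p1 := perm132 s o
    have p2 := perm231 s o
    have : Tr s (fun x y => ei k 1 x y + ei k 2 x y) = ∑ x ∈ s, ∑ y ∈ s, ∑ z ∈ s, m x y z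
      + ∑ x ∈ s, ∑ y ∈ s, ∑ z ∈ s, o x y z
      + ∑ x ∈ s, ∑ y ∈ s, ∑ z ∈ s, o x z y + ∑ x ∈ s, ∑ y ∈ s, ∑ z ∈ s, o y z x := by
      unfold Tr
      simp only [← Finset.sum_add_distrib]
      refine Finset.sum_congr rfl fun x _ => Finset.sum_congr rfl fun y _ => Finset.sum_congr rfl fun z _ => ?_
      simp only [m, o]
      rw [ei_symm h 1 z y, ei_symm h 2 z y, ei_symm h 1 y x, ei_symm h 2 y x, ei_symm h 1 z x, ei_symm h 2 z x]
      ring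
    rw [this, p1, p2]
    simp only [Finset.sum_add_distrib, ← Finset.mul_sum]
    ring
  rw [Ta]
  refine Finset.sum_le_sum fun x _ => ?_
  have e0 : 4 * (dg k s 1 x + dg k s 2 x) = ∑ y ∈ s, 4 * (ei k 1 x y + ei k 2 x y) := by
    rw [← Finset.mul_sum, Finset.sum_add_distrib]; rfl
  rw [e0]
  refine Finset.sum_le_sum fun y _ => ?_
  have e1 : ∑ z ∈ s, (m x y z + 3 * o x y z) =
      ei k 1 x y * (∑ z ∈ s, ei k 1 x z * ei k 1 y z + 3 * ∑ z ∈ s, ei k 2 x z * ei k 2 y z) +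
      ei k 2 x y * (∑ z ∈ s, ei k 2 x z * ei k 2 y z + 3 * ∑ z ∈ s, ei k 1 x z * ei k 1 y z) := by
    simp only [Finset.mul_sum, mul_add, ← Finset.sum_add_distrib]
    refine Finset.sum_congr rfl fun z _ => ?_
    simp only [m, o]
    ring
  rw [e1]
  by_cases hxy : x = y
  · subst hxy
    rw [ei_diag h (by norm_num), ei_diag h (by norm_num)]
    simp
  · have c1 := codeg h s (c := 1) (Or.inl rfl) hxy
    have c2 := codeg h s (c := 2) (Or.inr rfl) hxy
    have n1 := ei_nonneg k 1 x y
    have n2 := ei_nonneg k 2 x y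
    nlinarith

theorem Tr34_le {k : V → V → ℕ} (h : Col k) (K3 : ∀ a b c, k a b = 3 → k b c = 3 → k a c = 3 → False)
    (K4 : ∀ a b c d, k a b = 4 → k a c = 4 → k a d = 4 → k b c = 4 → k b d = 4 → k c d = 4 → False)
    (s : Finset V) :
    Tr s (fun x y => ei k 3 x y + ei k 4 x y) ≤ ∑ x ∈ s, (33 * dg k s 3 x + 44 * dg k s 4 x) := by
  let o : V → V → V → ℤ := fun x y z => ei k 3 x y * (ei k 3 x z * ei k 4 y z)
  let o' : V → V → V → ℤ := fun x y z => ei k 4 x y * (ei k 4 x z * ei k 3 y z)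
  let m : V → V → V → ℤ := fun x y z => ei k 4 x y * (ei k 4 x z * ei k 4 y z)
  have Ta : Tr s (fun x y => ei k 3 x y + ei k 4 x y) =
      ∑ x ∈ s, ∑ y ∈ s, ∑ z ∈ s, (m x y z + 3 * o x y z + 3 * o' x y z) := by
    have p1 := perm213 s o
    have p2 := perm312 s o
    have q1 := perm213 s o'
    have q2 := perm312 s o'
    have : Tr s (fun x y => ei k 3 x y + ei k 4 x y) = ∑ x ∈ s, ∑ y ∈ s, ∑ z ∈ s, m x y z
      + ∑ x ∈ s, ∑ y ∈ s, ∑ z ∈ s, o x y z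
      + ∑ x ∈ s, ∑ y ∈ s, ∑ z ∈ s, o y x z + ∑ x ∈ s, ∑ y ∈ s, ∑ z ∈ s, o z x y
      + ∑ x ∈ s, ∑ y ∈ s, ∑ z ∈ s, o' x y z
      + ∑ x ∈ s, ∑ y ∈ s, ∑ z ∈ s, o' y x z + ∑ x ∈ s, ∑ y ∈ s, ∑ z ∈ s, o' z x y := by
      unfold Tr
      simp only [← Finset.sum_add_distrib]
      refine Finset.sum_congr rfl fun x _ => Finset.sum_congr rfl fun y _ => Finset.sum_congr rfl fun z _ => ?_
      have h3 : ei k 3 x y * ei k 3 x z * ei k 3 y z = 0 := by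
        by_cases h1 : k x y = 3
        · by_cases h2 : k x z = 3
          · by_cases h3 : k y z = 3
            · exact (K3 x y z h1 h3 h2).elim
            · simp [ei, h3]
          · simp [ei, h2]
        · simp [ei, h1]
      simp only [m, o, o']
      rw [ei_symm h 3 z y, ei_symm h 4 z y, ei_symm h 3 y x, ei_symm h 4 y x, ei_symm h 3 z x, ei_symm h 4 z x]
      linear_combination h3
    rw [this, p1, p2, q1, q2]
    simp only [Finset.sum_add_distrib, ← Finset.mul_sum]
    ring
  rw [Ta]
  refine Finset.sum_le_sum fun x _ => ?_
  have e0 : 33 * dg k s 3 x + 44 * dg k s 4 x = ∑ y ∈ s, (33 * ei k 3 x y + 44 * ei k 4 x y) := by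
    rw [Finset.sum_add_distrib, ← Finset.mul_sum, ← Finset.mul_sum]; rfl
  rw [e0]
  refine Finset.sum_le_sum fun y _ => ?_
  have e1 : ∑ z ∈ s, (m x y z + 3 * o x y z + 3 * o' x y z) =
      ei k 4 x y * (∑ z ∈ s, ei k 4 x z * ei k 4 y z) + 3 * (ei k 3 x y * (∑ z ∈ s, ei k 3 x z * ei k 4 y z)) +
      3 * (ei k 4 x y * (∑ z ∈ s, ei k 4 x z * ei k 3 y z)) := by
    simp only [Finset.mul_sum, ← Finset.sum_add_distrib]
    rfl
  rw [e1]
  have b34 : ∀ x y, ∑ z ∈ s, ei k 3 x z * ei k 4 y z ≤ 11 := by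
    intro x y
    rw [ei_mul]
    have := small h (s.filter (fun z => k x z = 3 ∧ k y z = 4)) 4 ?_ ?_
    · exact_mod_cast this
    · intro a ha b hb hab
      rw [Finset.mem_filter] at ha hb
      have h1 := h.rng a b hab
      have h2 : k a b ≠ 3 := fun h3 => K3 x a b ha.2.1 h3 hb.2.1
      omega
    · intro a ha b hb c hc h1 h2 h3
      rw [Finset.mem_filter] at ha hb hc
      exact K4 y a b c ha.2.2 hb.2.2 hc.2.2 h1 h3 h2
  have b43 : ∑ z ∈ s, ei k 4 x z * ei k 3 y z ≤ 11 := by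
    have := b34 y x
    simp only [mul_comm (ei k 4 x _)]
    exact this
  have b44 : k x y = 4 → ∑ z ∈ s, ei k 4 x z * ei k 4 y z ≤ 11 := by
    intro hxy
    rw [ei_mul]
    have := small h (s.filter (fun z => k x z = 4 ∧ k y z = 4)) 3 ?_ ?_
    · exact_mod_cast this
    · intro a ha b hb hab
      rw [Finset.mem_filter] at ha hb
      have h1 := h.rng a b hab
      have h2 : k a b ≠ 4 := fun h3 => K4 x y a b hxy ha.2.1 hb.2.1 ha.2.2 hb.2.2 h3
      omega
    · intro a _ b _ c _
      exact K3 a b c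
  have b4 : ei k 4 x y * (∑ z ∈ s, ei k 4 x z * ei k 4 y z) ≤ 11 * ei k 4 x y := by
    by_cases h4 : k x y = 4
    · have := b44 h4
      have e4 : ei k 4 x y = 1 := if_pos h4
      rw [e4]
      linarith
    · have e4 : ei k 4 x y = 0 := if_neg h4
      rw [e4]
      linarith
  have n3 := ei_nonneg k 3 x y
  have n4 := ei_nonneg k 4 x y
  have b3 := mul_le_mul_of_nonneg_left (b34 x y) n3
  have b5 := mul_le_mul_of_nonneg_left b43 n4
  linarith

theorem top75 {k : V → V → ℕ} (h : Col k) (K3 : ∀ a b c, k a b = 3 → k b c = 3 → k a c = 3 → False)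
    (K4 : ∀ a b c d, k a b = 4 → k a c = 4 → k a d = 4 → k b c = 4 → k b d = 4 → k c d = 4 → False)
    (s : Finset V) (hs : s.card = 75) : False := by
  have hcZ : (s.card : ℤ) = 75 := by rw [hs]; norm_num
  have G := goodman s (fun x y => ei k 1 x y + ei k 2 x y) (fun x y => by rw [ei_symm h 1, ei_symm h 2])
    (fun x => by rw [ei_diag h (by norm_num), ei_diag h (by norm_num)]; rfl)
    (fun x y => by unfold ei; split_ifs <;> omega)
  have eb : (fun x y => (if x = y then 0 else 1) - (ei k 1 x y + ei k 2 x y)) =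
      fun x y => ei k 3 x y + ei k 4 x y := by
    funext x y
    rw [← ei_sum h]
    ring
  have t1 := Tr12_le h s
  have t2 := Tr34_le h K3 K4 s
  rw [eb, hcZ] at G
  have ed : ∀ x, ∑ y ∈ s, (ei k 1 x y + ei k 2 x y) = dg k s 1 x + dg k s 2 x := fun x => Finset.sum_add_distrib
  simp only [ed] at G
  have c1 := cherry h s (c := 1) (Or.inl rfl)
  have c2 := cherry h s (c := 2) (Or.inr rfl)
  rw [hcZ] at c1 c2
  have d4 : ∀ x, dg k s 4 x ≤ 35 := by
    intro x
    rw [dg_card]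
    have := lemmaC h (s.filter (fun y => k x y = 4)) (fun a _ b _ c _ => K3 a b c) ?_
    · exact_mod_cast this
    · intro a ha b hb c hc h1 h2 h3
      rw [Finset.mem_filter] at ha hb hc
      exact K4 x a b c ha.2 hb.2 hc.2 h1 h3 h2
  have per : ∀ x ∈ s, 3 * ((dg k s 1 x + dg k s 2 x) * (75 - 1 - (dg k s 1 x + dg k s 2 x))) +
      4 * (dg k s 1 x + dg k s 2 x) + (33 * dg k s 3 x + 44 * dg k s 4 x) -
      5 * (dg k s 1 x * dg k s 1 x - dg k s 1 x) - 5 * (dg k s 2 x * dg k s 2 x - dg k s 2 x) ≤ 5349 - 5 * 148 := by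
    intro x hx
    have e := dg_sum h s hx
    have := d4 x
    rw [hcZ] at e
    have e3 : dg k s 3 x = 74 - dg k s 1 x - dg k s 2 x - dg k s 4 x := by linarith
    rw [e3]
    nlinarith [sq_nonneg (dg k s 1 x - dg k s 2 x), sq_nonneg (dg k s 1 x + dg k s 2 x - 18)]
  have tot := Finset.sum_le_sum per
  rw [Finset.sum_sub_distrib, Finset.sum_sub_distrib, Finset.sum_add_distrib, Finset.sum_add_distrib,
    ← Finset.mul_sum, ← Finset.mul_sum (a := (5 : ℤ)), ← Finset.mul_sum (a := (5 : ℤ)),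
    Finset.sum_const, hs, nsmul_eq_mul] at tot
  rw [show ((75 : ℕ) : ℤ) = 75 from rfl] at tot
  linarith

end Top
end R75

theorem R75.inj4 {V : Type*} {a b c d : V} (h1 : a ≠ b) (h2 : a ≠ c) (h3 : a ≠ d) (h4 : b ≠ c) (h5 : b ≠ d)
    (h6 : c ≠ d) : Function.Injective ![a, b, c, d] := by
  intro u v huv
  fin_cases u <;> fin_cases v <;> first
    | rfl
    | exact (h1 huv).elim | exact (h2 huv).elim | exact (h3 huv).elim
    | exact (h4 huv).elim | exact (h5 huv).elim | exact (h6 huv).elim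
    | exact (h1 huv.symm).elim | exact (h2 huv.symm).elim | exact (h3 huv.symm).elim
    | exact (h4 huv.symm).elim | exact (h5 huv.symm).elim | exact (h6 huv.symm).elim

theorem R75.inj3 {V : Type*} {a b c : V} (h1 : a ≠ b) (h2 : a ≠ c) (h4 : b ≠ c) :
    Function.Injective ![a, b, c] := by
  intro u v huv
  fin_cases u <;> fin_cases v <;> first
    | rfl
    | exact (h1 huv).elim | exact (h2 huv).elim | exact (h4 huv).elim
    | exact (h1 huv.symm).elim | exact (h2 huv.symm).elim | exact (h4 huv.symm).elim

/-- `R(C₄, C₄, K₃, K₄) ≤ 75`. -/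
theorem statement15 : ramseyNumber [C4, C4, Kc 3, Kc 4] ≤ 75 := by
  refine Nat.sInf_le ⟨by norm_num, ?_⟩
  intro c
  by_contra hno
  push Not at hno
  have hc : ∀ i : Fin 4, ∀ f : (([C4, C4, Kc 3, Kc 4] : List VGraph).get i).V ↪ Fin 75,
      ¬ ∀ u v, (([C4, C4, Kc 3, Kc 4] : List VGraph).get i).G.Adj u v → c s(f u, f v) = i := by
    intro i f h
    obtain ⟨u, v, h1, h2⟩ := hno i f
    exact h2 (h u v h1)
  let k : Fin 75 → Fin 75 → ℕ := fun x y => if x = y then 0 else (c s(x, y)).val + 1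
  have kv : ∀ (i : Fin 4) x y, k x y = i.val + 1 → x ≠ y ∧ c s(x, y) = i := by
    intro i x y h
    by_cases hxy : x = y
    · simp only [k, if_pos hxy] at h
      omega
    · simp only [k, if_neg hxy] at h
      exact ⟨hxy, Fin.ext (by omega)⟩
  have diag : ∀ x, k x x = 0 := fun x => if_pos rfl
  have symm : ∀ x y, k x y = k y x := by
    intro x y
    simp only [k, Sym2.eq_swap, eq_comm]
  have cyc : ∀ i : Fin 4, (∀ f : Fin 4 ↪ Fin 75, ¬ ∀ u v, (SimpleGraph.cycleGraph 4).Adj u v → c s(f u, f v) = i) →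
      ∀ a b x y, a ≠ b → x ≠ y → k a x = i.val + 1 → k a y = i.val + 1 → k b x = i.val + 1 → k b y = i.val + 1 →
        False := by
    intro i hi a b x y hab hxy h1 h2 h3 h4
    obtain ⟨n1, h1⟩ := kv i _ _ h1
    obtain ⟨n2, h2⟩ := kv i _ _ h2
    obtain ⟨n3, h3⟩ := kv i _ _ h3
    obtain ⟨n4, h4⟩ := kv i _ _ h4
    have h1' : c s(x, a) = i := by rw [Sym2.eq_swap]; exact h1
    have h2' : c s(y, a) = i := by rw [Sym2.eq_swap]; exact h2
    have h3' : c s(x, b) = i := by rw [Sym2.eq_swap]; exact h3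
    have h4' : c s(y, b) = i := by rw [Sym2.eq_swap]; exact h4
    refine hi ⟨![a, x, b, y], ?_⟩ ?_
    · exact R75.inj4 n1 hab n2 n3.symm hxy n4
    · intro u v huv
      rw [SimpleGraph.cycleGraph_adj'] at huv
      fin_cases u <;> fin_cases v <;> first | assumption | (exfalso; revert huv; decide)
  have hCol : R75.Col k := by
    refine ⟨symm, diag, ?_, ?_⟩
    · intro x y hxy
      simp only [k, if_neg hxy]
      have : (c s(x, y)).val < 4 := (c s(x, y)).isLt
      omega
    · rintro c (rfl | rfl)
      · exact cyc 0 (hc 0)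
      · exact cyc 1 (hc 1)
  refine R75.top75 hCol ?_ ?_ Finset.univ (by simp)
  · intro x y z h1 h2 h3
    obtain ⟨n1, h1⟩ := kv 2 _ _ h1
    obtain ⟨n2, h2⟩ := kv 2 _ _ h2
    obtain ⟨n3, h3⟩ := kv 2 _ _ h3
    have h1' : c s(y, x) = (2 : Fin 4) := by rw [Sym2.eq_swap]; exact h1
    have h2' : c s(z, y) = (2 : Fin 4) := by rw [Sym2.eq_swap]; exact h2
    have h3' : c s(z, x) = (2 : Fin 4) := by rw [Sym2.eq_swap]; exact h3
    have hi : ∀ f : Fin 3 ↪ Fin 75, ¬ ∀ u v : Fin 3, u ≠ v → c s(f u, f v) = (2 : Fin 4) := hc 2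
    refine hi ⟨![x, y, z], ?_⟩ ?_
    · exact R75.inj3 n1 n3 n2
    · intro u v huv
      fin_cases u <;> fin_cases v <;> first | assumption | (exfalso; revert huv; decide)
  · intro w x y z h1 h2 h3 h4 h5 h6
    obtain ⟨n1, h1⟩ := kv 3 _ _ h1
    obtain ⟨n2, h2⟩ := kv 3 _ _ h2
    obtain ⟨n3, h3⟩ := kv 3 _ _ h3
    obtain ⟨n4, h4⟩ := kv 3 _ _ h4
    obtain ⟨n5, h5⟩ := kv 3 _ _ h5
    obtain ⟨n6, h6⟩ := kv 3 _ _ h6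
    have h1' : c s(x, w) = (3 : Fin 4) := by rw [Sym2.eq_swap]; exact h1
    have h2' : c s(y, w) = (3 : Fin 4) := by rw [Sym2.eq_swap]; exact h2
    have h3' : c s(z, w) = (3 : Fin 4) := by rw [Sym2.eq_swap]; exact h3
    have h4' : c s(y, x) = (3 : Fin 4) := by rw [Sym2.eq_swap]; exact h4
    have h5' : c s(z, x) = (3 : Fin 4) := by rw [Sym2.eq_swap]; exact h5
    have h6' : c s(z, y) = (3 : Fin 4) := by rw [Sym2.eq_swap]; exact h6
    have hi : ∀ f : Fin 4 ↪ Fin 75, ¬ ∀ u v : Fin 4, u ≠ v → c s(f u, f v) = (3 : Fin 4) := hc 3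
    refine hi ⟨![w, x, y, z], ?_⟩ ?_
    · exact R75.inj4 n1 n2 n3 n4 n5 n6
    · intro u v huv
      fin_cases u <;> fin_cases v <;> first | assumption | (exfalso; revert huv; decide)
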